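/- Fix an integer m ≥ 1. Let V be a finite nonempty type and let q₀ : V → V → ℕ encode a quiver Q that is acyclic (admits no directed cycles; in particular no loops) and connected (its underlying undirected multigraph, with q₀ i j + q₀ j i edges between i and j, is connected). Let q be the associated m-coloured quiver, defined by q i j 0 = q₀ i j, q i j m = q₀ j i, and q i j c = 0 for every colour c different from 0 and m. Then the coloured mutation class of q (the set of all m-coloured quivers on V obtained from q by finite sequences of coloured mutations at vertices of V) is finite if and only if V has at most two elements or the symmetric integer matrix C indexed by V, with C i i = 2 and C i j = −(q₀ i j + q₀ j i) for i ≠ j, is positive semidefinite (the latter condition holds precisely when the underlying graph of Q is a Dynkin diagram of type A, D, E or an extended Dynkin diagram). -/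

import Mathlib

set_option linter.all false
/-- Coloured mutation at the vertex `v` of an `m`-coloured quiver encoded by its
arrow-count function `q : V → V → ZMod (m+1) → ℕ` (where `q i j c` is the number of
arrows of colour `c` from `i` to `j`). -/
def colMut (m : ℕ) {V : Type*} [DecidableEq V]
    (q : V → V → ZMod (m + 1) → ℕ) (v : V) : V → V → ZMod (m + 1) → ℕ :=
  fun i j c =>
    if i = v then q i j (c + 1)
    else if j = v then q i j (c - 1)
    else
      ((q i j c : ℤ) - ∑ t ∈ Finset.univ.filter (fun t => t ≠ c), (q i j t : ℤ)
        + ((q i v c : ℤ) - (q i v (c - 1) : ℤ)) * (q v j 0 : ℤ)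
        + (q i v (m : ZMod (m + 1)) : ℤ) * ((q v j c : ℤ) - (q v j (c + 1) : ℤ))).toNat


/-! abstract two-term complexes -/

structure CSES {A0 A1 B0 B1 C0 C1 : Type*}
    [AddCommGroup A0] [Module ℚ A0] [AddCommGroup A1] [Module ℚ A1]
    [AddCommGroup B0] [Module ℚ B0] [AddCommGroup B1] [Module ℚ B1]
    [AddCommGroup C0] [Module ℚ C0] [AddCommGroup C1] [Module ℚ C1]
    (dA : A0 →ₗ[ℚ] A1) (dB : B0 →ₗ[ℚ] B1) (dC : C0 →ₗ[ℚ] C1)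
    (f0 : A0 → B0) (f1 : A1 → B1) (g0 : B0 → C0) (g1 : B1 → C1) : Prop where
  f0z : f0 0 = 0
  f1z : f1 0 = 0
  g0s : ∀ x y, g0 (x - y) = g0 x - g0 y
  g1s : ∀ x y, g1 (x - y) = g1 x - g1 y
  i0 : ∀ x y, f0 x = f0 y → x = y
  i1 : ∀ x y, f1 x = f1 y → x = y
  s0 : ∀ z, ∃ y, g0 y = z
  s1 : ∀ z, ∃ y, g1 y = z
  c0 : ∀ x, g0 (f0 x) = 0
  c1 : ∀ x, g1 (f1 x) = 0
  e0 : ∀ y, g0 y = 0 → ∃ x, f0 x = y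
  e1 : ∀ y, g1 y = 0 → ∃ x, f1 x = y
  cf : ∀ x, dB (f0 x) = f1 (dA x)
  cg : ∀ x, dC (g0 x) = g1 (dB x)

def VH {A0 A1 : Type*} [AddCommGroup A0] [Module ℚ A0] [AddCommGroup A1] [Module ℚ A1]
    (d : A0 →ₗ[ℚ] A1) : Prop := ∀ x, d x = 0 → x = 0
def VE {A0 A1 : Type*} [AddCommGroup A0] [Module ℚ A0] [AddCommGroup A1] [Module ℚ A1]
    (d : A0 →ₗ[ℚ] A1) : Prop := ∀ y, ∃ x, d x = y

section CS
variable {A0 A1 B0 B1 C0 C1 : Type*}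
    [AddCommGroup A0] [Module ℚ A0] [AddCommGroup A1] [Module ℚ A1]
    [AddCommGroup B0] [Module ℚ B0] [AddCommGroup B1] [Module ℚ B1]
    [AddCommGroup C0] [Module ℚ C0] [AddCommGroup C1] [Module ℚ C1]
    {dA : A0 →ₗ[ℚ] A1} {dB : B0 →ₗ[ℚ] B1} {dC : C0 →ₗ[ℚ] C1}
    {f0 : A0 → B0} {f1 : A1 → B1} {g0 : B0 → C0} {g1 : B1 → C1}

theorem CSES.l1 (h : CSES dA dB dC f0 f1 g0 g1) (hB : VH dB) : VH dA := fun x hx => by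
  apply h.i0; rw [h.f0z]; apply hB; rw [h.cf, hx, h.f1z]

theorem CSES.l2 (h : CSES dA dB dC f0 f1 g0 g1) (hA : VH dA) (hC : VH dC) : VH dB := fun y hy => by
  have g1z : g1 0 = 0 := by simpa using h.g1s 0 0
  have : g0 y = 0 := hC _ (by rw [h.cg, hy, g1z])
  obtain ⟨x, rfl⟩ := h.e0 y this
  rw [hA x (h.i1 _ _ (by rw [← h.cf, hy, h.f1z])), h.f0z]

theorem CSES.l3 (h : CSES dA dB dC f0 f1 g0 g1) (hB : VH dB) (hA : VE dA) : VH dC := fun z hz => by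
  obtain ⟨w, rfl⟩ := h.s0 z
  rw [h.cg] at hz
  obtain ⟨u, hu⟩ := h.e1 _ hz
  obtain ⟨x, rfl⟩ := hA u
  have : w - f0 x = 0 := hB _ (by rw [map_sub, h.cf, hu, sub_self])
  rw [sub_eq_zero] at this
  rw [this, h.c0]

theorem CSES.l4 (h : CSES dA dB dC f0 f1 g0 g1) (hC : VH dC) (hB : VE dB) : VE dA := fun c => by
  obtain ⟨w, hw⟩ := hB (f1 c)
  have : g0 w = 0 := hC _ (by rw [h.cg, hw, h.c1])
  obtain ⟨x, rfl⟩ := h.e0 w this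
  exact ⟨x, h.i1 _ _ (by rw [← h.cf, hw])⟩

theorem CSES.l5 (h : CSES dA dB dC f0 f1 g0 g1) (hA : VE dA) (hC : VE dC) : VE dB := fun c => by
  obtain ⟨z, hz⟩ := hC (g1 c)
  obtain ⟨w, rfl⟩ := h.s0 z
  have : g1 (c - dB w) = 0 := by rw [h.g1s, ← hz, ← h.cg, sub_self]
  obtain ⟨e, he⟩ := h.e1 _ this
  obtain ⟨x, rfl⟩ := hA e
  exact ⟨w + f0 x, by rw [map_add, h.cf, he]; abel⟩

theorem CSES.l6 (h : CSES dA dB dC f0 f1 g0 g1) (hB : VE dB) : VE dC := fun c => by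
  obtain ⟨w, rfl⟩ := h.s1 c
  obtain ⟨y, rfl⟩ := hB w
  exact ⟨g0 y, h.cg y⟩
end CS

/-! representations -/
structure QRep {V : Type*} (Q : V → V → ℕ) where
  obj : V → Type
  [acg : ∀ i, AddCommGroup (obj i)]
  [mod : ∀ i, Module ℚ (obj i)]
  [fd : ∀ i, FiniteDimensional ℚ (obj i)]
  map : ∀ i j, Fin (Q i j) → obj i →ₗ[ℚ] obj j

attribute [instance] QRep.acg QRep.mod QRep.fd

section Reps
variable {V : Type*} {Q : V → V → ℕ}

abbrev QC0 (M N : QRep Q) := ∀ i, M.obj i →ₗ[ℚ] N.obj i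
abbrev QC1 (M N : QRep Q) := ∀ i j, Fin (Q i j) → (M.obj i →ₗ[ℚ] N.obj j)

def qd (M N : QRep Q) : QC0 M N →ₗ[ℚ] QC1 M N where
  toFun f := fun i j a => N.map i j a ∘ₗ f i - f j ∘ₗ M.map i j a
  map_add' f g := by
    funext i j a; ext x; simp; abel
  map_smul' c f := by
    funext i j a; ext x; simp [smul_sub]

theorem qd_apply (M N : QRep Q) (f : QC0 M N) (i j : V) (a : Fin (Q i j)) (x : M.obj i) :
    qd M N f i j a x = N.map i j a (f i x) - f j (M.map i j a x) := rfl

theorem qd_eq_zero (M N : QRep Q) (f : QC0 M N) :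
    qd M N f = 0 ↔ ∀ i j a x, f j (M.map i j a x) = N.map i j a (f i x) := by
  constructor
  · intro h i j a x
    have := congrArg (fun g => g i j a x) h
    simp only [qd_apply] at this
    exact (sub_eq_zero.mp this).symm
  · intro h; funext i j a; ext x; rw [qd_apply, h, sub_self]; rfl

def H0 (M N : QRep Q) : Prop := VH (qd M N)
def E0 (M N : QRep Q) : Prop := VE (qd M N)

structure QSES (A B C : QRep Q) where
  f : QC0 A B
  g : QC0 B C
  df : qd A B f = 0
  dg : qd B C g = 0
  inj : ∀ i, Function.Injective (f i)
  sur : ∀ i, Function.Surjective (g i)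
  ex : ∀ i, Function.Exact (f i) (g i)

theorem split_lemma {A B C : Type} [AddCommGroup A] [Module ℚ A] [AddCommGroup B] [Module ℚ B]
    [AddCommGroup C] [Module ℚ C] (f : A →ₗ[ℚ] B) (g : B →ₗ[ℚ] C)
    (hf : Function.Injective f) (hg : Function.Surjective g) (he : Function.Exact f g) :
    ∃ (r : B →ₗ[ℚ] A) (s : C →ₗ[ℚ] B), (∀ x, r (f x) = x) ∧ (∀ z, g (s z) = z) ∧
      ∀ y, f (r y) + s (g y) = y := by
  obtain ⟨s, hs⟩ := LinearMap.exists_rightInverse_of_surjective g (LinearMap.range_eq_top.mpr hg)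
  have hs' : ∀ z, g (s z) = z := fun z => LinearMap.congr_fun hs z
  let e := LinearEquiv.ofInjective f hf
  have hk : ∀ y, y - s (g y) ∈ LinearMap.range f := fun y => by
    have : g (y - s (g y)) = 0 := by simp [hs']
    exact (he _).mp this
  let p : B →ₗ[ℚ] LinearMap.range f := LinearMap.codRestrict _ (LinearMap.id - s ∘ₗ g) hk
  have hfe : ∀ w, f (e.symm w) = w := fun w => by
    have := congrArg Subtype.val (e.apply_symm_apply w)
    simpa [e] using this
  refine ⟨e.symm.toLinearMap ∘ₗ p, s, fun x => ?_, hs', fun y => ?_⟩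
  · apply hf
    simp only [LinearMap.comp_apply, LinearEquiv.coe_coe]
    rw [hfe]
    simp [p, he.apply_apply_eq_zero]
  · simp only [LinearMap.comp_apply, LinearEquiv.coe_coe]
    rw [hfe]; simp [p]

theorem QSES.cov {A B C : QRep Q} (S : QSES A B C) (Y : QRep Q) :
    CSES (qd Y A) (qd Y B) (qd Y C) (fun x i => S.f i ∘ₗ x i) (fun x i j a => S.f j ∘ₗ x i j a)
      (fun x i => S.g i ∘ₗ x i) (fun x i j a => S.g j ∘ₗ x i j a) := by
  choose r s hr hs hrs using fun i => split_lemma (S.f i) (S.g i) (S.inj i) (S.sur i) (S.ex i)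
  have hf := (qd_eq_zero _ _ _).mp S.df
  have hg := (qd_eq_zero _ _ _).mp S.dg
  have hgf : ∀ i x, S.g i (S.f i x) = 0 := fun i x => (S.ex i).apply_apply_eq_zero x
  constructor
  · funext i; simp
  · funext i j a; simp
  · intro x y; funext i; ext t; simp
  · intro x y; funext i j a; ext t; simp
  · intro x y h; funext i; ext t
    exact S.inj i (by have := congrFun h i; exact LinearMap.congr_fun this t)
  · intro x y h; funext i j a; ext t
    exact S.inj j (by have := congrFun (congrFun (congrFun h i) j) a
                      exact LinearMap.congr_fun this t)
  · intro z; exact ⟨fun i => s i ∘ₗ z i, by funext i; ext t; simp [hs]⟩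
  · intro z; exact ⟨fun i j a => s j ∘ₗ z i j a, by funext i j a; ext t; simp [hs]⟩
  · intro x; funext i; ext t; simp [hgf]
  · intro x; funext i j a; ext t; simp [hgf]
  · intro y h; refine ⟨fun i => r i ∘ₗ y i, ?_⟩
    funext i; ext t
    have h1 : S.g i (y i t) = 0 := LinearMap.congr_fun (congrFun h i) t
    have h2 := hrs i (y i t)
    rw [h1] at h2; simpa using h2
  · intro y h; refine ⟨fun i j a => r j ∘ₗ y i j a, ?_⟩
    funext i j a; ext t
    have h1 : S.g j (y i j a t) = 0 :=
      LinearMap.congr_fun (congrFun (congrFun (congrFun h i) j) a) t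
    have h2 := hrs j (y i j a t)
    rw [h1] at h2; simpa using h2
  · intro x; funext i j a; ext t; simp [qd_apply, hf]
  · intro x; funext i j a; ext t; simp [qd_apply, hg]

theorem QSES.con {A B C : QRep Q} (S : QSES A B C) (Y : QRep Q) :
    CSES (qd C Y) (qd B Y) (qd A Y) (fun x i => x i ∘ₗ S.g i) (fun x i j a => x i j a ∘ₗ S.g i)
      (fun x i => x i ∘ₗ S.f i) (fun x i j a => x i j a ∘ₗ S.f i) := by
  choose r s hr hs hrs using fun i => split_lemma (S.f i) (S.g i) (S.inj i) (S.sur i) (S.ex i)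
  have hf := (qd_eq_zero _ _ _).mp S.df
  have hg := (qd_eq_zero _ _ _).mp S.dg
  have hgf : ∀ i x, S.g i (S.f i x) = 0 := fun i x => (S.ex i).apply_apply_eq_zero x
  constructor
  · funext i; simp
  · funext i j a; simp
  · intro x y; funext i; ext t; simp
  · intro x y; funext i j a; ext t; simp
  · intro x y h; funext i; ext t
    obtain ⟨t, rfl⟩ := S.sur i t
    exact LinearMap.congr_fun (congrFun h i) t
  · intro x y h; funext i j a; ext t
    obtain ⟨t, rfl⟩ := S.sur i t
    exact LinearMap.congr_fun (congrFun (congrFun (congrFun h i) j) a) t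
  · intro z; exact ⟨fun i => z i ∘ₗ r i, by funext i; ext t; simp [hr]⟩
  · intro z; exact ⟨fun i j a => z i j a ∘ₗ r i, by funext i j a; ext t; simp [hr]⟩
  · intro x; funext i; ext t; simp [hgf]
  · intro x; funext i j a; ext t; simp [hgf]
  · intro y h; refine ⟨fun i => y i ∘ₗ s i, ?_⟩
    funext i; ext t
    have h1 : y i (S.f i (r i t)) = 0 := LinearMap.congr_fun (congrFun h i) (r i t)
    have h2 := congrArg (y i) (hrs i t)
    rw [map_add, h1] at h2; simpa using h2
  · intro y h; refine ⟨fun i j a => y i j a ∘ₗ s i, ?_⟩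
    funext i j a; ext t
    have h1 : y i j a (S.f i (r i t)) = 0 :=
      LinearMap.congr_fun (congrFun (congrFun (congrFun h i) j) a) (r i t)
    have h2 := congrArg (y i j a) (hrs i t)
    rw [map_add, h1] at h2; simpa using h2
  · intro x; funext i j a; ext t; simp [qd_apply, hg]
  · intro x; funext i j a; ext t; simp [qd_apply, hf]

end Reps

section Reps2
variable {V : Type*} [Fintype V] {Q : V → V → ℕ}

noncomputable def qhom (M N : QRep Q) : ℕ := Module.finrank ℚ (LinearMap.ker (qd M N))
noncomputable def qext (M N : QRep Q) : ℕ :=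
  Module.finrank ℚ (QC1 M N ⧸ LinearMap.range (qd M N))

theorem qhom_eq_zero (M N : QRep Q) : qhom M N = 0 ↔ H0 M N := by
  rw [qhom, Submodule.finrank_eq_zero, LinearMap.ker_eq_bot']
  rfl

theorem qext_eq_zero (M N : QRep Q) : qext M N = 0 ↔ E0 M N := by
  rw [qext, Module.finrank_zero_iff, Submodule.Quotient.subsingleton_iff, LinearMap.range_eq_top]
  rfl

noncomputable def qdim (M : QRep Q) (i : V) : ℤ := Module.finrank ℚ (M.obj i)

def EF (Q : V → V → ℕ) (x y : V → ℤ) : ℤ :=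
  ∑ i, x i * y i - ∑ i, ∑ j, (Q i j : ℤ) * (x i * y j)

theorem euler (M N : QRep Q) : (qhom M N : ℤ) - qext M N = EF Q (qdim M) (qdim N) := by
  have h1 := LinearMap.finrank_range_add_finrank_ker (qd M N)
  have h2 := Submodule.finrank_quotient_add_finrank (LinearMap.range (qd M N))
  have h3 : Module.finrank ℚ (QC0 M N) =
      ∑ i, Module.finrank ℚ (M.obj i) * Module.finrank ℚ (N.obj i) := by
    rw [Module.finrank_pi_fintype]; simp [Module.finrank_linearMap]
  have h4 : Module.finrank ℚ (QC1 M N) =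
      ∑ i, ∑ j, Q i j * (Module.finrank ℚ (M.obj i) * Module.finrank ℚ (N.obj j)) := by
    rw [Module.finrank_pi_fintype]
    refine Finset.sum_congr rfl fun i _ => ?_
    rw [Module.finrank_pi_fintype]
    refine Finset.sum_congr rfl fun j _ => ?_
    rw [Module.finrank_pi_fintype]
    simp [Module.finrank_linearMap]
  have h5 : EF Q (qdim M) (qdim N) =
     (Module.finrank ℚ (QC0 M N) : ℤ) - Module.finrank ℚ (QC1 M N) := by
    rw [h3, h4]; simp [EF, qdim]
  rw [h5, qhom, qext]
  omega

theorem EF_add_left (x x' y : V → ℤ) : EF Q (x + x') y = EF Q x y + EF Q x' y := by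
  simp only [EF, Pi.add_apply, add_mul, mul_add, Finset.sum_add_distrib]; ring
theorem EF_add_right (x y y' : V → ℤ) : EF Q x (y + y') = EF Q x y + EF Q x y' := by
  simp only [EF, Pi.add_apply, mul_add, Finset.sum_add_distrib]; ring
theorem EF_smul_left (c : ℤ) (x y : V → ℤ) : EF Q (c • x) y = c * EF Q x y := by
  simp only [EF, Pi.smul_apply, smul_eq_mul, mul_sub, Finset.mul_sum]
  congr 1
  · exact Finset.sum_congr rfl fun i _ => by ring
  · exact Finset.sum_congr rfl fun i _ => Finset.sum_congr rfl fun j _ => by ring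
theorem EF_smul_right (c : ℤ) (x y : V → ℤ) : EF Q x (c • y) = c * EF Q x y := by
  simp only [EF, Pi.smul_apply, smul_eq_mul, mul_sub, Finset.mul_sum]
  congr 1
  · exact Finset.sum_congr rfl fun i _ => by ring
  · exact Finset.sum_congr rfl fun i _ => Finset.sum_congr rfl fun j _ => by ring

theorem QSES.dim {A B C : QRep Q} (S : QSES A B C) : qdim B = qdim A + qdim C := by
  funext i
  have h1 := LinearMap.finrank_range_add_finrank_ker (S.g i)
  have h2 : LinearMap.ker (S.g i) = LinearMap.range (S.f i) :=
    LinearMap.exact_iff.mp (S.ex i)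
  rw [h2, LinearMap.finrank_range_of_inj (S.inj i), LinearMap.range_eq_top.mpr (S.sur i),
    finrank_top] at h1
  simp only [qdim, Pi.add_apply]; omega

/-! powers -/
def qpow (k : ℕ) (γ : QRep Q) : QRep Q where
  obj i := Fin k → γ.obj i
  map i j a := (γ.map i j a).compLeft (Fin k)

theorem qpow_map (k : ℕ) (γ : QRep Q) (i j : V) (a : Fin (Q i j)) (x : Fin k → γ.obj i) (l : Fin k) :
    (qpow k γ).map i j a x l = γ.map i j a (x l) := rfl

theorem qpow_dim (k : ℕ) (γ : QRep Q) : qdim (qpow k γ) = (k : ℤ) • qdim γ := by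
  funext i
  simp only [qdim, Pi.smul_apply, smul_eq_mul]
  change ((Module.finrank ℚ (Fin k → γ.obj i) : ℕ) : ℤ) = _
  rw [Module.finrank_pi_fintype]; simp

/-- projection and inclusion -/
def qpr {k : ℕ} (γ : QRep Q) (l : Fin k) : QC0 (qpow k γ) γ := fun i => LinearMap.proj (φ := fun _ : Fin k => γ.obj i) l
def qin {k : ℕ} (γ : QRep Q) (l : Fin k) : QC0 γ (qpow k γ) :=
  fun i => LinearMap.single ℚ (fun _ : Fin k => γ.obj i) l

theorem qpr_apply {k : ℕ} (γ : QRep Q) (l : Fin k) (i : V) (x : (qpow k γ).obj i) :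
    qpr γ l i x = x l := rfl
theorem qpr_qin {k : ℕ} (γ : QRep Q) (l : Fin k) (i : V) (x : γ.obj i) :
    qpr γ l i (qin γ l i x) = x := by
  change (Pi.single l x : Fin k → γ.obj i) l = x
  simp
theorem qin_sum {k : ℕ} (γ : QRep Q) (i : V) (x : (qpow k γ).obj i) :
    ∑ l, qin γ l i (qpr γ l i x) = x := by
  change ∑ l, Pi.single l (x l) = x
  exact Finset.univ_sum_single x
theorem qpr_d {k : ℕ} (γ : QRep Q) (l : Fin k) (i j a) (x : (qpow k γ).obj i) :
    qpr γ l j ((qpow k γ).map i j a x) = γ.map i j a (qpr γ l i x) := rfl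
theorem qin_d {k : ℕ} (γ : QRep Q) (l : Fin k) (i j a) (x : γ.obj i) :
    qin γ l j (γ.map i j a x) = (qpow k γ).map i j a (qin γ l i x) := by
  funext l'
  change (Pi.single l (γ.map i j a x) : Fin k → γ.obj j) l' = γ.map i j a ((Pi.single l x : Fin k → γ.obj i) l')
  simp only [Pi.single_apply]
  split_ifs with h
  · rfl
  · simp

theorem qpow_ext_in {k : ℕ} {γ : QRep Q} {i : V} {W : Type*} [AddCommGroup W] [Module ℚ W]
    {x y : (qpow k γ).obj i →ₗ[ℚ] W}
    (h : ∀ l t, x (qin γ l i t) = y (qin γ l i t)) : x = y := by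
  ext t
  rw [← qin_sum γ i t, map_sum, map_sum]
  exact Finset.sum_congr rfl fun l _ => h l _

theorem H0_pow_right (k : ℕ) (hk : 0 < k) (Y γ : QRep Q) : H0 Y (qpow k γ) ↔ H0 Y γ := by
  constructor
  · intro h x hx
    let l : Fin k := ⟨0, hk⟩
    have hx' := (qd_eq_zero _ _ _).mp hx
    have := h (fun i => qin γ l i ∘ₗ x i) ((qd_eq_zero _ _ _).mpr (by
      intro i j a t; simp [hx', qin_d]))
    funext i; ext t
    have h2 := LinearMap.congr_fun (congrFun this i) t
    have h3 := congrArg (qpr γ l i) h2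
    simpa [qpr_qin] using h3
  · intro h x hx
    have hx' := (qd_eq_zero _ _ _).mp hx
    funext i; ext t; funext l
    have := h (fun i => qpr γ l i ∘ₗ x i) ((qd_eq_zero _ _ _).mpr (by
      intro i j a t; simp [hx', qpr_d]))
    exact LinearMap.congr_fun (congrFun this i) t

theorem E0_pow_right (k : ℕ) (hk : 0 < k) (Y γ : QRep Q) : E0 Y (qpow k γ) ↔ E0 Y γ := by
  constructor
  · intro h c
    let l : Fin k := ⟨0, hk⟩
    obtain ⟨x, hx⟩ := h (fun i j a => qin γ l j ∘ₗ c i j a)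
    refine ⟨fun i => qpr γ l i ∘ₗ x i, ?_⟩
    funext i j a; ext t
    have h2 := LinearMap.congr_fun (congrFun (congrFun (congrFun hx i) j) a) t
    have h3 := congrArg (qpr γ l j) h2
    simpa [qpr_qin, qd_apply, qpr_d] using h3
  · intro h c
    choose x hx using fun l => h (fun i j a => qpr γ l j ∘ₗ c i j a)
    refine ⟨fun i => LinearMap.pi (fun l => x l i), ?_⟩
    funext i j a; ext t; funext l
    exact LinearMap.congr_fun (congrFun (congrFun (congrFun (hx l) i) j) a) t

theorem H0_pow_left (k : ℕ) (hk : 0 < k) (Y γ : QRep Q) : H0 (qpow k γ) Y ↔ H0 γ Y := by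
  constructor
  · intro h x hx
    let l : Fin k := ⟨0, hk⟩
    have hx' := (qd_eq_zero _ _ _).mp hx
    have := h (fun i => x i ∘ₗ qpr γ l i) ((qd_eq_zero _ _ _).mpr (by
      intro i j a t; simp [hx', qpr_d]))
    funext i; ext t
    have h2 := LinearMap.congr_fun (congrFun this i) (qin γ l i t)
    simpa [qpr_qin] using h2
  · intro h x hx
    have hx' := (qd_eq_zero _ _ _).mp hx
    funext i; apply qpow_ext_in; intro l t
    have := h (fun i => x i ∘ₗ qin γ l i) ((qd_eq_zero _ _ _).mpr (by
      intro i j a t; simp [hx', qin_d]))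
    exact LinearMap.congr_fun (congrFun this i) t

theorem qpr_qin_ne {k : ℕ} (γ : QRep Q) (l l' : Fin k) (h : l ≠ l') (i : V) (x : γ.obj i) :
    qpr γ l i (qin γ l' i x) = 0 := by
  change (Pi.single l' x : Fin k → γ.obj i) l = 0
  simp [h]

theorem E0_pow_left (k : ℕ) (hk : 0 < k) (Y γ : QRep Q) : E0 (qpow k γ) Y ↔ E0 γ Y := by
  constructor
  · intro h c
    let l : Fin k := ⟨0, hk⟩
    obtain ⟨x, hx⟩ := h (fun i j a => c i j a ∘ₗ qpr γ l i)
    refine ⟨fun i => x i ∘ₗ qin γ l i, ?_⟩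
    funext i j a; ext t
    have h2 := LinearMap.congr_fun (congrFun (congrFun (congrFun hx i) j) a) (qin γ l i t)
    simpa [qpr_qin, qd_apply, qin_d] using h2
  · intro h c
    choose x hx using fun l => h (fun i j a => c i j a ∘ₗ qin γ l i)
    refine ⟨fun i => ∑ l, x l i ∘ₗ qpr γ l i, ?_⟩
    funext i j a; apply qpow_ext_in; intro l t
    have := LinearMap.congr_fun (congrFun (congrFun (congrFun (hx l) i) j) a) t
    rw [qd_apply] at this ⊢
    have key : ∀ i (t : γ.obj i), (∑ l, x l i ∘ₗ qpr γ l i) (qin γ l i t) = x l i t := by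
      intro i t
      rw [LinearMap.sum_apply, Finset.sum_eq_single l]
      · simp [qpr_qin]
      · intro l' _ hl; simp [qpr_qin_ne γ l' l hl]
      · simp
    rw [← qin_d, key, key, this]; rfl

/-! sub and quotient -/
def qsub (M : QRep Q) (S : ∀ i, Submodule ℚ (M.obj i))
    (hS : ∀ i j a, ∀ x ∈ S i, M.map i j a x ∈ S j) : QRep Q where
  obj i := S i
  map i j a := (M.map i j a).restrict (hS i j a)

def qquot (M : QRep Q) (S : ∀ i, Submodule ℚ (M.obj i))
    (hS : ∀ i j a, ∀ x ∈ S i, M.map i j a x ∈ S j) : QRep Q where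
  obj i := M.obj i ⧸ S i
  map i j a := (S i).mapQ (S j) (M.map i j a) (hS i j a)

def qsubquot (M : QRep Q) (S : ∀ i, Submodule ℚ (M.obj i))
    (hS : ∀ i j a, ∀ x ∈ S i, M.map i j a x ∈ S j) : QSES (qsub M S hS) M (qquot M S hS) where
  f i := (S i).subtype
  g i := (S i).mkQ
  df := (qd_eq_zero _ _ _).mpr fun i j a x => rfl
  dg := (qd_eq_zero _ _ _).mpr fun i j a x => rfl
  inj i := (S i).injective_subtype
  sur i := (S i).mkQ_surjective
  ex i := LinearMap.exact_subtype_mkQ (S i)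

variable {M N : QRep Q}

theorem ker_stable (f : QC0 M N) (hf : qd M N f = 0) :
    ∀ i j a, ∀ x ∈ LinearMap.ker (f i), M.map i j a x ∈ LinearMap.ker (f j) := by
  intro i j a x hx
  rw [LinearMap.mem_ker] at hx ⊢
  rw [(qd_eq_zero _ _ _).mp hf, hx, map_zero]
theorem range_stable (f : QC0 M N) (hf : qd M N f = 0) :
    ∀ i j a, ∀ x ∈ LinearMap.range (f i), N.map i j a x ∈ LinearMap.range (f j) := by
  rintro i j a _ ⟨x, rfl⟩
  exact ⟨M.map i j a x, (qd_eq_zero _ _ _).mp hf i j a x⟩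

def kerSES (f : QC0 M N) (hf : qd M N f = 0) :
    QSES (qsub M (fun i => LinearMap.ker (f i)) (ker_stable f hf)) M
      (qsub N (fun i => LinearMap.range (f i)) (range_stable f hf)) where
  f i := (LinearMap.ker (f i)).subtype
  g i := (f i).rangeRestrict
  df := (qd_eq_zero _ _ _).mpr fun i j a x => rfl
  dg := (qd_eq_zero _ _ _).mpr fun i j a x => Subtype.ext ((qd_eq_zero _ _ _).mp hf i j a x)
  inj i := Submodule.injective_subtype _
  sur i := LinearMap.surjective_rangeRestrict _
  ex i := by
    have : Function.Exact (LinearMap.ker (f i)).subtype (f i).rangeRestrict := by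
      rw [LinearMap.exact_iff, LinearMap.ker_rangeRestrict, Submodule.range_subtype]
    exact this

/-- kernel sequence for epis -/
def epiSES (f : QC0 M N) (hf : qd M N f = 0) (h : ∀ i, Function.Surjective (f i)) :
    QSES (qsub M (fun i => LinearMap.ker (f i)) (ker_stable f hf)) M N where
  f i := (LinearMap.ker (f i)).subtype
  g i := f i
  df := (qd_eq_zero _ _ _).mpr fun i j a x => rfl
  dg := hf
  inj i := Submodule.injective_subtype _
  sur i := h i
  ex i := by
    have : Function.Exact (LinearMap.ker (f i)).subtype (f i) := by
      rw [LinearMap.exact_iff, Submodule.range_subtype]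
    exact this

def monoSES (f : QC0 M N) (hf : qd M N f = 0) (h : ∀ i, Function.Injective (f i)) :
    QSES M N (qquot N (fun i => LinearMap.range (f i)) (range_stable f hf)) where
  f i := f i
  g i := (LinearMap.range (f i)).mkQ
  df := hf
  dg := (qd_eq_zero _ _ _).mpr fun i j a x => rfl
  inj i := h i
  sur i := Submodule.mkQ_surjective _
  ex i := LinearMap.exact_map_mkQ_range (f i)

/-- extension -/
def qextn (M N : QRep Q) (c : QC1 N M) : QRep Q where
  obj i := M.obj i × N.obj i
  map i j a := LinearMap.prod (M.map i j a ∘ₗ LinearMap.fst ℚ _ _ + c i j a ∘ₗ LinearMap.snd ℚ _ _)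
    (N.map i j a ∘ₗ LinearMap.snd ℚ _ _)

def extnSES (M N : QRep Q) (c : QC1 N M) : QSES M (qextn M N c) N where
  f i := LinearMap.inl ℚ (M.obj i) (N.obj i)
  g i := LinearMap.snd ℚ (M.obj i) (N.obj i)
  df := (qd_eq_zero _ _ _).mpr fun i j a x => by
    change (M.map i j a x, (0 : N.obj j)) = (M.map i j a x + c i j a 0, N.map i j a 0)
    simp
  dg := (qd_eq_zero _ _ _).mpr fun i j a x => rfl
  inj i := LinearMap.inl_injective
  sur i := LinearMap.snd_surjective
  ex i := Function.Exact.inl_snd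

end Reps2

section Reps3
variable {V : Type*} [Fintype V] {Q : V → V → ℕ}

structure Exc (M : QRep Q) : Prop where
  h : qhom M M = 1
  e : qext M M = 0

def qid (M : QRep Q) : QC0 M M := fun _ => LinearMap.id
theorem qid_d (M : QRep Q) : qd M M (qid M) = 0 := (qd_eq_zero _ _ _).mpr fun _ _ _ _ => rfl

theorem H0_of_qid (M : QRep Q) (h : qid M = 0) (N : QRep Q) (f : QC0 M N) : f = 0 := by
  funext i; ext x
  have : x = 0 := LinearMap.congr_fun (congrFun h i) x
  rw [this]; simp

theorem brick {M : QRep Q} (hM : qhom M M = 1) (f : QC0 M M) (hf : qd M M f = 0) :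
    ∃ c : ℚ, ∀ i x, f i x = c • x := by
  by_cases h0 : qid M = 0
  · exact ⟨0, fun i x => by rw [H0_of_qid M h0 M f]; simp⟩
  · have hne : (⟨qid M, qid_d M⟩ : LinearMap.ker (qd M M)) ≠ 0 := fun h => h0 (congrArg Subtype.val h)
    obtain ⟨c, hc⟩ := (finrank_eq_one_iff_of_nonzero' _ hne).mp hM ⟨f, hf⟩
    refine ⟨c, fun i x => ?_⟩
    have h2 := congrArg Subtype.val hc
    have h3 : c • qid M = f := h2
    rw [← h3]; rfl

variable {γ β : QRep Q} {k : ℕ}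

def uni (b : Fin k → LinearMap.ker (qd γ β)) : QC0 (qpow k γ) β :=
  fun i => ∑ l, (b l).1 i ∘ₗ qpr γ l i

theorem uni_apply (b : Fin k → LinearMap.ker (qd γ β)) (i : V) (x : (qpow k γ).obj i) :
    uni b i x = ∑ l, (b l).1 i (qpr γ l i x) := by simp [uni]

theorem uni_d (b : Fin k → LinearMap.ker (qd γ β)) : qd _ _ (uni b) = 0 := by
  rw [qd_eq_zero]
  intro i j a x
  simp only [uni_apply, map_sum]
  refine Finset.sum_congr rfl fun l _ => ?_
  rw [qpr_d, (qd_eq_zero _ _ _).mp (b l).2]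

theorem pow_comp (hγ : qhom γ γ = 1) (φ : QC0 γ (qpow k γ)) (hφ : qd _ _ φ = 0) :
    ∃ c : Fin k → ℚ, ∀ l i x, qpr γ l i (φ i x) = c l • x := by
  have := fun l : Fin k => brick hγ (fun i => qpr γ l i ∘ₗ φ i) ((qd_eq_zero _ _ _).mpr (by
      intro i j a t
      simp [(qd_eq_zero _ _ _).mp hφ, qpr_d]))
  choose c hc using this
  exact ⟨c, hc⟩

theorem uni_inj (hγ : qhom γ γ = 1) (b : Fin k → LinearMap.ker (qd γ β))
    (hb : LinearIndependent ℚ b) (φ : QC0 γ (qpow k γ)) (hφ : qd _ _ φ = 0)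
    (h : ∀ i x, uni b i (φ i x) = 0) : φ = 0 := by
  obtain ⟨c, hc⟩ := pow_comp hγ φ hφ
  have h1 : ∑ l, c l • b l = 0 := by
    apply Subtype.ext
    funext i; ext x
    have := h i x
    rw [uni_apply] at this
    simp only [hc, map_smul] at this
    simp only [AddSubmonoidClass.coe_finset_sum, Finset.sum_apply, LinearMap.sum_apply]
    exact this.trans rfl
  have h2 := Fintype.linearIndependent_iff.mp hb c h1
  funext i; ext x; funext l
  have := hc l i x
  rw [h2, zero_smul] at this
  exact this

theorem H0_ker_uni (hγ : qhom γ γ = 1) (b : Fin k → LinearMap.ker (qd γ β))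
    (hb : LinearIndependent ℚ b) :
    H0 γ (qsub (qpow k γ) (fun i => LinearMap.ker (uni b i)) (ker_stable _ (uni_d b))) := by
  intro φ hφ
  have hφ' := (qd_eq_zero _ _ _).mp hφ
  have := uni_inj hγ b hb (fun i => (LinearMap.ker (uni b i)).subtype ∘ₗ φ i)
    ((qd_eq_zero _ _ _).mpr (by
      intro i j a x
      exact congrArg Subtype.val (hφ' i j a x))) (by
      intro i x
      exact (φ i x).2)
  funext i; ext x
  exact Subtype.ext (LinearMap.congr_fun (congrFun this i) x)

theorem HR (hγ : Exc γ) (hβ : Exc β) (h0 : H0 β γ) (h1 : E0 β γ) (hk : 0 < k)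
    (b : Fin k → LinearMap.ker (qd γ β)) (hb : LinearIndependent ℚ b) :
    (∀ i, Function.Surjective (uni b i)) ∨ (∀ i, Function.Injective (uni b i)) := by
  by_cases hs : ∀ i, Function.Surjective (uni b i)
  · exact Or.inl hs
  right
  push Not at hs
  obtain ⟨i0, hi0⟩ := hs
  have S := kerSES (uni b) (uni_d b)
  have T := qsubquot β (fun i => LinearMap.range (uni b i)) (range_stable _ (uni_d b))
  set K := qsub (qpow k γ) (fun i => LinearMap.ker (uni b i)) (ker_stable _ (uni_d b)) with hK
  set I := qsub β (fun i => LinearMap.range (uni b i)) (range_stable _ (uni_d b)) with hI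
  have hβI : H0 β I := by
    intro φ hφ
    have hφ' := (qd_eq_zero _ _ _).mp hφ
    obtain ⟨c, hc⟩ := brick hβ.h (fun i => (LinearMap.range (uni b i)).subtype ∘ₗ φ i)
      ((qd_eq_zero _ _ _).mpr (by
      intro i j a x
      exact congrArg Subtype.val (hφ' i j a x)))
    have hc' : ∀ i x, (φ i x).1 = c • x := hc
    by_cases hc0 : c = 0
    · funext i; ext x
      apply Subtype.ext
      rw [hc', hc0, zero_smul]; rfl
    · exfalso; apply hi0
      intro y
      have := (φ i0 (c⁻¹ • y)).2
      rw [hc', smul_smul, mul_inv_cancel₀ hc0, one_smul] at this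
      exact this
  have hβK : E0 β K := (S.cov β).l4 hβI ((E0_pow_right k hk β γ).mpr h1)
  have hIK : E0 I K := (T.con K).l6 hβK
  have hγK : H0 (qpow k γ) K := (H0_pow_left k hk K γ).mpr (H0_ker_uni hγ.h b hb)
  have hKK : H0 K K := (S.con K).l3 hγK hIK
  have hid := hKK (qid K) (qid_d K)
  intro i
  rw [← LinearMap.ker_eq_bot, Submodule.eq_bot_iff]
  intro x hx
  have := LinearMap.congr_fun (congrFun hid i) (⟨x, hx⟩ : LinearMap.ker (uni b i))
  exact congrArg Subtype.val this

theorem exists_basis (γ β : QRep Q) : ∃ b : Fin (qhom γ β) → LinearMap.ker (qd γ β), LinearIndependent ℚ b :=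
  ⟨_, (Module.finBasis ℚ (LinearMap.ker (qd γ β))).linearIndependent⟩

theorem conc (hγ : Exc γ) (hβ : Exc β) (h0 : H0 β γ) (h1 : E0 β γ) :
    qhom γ β = 0 ∨ qext γ β = 0 := by
  by_cases hk : qhom γ β = 0
  · exact Or.inl hk
  right
  have hk := Nat.pos_of_ne_zero hk
  obtain ⟨b, hb⟩ := exists_basis γ β
  rw [qext_eq_zero]
  rcases HR hγ hβ h0 h1 hk b hb with h | h
  · exact ((epiSES _ (uni_d b) h).cov γ).l6 ((E0_pow_right _ hk γ γ).mpr ((qext_eq_zero _ _).mp hγ.e))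
  · exact (E0_pow_left _ hk β γ).mp (((monoSES _ (uni_d b) h).con β).l6 ((qext_eq_zero _ _).mp hβ.e))

/-- epi type, mono type, extension type -/
theorem tri_hom (hγ : Exc γ) (hβ : Exc β) (h0 : H0 β γ) (h1 : E0 β γ) (hk : 0 < qhom γ β) :
    (∃ β', Nonempty (QSES β' (qpow (qhom γ β) γ) β) ∧ H0 γ β' ∧ E0 γ β') ∨
    (∃ β', Nonempty (QSES (qpow (qhom γ β) γ) β β') ∧ H0 γ β' ∧ E0 γ β') := by
  obtain ⟨b, hb⟩ := exists_basis γ β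
  have he : qext γ β = 0 := (conc hγ hβ h0 h1).resolve_left hk.ne'
  have e1 := euler γ β
  have e2 := euler γ γ
  rw [hγ.h, hγ.e] at e2
  rw [he] at e1
  rcases HR hγ hβ h0 h1 hk b hb with h | h
  · left
    refine ⟨_, ⟨epiSES _ (uni_d b) h⟩, H0_ker_uni hγ.h b hb, ?_⟩
    have S := epiSES _ (uni_d b) h
    set K := qsub _ _ (ker_stable _ (uni_d b)) with hK
    have hd := S.dim
    rw [qpow_dim] at hd
    have e3 := euler γ K
    have : EF Q (qdim γ) ((qhom γ β : ℤ) • qdim γ) = EF Q (qdim γ) (qdim K) + EF Q (qdim γ) (qdim β) := by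
      rw [hd, EF_add_right]
    rw [EF_smul_right, ← e1, ← e2, ← e3, (qhom_eq_zero _ _).mpr (H0_ker_uni hγ.h b hb)] at this
    rw [← qext_eq_zero]
    push_cast at this
    linarith
  · right
    have S := monoSES _ (uni_d b) h
    have hE := (S.cov γ).l6 ((qext_eq_zero _ _).mp he)
    refine ⟨_, ⟨S⟩, ?_, hE⟩
    set K := qquot _ _ (range_stable _ (uni_d b)) with hK
    have hd := S.dim
    rw [qpow_dim] at hd
    have e3 := euler γ K
    rw [hd, EF_add_right, EF_smul_right, ← e2, ← e3, (qext_eq_zero _ _).mpr hE] at e1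
    rw [← qhom_eq_zero]
    push_cast at e1
    linarith

theorem tri_ext (hγ : Exc γ) (hH : H0 γ β) (hk : 0 < qext γ β) :
    ∃ β', Nonempty (QSES β β' (qpow (qext γ β) γ)) ∧ H0 γ β' ∧ E0 γ β' := by
  set k := qext γ β with hkd
  obtain ⟨b, hbi⟩ : ∃ b : Fin k → (QC1 γ β ⧸ LinearMap.range (qd γ β)), LinearIndependent ℚ b :=
    ⟨_, (Module.finBasis ℚ (QC1 γ β ⧸ LinearMap.range (qd γ β))).linearIndependent⟩
  choose e he using fun l => Submodule.mkQ_surjective _ (b l)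
  let c : QC1 (qpow k γ) β := fun i j a => ∑ l : Fin k, e l i j a ∘ₗ qpr γ l i
  have S := extnSES β (qpow k γ) c
  have hH' : H0 γ (qextn β (qpow k γ) c) := by
    intro φ hφ
    have hφ' := (qd_eq_zero _ _ _).mp hφ
    let u : QC0 γ β := fun i => LinearMap.fst ℚ (β.obj i) ((qpow k γ).obj i) ∘ₗ φ i
    let w : QC0 γ (qpow k γ) := fun i => LinearMap.snd ℚ (β.obj i) ((qpow k γ).obj i) ∘ₗ φ i
    have hw : qd _ _ w = 0 := (qd_eq_zero _ _ _).mpr fun i j a x => congrArg Prod.snd (hφ' i j a x)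
    have hu : ∀ i j a x, u j (γ.map i j a x) = β.map i j a (u i x) + c i j a (w i x) :=
      fun i j a x => congrArg Prod.fst (hφ' i j a x)
    obtain ⟨t, ht⟩ := pow_comp hγ.h w hw
    have h1 : ∑ l, t l • e l = qd γ β (-u) := by
      funext i j a; ext x
      have h2 := hu i j a x
      have h3 : c i j a (w i x) = ∑ l, t l • e l i j a x := by
        simp only [c, LinearMap.sum_apply, LinearMap.comp_apply, ht, map_smul]
      rw [qd_apply]
      simp only [Finset.sum_apply, Pi.smul_apply, LinearMap.sum_apply, LinearMap.smul_apply]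
      rw [← h3]
      simp only [Pi.neg_apply, LinearMap.neg_apply, map_neg]
      rw [h2]; abel
    have h2 : ∑ l, t l • b l = 0 := by
      have : (LinearMap.range (qd γ β)).mkQ (∑ l, t l • e l) = 0 := by
        rw [h1]; simp
      rw [map_sum] at this
      simp only [map_smul, he] at this
      exact this
    have h3 := Fintype.linearIndependent_iff.mp hbi t h2
    have hw0 : ∀ i x, w i x = 0 := by
      intro i x; funext l
      have := ht l i x
      rw [h3, zero_smul] at this
      exact this
    have hu0 : u = 0 := hH u ((qd_eq_zero _ _ _).mpr fun i j a x => by rw [hu, hw0]; simp)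
    funext i; ext x
    exact Prod.ext (LinearMap.congr_fun (congrFun hu0 i) x) (hw0 i x)
  refine ⟨_, ⟨S⟩, hH', ?_⟩
  have e1 := euler γ β
  have e2 := euler γ γ
  rw [hγ.h, hγ.e] at e2
  rw [(qhom_eq_zero _ _).mpr hH, ← hkd] at e1
  have hd := S.dim
  rw [qpow_dim] at hd
  have e3 := euler γ (qextn β (qpow k γ) c)
  rw [hd, EF_add_right, EF_smul_right, ← e2, ← e1, (qhom_eq_zero _ _).mpr hH'] at e3
  rw [← qext_eq_zero]
  push_cast at e3
  linarith

end Reps3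

section Stalks
variable {V : Type*} [Fintype V] {Q : V → V → ℕ}

abbrev Stk {V : Type*} (Q : V → V → ℕ) := QRep Q × ℤ

noncomputable def Hs (X Y : Stk Q) (p : ℤ) : ℕ :=
  if p = X.2 - Y.2 then qhom X.1 Y.1 else if p = X.2 - Y.2 + 1 then qext X.1 Y.1 else 0

theorem Hs_zero (X Y : Stk Q) (p : ℤ) : Hs X Y p = 0 ↔
    (p = X.2 - Y.2 → H0 X.1 Y.1) ∧ (p = X.2 - Y.2 + 1 → E0 X.1 Y.1) := by
  unfold Hs
  rw [← qhom_eq_zero, ← qext_eq_zero]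
  split_ifs with h1 h2
  · constructor
    · intro h; exact ⟨fun _ => h, fun h3 => by omega⟩
    · intro h; exact h.1 h1
  · constructor
    · intro h; exact ⟨fun h3 => absurd h3 h1, fun _ => h⟩
    · intro h; exact h.2 h2
  · exact ⟨fun _ => ⟨fun h => absurd h h1, fun h => absurd h h2⟩, fun _ => rfl⟩

structure Tri (X X' Z : Stk Q) : Prop where
  cov1 : ∀ Y p, Hs Y Z p = 0 → Hs Y X' (p + 1) = 0 → Hs Y X (p + 1) = 0
  cov2 : ∀ Y p, Hs Y X p = 0 → Hs Y Z p = 0 → Hs Y X' p = 0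
  cov3 : ∀ Y p, Hs Y X' p = 0 → Hs Y X (p + 1) = 0 → Hs Y Z p = 0
  con1 : ∀ Y p, Hs X Y p = 0 → Hs X' Y (p + 1) = 0 → Hs Z Y (p + 1) = 0
  con2 : ∀ Y p, Hs X Y p = 0 → Hs Z Y p = 0 → Hs X' Y p = 0
  con3 : ∀ Y p, Hs X' Y p = 0 → Hs Z Y (p + 1) = 0 → Hs X Y p = 0

theorem QSES.tri {A B C : QRep Q} (S : QSES A B C) (e : ℤ) : Tri (A, e) (B, e) (C, e) := by
  constructor
  · intro Y p h1 h2
    simp only [Hs_zero] at h1 h2 ⊢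
    exact ⟨fun h => (S.cov Y.1).l1 (h2.1 h), fun h => (S.cov Y.1).l4 (h1.1 (by omega)) (h2.2 h)⟩
  · intro Y p h1 h2
    simp only [Hs_zero] at h1 h2 ⊢
    exact ⟨fun h => (S.cov Y.1).l2 (h1.1 h) (h2.1 h), fun h => (S.cov Y.1).l5 (h1.2 h) (h2.2 h)⟩
  · intro Y p h1 h2
    simp only [Hs_zero] at h1 h2 ⊢
    exact ⟨fun h => (S.cov Y.1).l3 (h1.1 h) (h2.2 (by omega)), fun h => (S.cov Y.1).l6 (h1.2 h)⟩
  · intro Y p h1 h2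
    simp only [Hs_zero] at h1 h2 ⊢
    exact ⟨fun h => (S.con Y.1).l1 (h2.1 h), fun h => (S.con Y.1).l4 (h1.1 (by omega)) (h2.2 h)⟩
  · intro Y p h1 h2
    simp only [Hs_zero] at h1 h2 ⊢
    exact ⟨fun h => (S.con Y.1).l2 (h2.1 h) (h1.1 h), fun h => (S.con Y.1).l5 (h2.2 h) (h1.2 h)⟩
  · intro Y p h1 h2
    simp only [Hs_zero] at h1 h2 ⊢
    exact ⟨fun h => (S.con Y.1).l3 (h1.1 h) (h2.2 (by omega)), fun h => (S.con Y.1).l6 (h1.2 h)⟩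

def sh (X : Stk Q) (n : ℤ) : Stk Q := (X.1, X.2 + n)

theorem Hs_sh_right (X Y : Stk Q) (n p : ℤ) : Hs X (sh Y n) p = Hs X Y (p + n) := by
  simp only [Hs, sh]
  congr 1
  · exact propext (by constructor <;> intro h <;> linarith)
  · congr 1
    exact propext (by constructor <;> intro h <;> linarith)
theorem Hs_sh_left (X Y : Stk Q) (n p : ℤ) : Hs (sh X n) Y p = Hs X Y (p - n) := by
  simp only [Hs, sh]
  congr 1
  · exact propext (by constructor <;> intro h <;> linarith)
  · congr 1
    exact propext (by constructor <;> intro h <;> linarith)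

theorem Tri.rot {X X' Z : Stk Q} (T : Tri X X' Z) : Tri X' Z (sh X 1) := by
  constructor
  · intro Y p h1 h2
    rw [Hs_sh_right] at h1
    exact T.cov2 Y (p+1) h1 h2
  · intro Y p h1 h2
    rw [Hs_sh_right] at h2
    exact T.cov3 Y p h1 h2
  · intro Y p h1 h2
    rw [Hs_sh_right]
    exact T.cov1 Y p h1 h2
  · intro Y p h1 h2
    rw [Hs_sh_left, add_sub_cancel_right]
    exact T.con3 Y p h1 h2
  · intro Y p h1 h2
    rw [Hs_sh_left] at h2
    have := T.con1 Y (p-1) h2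
    rw [sub_add_cancel] at this
    exact this h1
  · intro Y p h1 h2
    rw [Hs_sh_left, add_sub_cancel_right] at h2
    exact T.con2 Y p h2 h1

theorem Hs_pow_right (k : ℕ) (hk : 0 < k) (Y : Stk Q) (γ : QRep Q) (d p : ℤ) :
    Hs Y (qpow k γ, d) p = 0 ↔ Hs Y (γ, d) p = 0 := by
  simp only [Hs_zero, H0_pow_right k hk, E0_pow_right k hk]
theorem Hs_pow_left (k : ℕ) (hk : 0 < k) (Y : Stk Q) (γ : QRep Q) (d p : ℤ) :
    Hs (qpow k γ, d) Y p = 0 ↔ Hs (γ, d) Y p = 0 := by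
  simp only [Hs_zero, H0_pow_left k hk, E0_pow_left k hk]

theorem Tri.of_pow {X X' : Stk Q} {k : ℕ} (hk : 0 < k) {γ : QRep Q} {d : ℤ}
    (T : Tri X X' (qpow k γ, d)) : Tri X X' (γ, d) := by
  obtain ⟨a, b, c, e, f, g⟩ := T
  simp only [Hs_pow_right k hk, Hs_pow_left k hk] at a b c e f g
  exact ⟨a, b, c, e, f, g⟩

noncomputable def cls (X : Stk Q) : V → ℤ := (X.2.negOnePow : ℤ) • qdim X.1

theorem EF_cls (X Y : Stk Q) : EF Q (cls X) (cls Y) =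
    ((X.2 - Y.2).negOnePow : ℤ) * (qhom X.1 Y.1 - qext X.1 Y.1) := by
  rw [cls, cls, EF_smul_left, EF_smul_right, ← euler, Int.negOnePow_sub]
  push_cast; ring

/-- concentrated function -/
def Sg (h : ℤ → ℕ) (a : ℤ) (x : ℕ) : Prop := ∀ p, h p = if p = a then x else 0

theorem Hs_single (X Y : Stk Q) (h : qhom X.1 Y.1 = 0 ∨ qext X.1 Y.1 = 0) :
    ∃ a x, Sg (Hs X Y) a x ∧ EF Q (cls X) (cls Y) = (a.negOnePow : ℤ) * x := by
  rcases h with h | h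
  · refine ⟨X.2 - Y.2 + 1, qext X.1 Y.1, fun p => ?_, ?_⟩
    · unfold Hs; rw [h]; split_ifs <;> first | rfl | omega
    · rw [EF_cls, h, Int.negOnePow_succ]; push_cast; ring
  · refine ⟨X.2 - Y.2, qhom X.1 Y.1, fun p => ?_, ?_⟩
    · unfold Hs; rw [h]; split_ifs <;> rfl
    · rw [EF_cls, h]; push_cast; ring

theorem Hs_all_zero (X Y : Stk Q) : (∀ p, Hs X Y p = 0) ↔ (qhom X.1 Y.1 = 0 ∧ qext X.1 Y.1 = 0) := by
  constructor
  · intro h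
    have h1 := h (X.2 - Y.2)
    have h2 := h (X.2 - Y.2 + 1)
    simp [Hs] at h1 h2
    exact ⟨h1, h2⟩
  · rintro ⟨h1, h2⟩ p
    unfold Hs; rw [h1, h2]; split_ifs <;> rfl

theorem EF_all_zero (X Y : Stk Q) (h : ∀ p, Hs X Y p = 0) : EF Q (cls X) (cls Y) = 0 := by
  rw [EF_cls, ((Hs_all_zero X Y).mp h).1, ((Hs_all_zero X Y).mp h).2]; simp

theorem EF_exc (X : Stk Q) (h : Exc X.1) : EF Q (cls X) (cls X) = 1 := by
  rw [EF_cls, h.h, h.e]; simp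

theorem Hs_exc (X : Stk Q) (h : Exc X.1) (p : ℤ) : Hs X X p = if p = 0 then 1 else 0 := by
  unfold Hs; rw [h.h, h.e, sub_self]; split_ifs <;> rfl

theorem EF_Hs_zero (X Y : Stk Q) (h : EF Q (cls X) (cls Y) = 0)
    (hc : qhom X.1 Y.1 = 0 ∨ qext X.1 Y.1 = 0) : ∀ p, Hs X Y p = 0 := by
  obtain ⟨a, x, h1, h2⟩ := Hs_single X Y hc
  rw [h] at h2
  have : x = 0 := by
    have := mul_eq_zero.mp h2.symm
    simpa using this
  intro p; rw [h1, this]; simp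

theorem tri_exists {γ β : Stk Q} (hγ : Exc γ.1) (hβ : Exc β.1) (h0 : ∀ p, Hs β γ p = 0)
    (hk : Hs γ β 1 ≠ 0) : ∃ β' : Stk Q, Tri β β' γ ∧ (∀ p, Hs γ β' p = 0) ∧
      cls β' = cls β + (Hs γ β 1 : ℤ) • cls γ ∧ (β'.2 = γ.2 ∨ β'.2 = γ.2 - 1) := by
  obtain ⟨γ, d⟩ := γ
  obtain ⟨β, e⟩ := β
  have h0' := (Hs_all_zero _ _).mp h0
  simp only [qhom_eq_zero, qext_eq_zero] at h0'
  have hz : ∀ (β' : QRep Q) (e' : ℤ), H0 γ β' → E0 γ β' → ∀ p, Hs (γ, d) (β', e') p = 0 := by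
    intro β' e' h1 h2 p
    rw [Hs_zero]; exact ⟨fun _ => h1, fun _ => h2⟩
  by_cases hed : (1 : ℤ) = d - e
  · have hh : Hs (γ, d) (β, e) 1 = qhom γ β := by simp [Hs, hed]
    rw [hh] at hk ⊢
    have hk' := Nat.pos_of_ne_zero hk
    obtain rfl : e = d - 1 := by omega
    have es : ((d - 1).negOnePow : ℤ) = - (d.negOnePow : ℤ) := by
      rw [Int.negOnePow_sub]; simp
    rcases tri_hom hγ hβ h0'.1 h0'.2 hk' with ⟨β', ⟨S⟩, h1, h2⟩ | ⟨β', ⟨S⟩, h1, h2⟩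
    · refine ⟨(β', d), ?_, hz _ _ h1 h2, ?_, Or.inl rfl⟩
      · have := (S.tri (d - 1)).rot.rot
        simp only [sh, sub_add_cancel] at this
        exact this.of_pow hk'
      · have := S.dim
        rw [qpow_dim] at this
        simp only [cls, es]
        rw [eq_sub_of_add_eq this.symm]
        module
    · refine ⟨(β', d - 1), ?_, hz _ _ h1 h2, ?_, Or.inr rfl⟩
      · have := (S.tri (d - 1)).rot
        simp only [sh, sub_add_cancel] at this
        exact this.of_pow hk'
      · have := S.dim
        rw [qpow_dim] at this
        simp only [cls, es]
        rw [this]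
        module
  · have hed' : e = d := by
      by_contra hne
      apply hk
      simp only [Hs]
      rw [if_neg hed, if_neg]
      omega
    subst hed'
    have hh : Hs (γ, e) (β, e) 1 = qext γ β := by simp [Hs]
    rw [hh] at hk ⊢
    have hH : qhom γ β = 0 := (conc hγ hβ h0'.1 h0'.2).resolve_right hk
    rw [qhom_eq_zero] at hH
    have hk' := Nat.pos_of_ne_zero hk
    obtain ⟨β', ⟨S⟩, h1, h2⟩ := tri_ext hγ hH hk'
    refine ⟨(β', e), (S.tri e).of_pow hk', hz _ _ h1 h2, ?_, Or.inl rfl⟩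
    have := S.dim
    rw [qpow_dim] at this
    simp only [cls]
    rw [this]
    module

end Stalks

section States
variable {V : Type*} [Fintype V] [DecidableEq V] {Q : V → V → ℕ}

structure SState (m : ℕ) (X : V → Stk Q) (r : V → ℕ) : Prop where
  deg0 : ∀ i, 0 ≤ (X i).2
  degm : ∀ i, (X i).2 ≤ m
  rinj : Function.Injective r
  exc : ∀ i, Exc (X i).1
  ord : ∀ i j, r i < r j → ∀ p, Hs (X j) (X i) p = 0
  pos : ∀ i j, i ≠ j → ∀ p ≤ 0, Hs (X i) (X j) p = 0

variable {m : ℕ} {X : V → Stk Q} {r : V → ℕ}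

theorem SState.conc (S : SState m X r) {i j : V} (h : i ≠ j) :
    qhom (X i).1 (X j).1 = 0 ∨ qext (X i).1 (X j).1 = 0 := by
  rcases lt_or_gt_of_ne (S.rinj.ne h) with h | h
  · have := (Hs_all_zero _ _).mp (S.ord i j h)
    rw [qhom_eq_zero, qext_eq_zero] at this
    exact _root_.conc (S.exc i) (S.exc j) this.1 this.2
  · exact Or.inl ((Hs_all_zero _ _).mp (S.ord j i h)).1

/-- data produced by lowering -/
structure Low (X X' : V → Stk Q) (v : V) : Prop where
  atv : X' v = sh (X v) (-1)
  nJ : ∀ j, j ≠ v → Hs (X v) (X j) 1 = 0 → X' j = X j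
  tri : ∀ j, Hs (X v) (X j) 1 ≠ 0 → Tri (X j) (X' j) (X v)
  l3 : ∀ j, Hs (X v) (X j) 1 ≠ 0 → ∀ p, Hs (X v) (X' j) p = 0
  cl : ∀ j, Hs (X v) (X j) 1 ≠ 0 → cls (X' j) = cls (X j) + (Hs (X v) (X j) 1 : ℤ) • cls (X v)
  dg : ∀ j, Hs (X v) (X j) 1 ≠ 0 → (X' j).2 = (X v).2 ∨ (X' j).2 = (X v).2 - 1

theorem SState.Jne (S : SState m X r) {v j : V} (h : Hs (X v) (X j) 1 ≠ 0) : j ≠ v := by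
  rintro rfl; apply h; rw [Hs_exc _ (S.exc j)]; simp

theorem SState.lt_of_ne (S : SState m X r) {i j : V} (hij : i ≠ j) {p : ℤ} (h : Hs (X i) (X j) p ≠ 0) : r i < r j := by
  by_contra hlt
  have : r j < r i := lt_of_le_of_ne (not_lt.mp hlt) (S.rinj.ne hij.symm)
  exact h (S.ord j i this p)

theorem SState.Jlt (S : SState m X r) {v j : V} (h : Hs (X v) (X j) 1 ≠ 0) : r v < r j :=
  S.lt_of_ne (S.Jne h).symm h

theorem SState.exists_low (S : SState m X r) (v : V) : ∃ X', Low X X' v := by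
  have h := fun (j : V) (hj : Hs (X v) (X j) 1 ≠ 0) =>
    tri_exists (S.exc v) (S.exc j) (S.ord v j (S.Jlt hj)) hj
  choose F hF using h
  classical
  refine ⟨fun j => if hj : j = v then sh (X v) (-1) else if h : Hs (X v) (X j) 1 = 0 then X j else F j h, ?_⟩
  constructor
  · simp
  · intro j h1 h2; simp [h1, h2]
  all_goals
    intro j hj
    simp only [S.Jne hj, hj, dif_neg, not_false_eq_true]
    have := hF j hj
    tauto

/-- arrows of the ext quiver -/
def Rl (X : V → Stk Q) (i j : V) : Prop := i ≠ j ∧ ∃ p, Hs (X i) (X j) p ≠ 0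

def Dset (X : V → Stk Q) (r : V → ℕ) (v x : V) : Prop :=
  r v < r x ∧ ∃ j, Hs (X v) (X j) 1 ≠ 0 ∧ Relation.ReflTransGen (Rl X) x j

theorem SState.rl_lt (S : SState m X r) {i j : V} (h : Rl X i j) : r i < r j := by
  obtain ⟨h1, p, h2⟩ := h
  exact S.lt_of_ne h1 h2

theorem Hs_ne_deg {X Y : Stk Q} {p : ℤ} (h : Hs X Y p ≠ 0) : p = X.2 - Y.2 ∧ qhom X.1 Y.1 ≠ 0 ∨ p = X.2 - Y.2 + 1 ∧ qext X.1 Y.1 ≠ 0 := by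
  unfold Hs at h
  split_ifs at h with h1 h2
  · exact Or.inl ⟨h1, h⟩
  · exact Or.inr ⟨h2, h⟩
  · exact absurd rfl h

theorem SState.rl_deg (S : SState m X r) {i j : V} (h : Rl X i j) :
    (X j).2 ≤ (X i).2 ∧ ((X j).2 = (X i).2 → qext (X i).1 (X j).1 ≠ 0) := by
  obtain ⟨h1, p, h2⟩ := h
  have hp : 1 ≤ p := by
    by_contra hp
    exact h2 (S.pos i j h1 p (by omega))
  rcases Hs_ne_deg h2 with ⟨h3, h4⟩ | ⟨h3, h4⟩
  · exact ⟨by omega, fun h => by omega⟩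
  · exact ⟨by omega, fun _ => h4⟩

theorem SState.path (S : SState m X r) {i j : V} (h : Relation.ReflTransGen (Rl X) i j) :
    (X j).2 ≤ (X i).2 ∧ r i ≤ r j := by
  induction h with
  | refl => exact ⟨le_rfl, le_rfl⟩
  | tail _ h2 ih => exact ⟨(S.rl_deg h2).1.trans ih.1, ih.2.trans (S.rl_lt h2).le⟩

theorem SState.claim (S : SState m X r) {v k : V} (hk : Dset X r v k) (hJ : Hs (X v) (X k) 1 = 0) :
    ∀ p, Hs (X v) (X k) p = 0 := by
  by_contra hcon
  push Not at hcon
  obtain ⟨p, hp⟩ := hcon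
  obtain ⟨hvk, j, hj, hpath⟩ := hk
  have hkv : k ≠ v := by rintro rfl; omega
  have hp2 : 2 ≤ p := by
    by_contra hlt
    by_cases h1 : p = 1
    · rw [h1] at hp; exact hp hJ
    · exact hp (S.pos v k hkv.symm p (by omega))
  have hdk := (S.path hpath).1
  rcases Relation.ReflTransGen.cases_tail hpath with h | ⟨y, hy1, hy2⟩
  · rw [h] at hj; exact hj hJ
  have hy := S.rl_deg hy2
  have hyp := S.path hy1
  have hylt := S.rl_lt hy2
  have hjd := Hs_ne_deg hj
  rcases Hs_ne_deg hp with ⟨h3, h4⟩ | ⟨h3, h4⟩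
  · omega
  · have hd : (X j).2 = (X v).2 - 1 := by omega
    have hdy : (X j).2 = (X y).2 := by omega
    have hext := hy.2 hdy
    have hhom : qhom (X v).1 (X j).1 ≠ 0 := by
      rcases hjd with h | h
      · exact h.2
      · omega
    have hjv := (Hs_all_zero _ _).mp (S.ord v j (S.Jlt hj))
    rw [qhom_eq_zero, qext_eq_zero] at hjv
    rcases tri_hom (S.exc v) (S.exc j) hjv.1 hjv.2 (Nat.pos_of_ne_zero hhom) with ⟨β', ⟨T⟩, _, _⟩ | ⟨β', ⟨T⟩, _, _⟩
    · have h5 := ((Hs_all_zero _ _).mp (S.ord v y (by omega))).2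
      rw [qext_eq_zero] at h5
      exact hext ((qext_eq_zero _ _).mpr ((T.cov (X y).1).l6 ((E0_pow_right _ (Nat.pos_of_ne_zero hhom) _ _).mpr h5)))
    · have h5 := ((Hs_all_zero _ _).mp (S.ord k j (by omega))).2
      rw [qext_eq_zero] at h5
      exact h4 ((qext_eq_zero _ _).mpr ((E0_pow_left _ (Nat.pos_of_ne_zero hhom) _ _).mp ((T.con (X k).1).l6 h5)))

theorem Dset_of_J (S : SState m X r) {v j : V} (h : Hs (X v) (X j) 1 ≠ 0) : Dset X r v j :=
  ⟨S.Jlt h, j, h, Relation.ReflTransGen.refl⟩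

theorem Dset_closed (S : SState m X r) {v x d : V} (hx : r v < r x) (hd : Dset X r v d) (hxd : x ≠ d)
    (hnx : ¬ Dset X r v x) : ∀ p, Hs (X x) (X d) p = 0 := by
  by_contra hcon
  push Not at hcon
  obtain ⟨_, j, hj, hp⟩ := hd
  exact hnx ⟨hx, j, hj, Relation.ReflTransGen.head ⟨hxd, hcon⟩ hp⟩

open Classical in
theorem SState.lower (S : SState m X r) {X' : V → Stk Q} {v : V} (L : Low X X' v) (hv : 1 ≤ (X v).2) :
    ∃ r', SState m X' r' := by
  obtain ⟨N, hN⟩ : ∃ N, ∀ x, r x < N := ⟨(Finset.univ.sup r) + 1, fun x => Nat.lt_succ_of_le (Finset.le_sup (Finset.mem_univ x))⟩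
  let r' : V → ℕ := fun x => if r x < r v ∨ Dset X r v x then r x else N + r x
  have hvD : ¬ Dset X r v v := fun h => by have := h.1; omega
  have hr'v : r' v = N + r v := by simp [r', hvD]
  have J1 : ∀ j, Hs (X v) (X j) 1 ≠ 0 → ∀ i p, Hs (X i) (X j) p = 0 → Hs (X i) (X v) p = 0 → Hs (X i) (X' j) p = 0 :=
    fun j hj i p h1 h2 => (L.tri j hj).cov2 _ _ h1 h2
  have Jv : ∀ j, Hs (X v) (X j) 1 ≠ 0 → ∀ p, Hs (X j) (X v) p = 0 := fun j hj => S.ord v j (S.Jlt hj)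
  refine ⟨r', ?_⟩
  constructor
  · intro i
    by_cases hi : i = v
    · subst hi; rw [L.atv]; simp only [sh]; omega
    by_cases hJ : Hs (X v) (X i) 1 = 0
    · rw [L.nJ i hi hJ]; exact S.deg0 i
    · have := L.dg i hJ; omega
  · intro i
    have := S.degm v
    by_cases hi : i = v
    · subst hi; rw [L.atv]; simp only [sh]; omega
    by_cases hJ : Hs (X v) (X i) 1 = 0
    · rw [L.nJ i hi hJ]; exact S.degm i
    · have := L.dg i hJ; omega
  · intro x y hxy
    simp only [r'] at hxy
    have := hN x
    have := hN y
    apply S.rinj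
    split_ifs at hxy <;> omega
  · intro i
    by_cases hi : i = v
    · subst hi; rw [L.atv]; exact S.exc i
    by_cases hJ : Hs (X v) (X i) 1 = 0
    · rw [L.nJ i hi hJ]; exact S.exc i
    · have h1 : Hs (X i) (X' i) 1 = 0 := J1 i hJ i 1 (by rw [Hs_exc _ (S.exc i)]; simp) (Jv i hJ 1)
      have h2 : Hs (X' i) (X' i) 1 = 0 := (L.tri i hJ).con2 _ _ h1 (L.l3 i hJ 1)
      have h3 : qext (X' i).1 (X' i).1 = 0 := by
        rw [qext_eq_zero]; exact ((Hs_zero _ _ _).mp h2).2 (by simp)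
      refine ⟨?_, h3⟩
      have e1 := EF_cls (X' i) (X' i)
      rw [L.cl i hJ, EF_add_left, EF_add_right, EF_add_right, EF_smul_left, EF_smul_right, EF_smul_left,
        EF_smul_right, EF_exc _ (S.exc i), EF_exc _ (S.exc v), EF_all_zero _ _ (Jv i hJ), h3] at e1
      obtain ⟨a, x, h4, h5⟩ := Hs_single _ _ (S.conc (S.Jne hJ).symm)
      have h6 := h4 1
      have : a = 1 := by
        by_contra hne
        rw [if_neg (fun h => hne h.symm)] at h6; exact hJ h6
      subst this
      simp only [if_true] at h6
      rw [h5, h6] at e1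
      simp at e1
      omega
  · intro i j hij p
    have hNi := hN i
    have hNj := hN j
    have hNv := hN v
    by_cases hj : j = v
    · subst hj
      rw [L.atv, Hs_sh_left]
      rw [hr'v] at hij
      have hi : r i < r j ∨ Dset X r j i := by
        by_contra hcon
        simp only [r', if_neg hcon] at hij
        rcases Nat.lt_trichotomy (r i) (r j) with h | h | h
        · exact hcon (Or.inl h)
        · omega
        · omega
      by_cases hJ : Hs (X j) (X i) 1 = 0
      · have hij : i ≠ j := by
          rintro rfl; rcases hi with h | h
          · omega
          · exact hvD h
        rw [L.nJ i hij hJ]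
        rcases hi with h | h
        · exact S.ord i j h _
        · exact S.claim h hJ _
      · exact L.l3 i hJ _
    by_cases hi : i = v
    · subst hi
      rw [L.atv, Hs_sh_right]
      rw [hr'v] at hij
      have hj1 : ¬ (r j < r i ∨ Dset X r i j) := by
        intro hcon
        simp only [r', if_pos hcon] at hij
        omega
      have hJ : Hs (X i) (X j) 1 = 0 := by
        by_contra hJ
        exact hj1 (Or.inr (Dset_of_J S hJ))
      rw [L.nJ j hj hJ]
      refine S.ord i j ?_ _
      have : r i ≠ r j := S.rinj.ne (Ne.symm hj)
      have : ¬ r j < r i := fun h => hj1 (Or.inl h)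
      omega
    have hrvi : r v ≠ r i := S.rinj.ne (Ne.symm hi)
    have hrvj : r v ≠ r j := S.rinj.ne (Ne.symm hj)
    have hne : i ≠ j := by rintro rfl; omega
    have hrij : r i ≠ r j := S.rinj.ne hne
    have key : (r i < r j ∧ (r i < r v ∨ Dset X r v i ∨ ¬ Dset X r v j)) ∨ (Dset X r v i ∧ ¬ Dset X r v j ∧ r v < r j) := by
      simp only [r'] at hij
      by_cases hDi : Dset X r v i <;> by_cases hDj : Dset X r v j <;>
        simp only [hDi, hDj, or_true, or_false, if_true, if_false, not_true, not_false_eq_true, and_true, true_and, and_false, false_and] at hij ⊢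
      · omega
      · split_ifs at hij <;> omega
      · split_ifs at hij <;> omega
      · split_ifs at hij <;> omega
    have ji0 : ∀ p, Hs (X j) (X i) p = 0 := by
      rcases key with h | ⟨h1, h2, h3⟩
      · exact S.ord i j h.1
      · exact Dset_closed S h3 h1 hne.symm h2
    by_cases hJi : Hs (X v) (X i) 1 = 0 <;> by_cases hJj : Hs (X v) (X j) 1 = 0
    · rw [L.nJ i hi hJi, L.nJ j hj hJj]; exact ji0 p
    · rw [L.nJ i hi hJi]
      refine (L.tri j hJj).con2 _ _ (ji0 p) ?_
      have hD := Dset_of_J S hJj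
      rcases key with ⟨h, h2⟩ | h
      · rcases h2 with h2 | h2 | h2
        · exact S.ord i v h2 p
        · exact S.claim h2 hJi p
        · exact absurd hD h2
      · exact absurd hD h.2.1
    · rw [L.nJ j hj hJj]
      refine J1 i hJi j p (ji0 p) (S.ord v j ?_ p)
      have := S.Jlt hJi
      rcases key with h | h
      · omega
      · exact h.2.2
    · exact (L.tri j hJj).con2 _ _ (J1 i hJi j p (ji0 p) (Jv j hJj p)) (L.l3 i hJi p)
  · intro i j hij p hp
    by_cases hiv : i = v
    · subst hiv
      rw [L.atv, Hs_sh_left]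
      by_cases hJ : Hs (X i) (X j) 1 = 0
      · rw [L.nJ j hij.symm hJ]
        by_cases h : p = 0
        · subst h; simpa using hJ
        · exact S.pos i j hij _ (by omega)
      · exact L.l3 j hJ _
    by_cases hjv : j = v
    · subst hjv
      rw [L.atv, Hs_sh_right]
      by_cases hJ : Hs (X j) (X i) 1 = 0
      · rw [L.nJ i hij hJ]
        exact S.pos i j hij _ (by omega)
      · refine (L.tri i hJ).con2 _ _ (Jv i hJ _) ?_
        rw [Hs_exc _ (S.exc j), if_neg (by omega)]
    by_cases hJi : Hs (X v) (X i) 1 = 0 <;> by_cases hJj : Hs (X v) (X j) 1 = 0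
    · rw [L.nJ i hiv hJi, L.nJ j hjv hJj]; exact S.pos i j hij p hp
    · rw [L.nJ i hiv hJi]
      exact J1 j hJj i p (S.pos i j hij p hp) (S.pos i v hiv p hp)
    · rw [L.nJ j hjv hJj]
      exact (L.tri i hJi).con2 _ _ (S.pos i j hij p hp) (S.pos v j (Ne.symm hjv) p hp)
    · exact (L.tri i hJi).con2 _ _ (J1 j hJj i p (S.pos i j hij p hp) (S.pos i v hiv p hp)) (L.l3 j hJj p)

end States

def Sgl (h : ℤ → ℕ) (a : ℤ) (x : ℕ) : Prop := ∀ p, h p = if p = a then x else 0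

theorem core {P B P' : ℤ → ℕ} {a b a' : ℤ} {x y x' k : ℕ}
    (hP : Sgl P a x) (hB : Sgl B b y) (hP' : Sgl P' a' x') (hk : 0 < k)
    (p1 : ∀ c, P c = 0 → B c = 0 → P' c = 0)
    (p2 : ∀ c, B (c - 1) = 0 → P' c = 0 → P c = 0)
    (p3 : ∀ c, P (c + 1) = 0 → P' c = 0 → B c = 0)
    (eu : (a'.negOnePow : ℤ) * x' = (a.negOnePow : ℤ) * x + k * ((b.negOnePow : ℤ) * y)) :
    (∀ c, P' c = (2 * (P c : ℤ) - x + ((B c : ℤ) - B (c - 1)) * k).toNat) ∧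
      (x ≠ 0 → y ≠ 0 → a = b ∨ a = b + 1) := by
  have hab : x ≠ 0 → y ≠ 0 → a = b ∨ a = b + 1 := by
    intro hx hy
    by_contra hcon
    push Not at hcon
    have h1 : P' a ≠ 0 := fun h => by
      have := p2 a (by rw [hB, if_neg (by omega)]) h
      rw [hP, if_pos rfl] at this; exact hx this
    have h2 : P' b ≠ 0 := fun h => by
      have := p3 b (by rw [hP, if_neg (by omega)]) h
      rw [hB, if_pos rfl] at this; exact hy this
    rw [hP'] at h1 h2
    have h3 : a = a' := by by_contra h; simp [h] at h1
    have h4 : b = a' := by by_contra h; simp [h] at h2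
    exact hcon.1 (by omega)
  refine ⟨fun c => ?_, hab⟩
  have hx' : x' ≠ 0 → (a' = a ∧ x ≠ 0) ∨ (a' = b ∧ y ≠ 0) := by
    intro h
    by_contra hcon
    push Not at hcon
    have := p1 a' (by rw [hP]; split_ifs with h1; exacts [hcon.1 h1, rfl]) (by rw [hB]; split_ifs with h1; exacts [hcon.2 h1, rfl])
    rw [hP', if_pos rfl] at this
    exact h this
  have sgn : ∀ n : ℤ, (n.negOnePow : ℤ) = 1 ∨ (n.negOnePow : ℤ) = -1 := fun n => by
    rcases Int.units_eq_one_or n.negOnePow with h | h <;> rw [h] <;> simp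
  have hsb : ((b + 1).negOnePow : ℤ) = - (b.negOnePow : ℤ) := by rw [Int.negOnePow_succ]; simp
  rw [hP', hP, hB, hB]
  by_cases hx : x = 0
  · subst hx
    by_cases hy : y = 0
    · subst hy
      have : x' = 0 := by
        have h := sgn a'
        rcases h with h | h <;> rw [h] at eu <;> simp at eu <;> exact eu
      simp [this]
    · have hky : 0 < k * y := Nat.mul_pos hk (Nat.pos_of_ne_zero hy)
      have hx'0 : x' ≠ 0 := by
        rintro rfl
        rcases sgn b with h | h <;> rw [h] at eu <;> simp at eu <;> omega
      have ha' : a' = b := by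
        rcases hx' hx'0 with h | h
        · exact absurd rfl h.2
        · exact h.1
      subst ha'
      have : (x' : ℤ) = k * y := by
        rcases sgn a' with h | h <;> rw [h] at eu <;> simp at eu <;> linarith
      by_cases h1 : c = a'
      · subst h1; simp; rw [mul_comm, ← this]; simp
      · by_cases h2 : c - 1 = a'
        · simp only [h1, h2, if_false, if_true]
          symm; apply Int.toNat_of_nonpos; push_cast
          have : (0:ℤ) < k * y := by exact_mod_cast hky
          rw [ite_self]
          nlinarith
        · simp [h1, h2]
  · by_cases hy : y = 0
    · subst hy
      have hx'0 : x' ≠ 0 := by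
        rintro rfl
        rcases sgn a with h | h <;> rw [h] at eu <;> simp at eu <;> omega
      have ha' : a' = a := by
        rcases hx' hx'0 with h | h
        · exact h.1
        · exact absurd rfl h.2
      subst ha'
      have : (x' : ℤ) = x := by
        rcases sgn a' with h | h <;> rw [h] at eu <;> simp at eu <;> linarith
      by_cases h1 : c = a'
      · subst h1; simp; omega
      · simp [h1]
    · have hky : 0 < k * y := Nat.mul_pos hk (Nat.pos_of_ne_zero hy)
      have hky' : (0 : ℤ) < k * y := by exact_mod_cast hky
      rcases hab hx hy with h0 | h0
      · subst h0
        have hxk : (0:ℤ) < x + k * y := by positivity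
        have hx'0 : x' ≠ 0 := by
          rintro rfl
          rcases sgn a with h | h <;> rw [h] at eu <;> simp at eu <;> linarith
        have ha' : a' = a := by
          rcases hx' hx'0 with h | h
          · exact h.1
          · exact h.1
        subst ha'
        have : (x' : ℤ) = x + k * y := by
          rcases sgn a' with h | h <;> rw [h] at eu <;> simp at eu <;> linarith
        by_cases h1 : c = a'
        · subst h1; simp
          have : (2 * (x:ℤ) - x + y * k) = x' := by rw [this]; ring
          rw [this]; simp
        · by_cases h2 : c - 1 = a'
          · simp only [h1, h2, if_false, if_true]
            symm; apply Int.toNat_of_nonpos; push_cast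
            nlinarith
          · simp [h1, h2]
      · subst h0
        rw [hsb] at eu
        have e2 : (x' = 0 ∧ (x : ℤ) = k * y) ∨ (a' = b + 1 ∧ (x' : ℤ) = x - k * y) ∨ (a' = b ∧ (x':ℤ) = k * y - x) := by
          by_cases hx'0 : x' = 0
          · left; refine ⟨hx'0, ?_⟩
            subst hx'0
            rcases sgn b with h | h <;> rw [h] at eu <;> simp at eu <;> linarith
          · right
            rcases hx' hx'0 with h | h
            · left; refine ⟨h.1, ?_⟩
              rw [h.1, hsb] at eu
              rcases sgn b with h | h <;> rw [h] at eu <;> simp at eu <;> linarith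
            · right; refine ⟨h.1, ?_⟩
              rw [h.1] at eu
              rcases sgn b with h | h <;> rw [h] at eu <;> simp at eu <;> linarith
        generalize hK : (k : ℤ) * y = K at *
        have hK2 : (y : ℤ) * k = K := by rw [mul_comm]; exact hK
        by_cases h1 : c = b
        · subst h1
          simp [hK2]
          rcases e2 with ⟨h, h2⟩ | ⟨h, h2⟩ | ⟨h, h2⟩
          · simp [h]; omega
          · rw [if_neg (by omega)]; omega
          · rw [if_pos h.symm]; omega
        · by_cases h2 : c = b + 1
          · subst h2
            simp [hK2]
            rcases e2 with ⟨h, h2⟩ | ⟨h, h2⟩ | ⟨h, h2⟩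
            · simp [h]; omega
            · rw [if_pos h.symm]; omega
            · rw [if_neg (by omega)]; omega
          · have h3 : c - 1 ≠ b := by omega
            simp [h1, h2, h3]
            rcases e2 with ⟨h, h2⟩ | ⟨h, h2⟩ | ⟨h, h2⟩
            · intro _; exact h
            · intro h; omega
            · intro h; omega

/-! q-level lemmas -/
section ql
variable {m : ℕ} {V : Type*} [DecidableEq V]

theorem zm_neg : (m : ZMod (m + 1)) = -1 := by
  have : ((m + 1 : ℕ) : ZMod (m + 1)) = 0 := ZMod.natCast_self _
  push_cast at this
  exact eq_neg_of_add_eq_zero_left this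

def Szm (f : ZMod (m + 1) → ℕ) (a : ZMod (m + 1)) (x : ℕ) : Prop := ∀ c, f c = if c = a then x else 0

theorem Szm.sum {f : ZMod (m + 1) → ℕ} {a : ZMod (m + 1)} {x : ℕ} (h : Szm f a x) (c : ZMod (m + 1)) :
    (f c : ℤ) - ∑ t ∈ Finset.univ.filter (fun t => t ≠ c), (f t : ℤ) = 2 * f c - x := by
  have h1 : ∑ t, (f t : ℤ) = x := by
    simp [show ∀ t, f t = _ from h]
  have h2 := Finset.sum_filter_add_sum_filter_not Finset.univ (fun t => t ≠ c) (fun t => (f t : ℤ))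
  rw [h1] at h2
  have h3 : ∑ t ∈ Finset.univ.filter (fun t => ¬ t ≠ c), (f t : ℤ) = f c := by
    have : Finset.univ.filter (fun t : ZMod (m+1) => ¬ t ≠ c) = {c} := by ext; simp
    rw [this]; simp
  rw [h3] at h2
  linarith

structure Good (q : V → V → ZMod (m + 1) → ℕ) : Prop where
  loop : ∀ i c, q i i c = 0
  skew : ∀ i j c, q i j c = q j i (-1 - c)
  mono : ∀ i j, ∃ a x, Szm (q i j) a x

variable {q : V → V → ZMod (m + 1) → ℕ} {v : V}

theorem cm_left (j : V) (c : ZMod (m + 1)) : colMut m q v v j c = q v j (c + 1) := by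
  simp [colMut]
theorem cm_right {i : V} (hi : i ≠ v) (c : ZMod (m + 1)) : colMut m q v i v c = q i v (c - 1) := by
  simp [colMut, hi]
theorem cm_mid {i j : V} (hi : i ≠ v) (hj : j ≠ v) {a x} (h : Szm (q i j) a x) (c : ZMod (m + 1)) :
    colMut m q v i j c = (2 * (q i j c : ℤ) - x + ((q i v c : ℤ) - q i v (c - 1)) * q v j 0
      + (q i v (-1) : ℤ) * ((q v j c : ℤ) - q v j (c + 1))).toNat := by
  simp only [colMut, if_neg hi, if_neg hj]
  rw [h.sum, zm_neg]

theorem Szm.self {f : ZMod (m + 1) → ℕ} {a : ZMod (m + 1)} {x : ℕ} (h : Szm f a x) (c : ZMod (m + 1)) :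
    (2 * (f c : ℤ) - x).toNat = f c := by
  rw [h c]; split_ifs <;> simp
  omega

theorem cm_skew (G : ∀ i j c, q i j c = q j i (-1 - c)) (Hl : ∀ c, q v v c = 0) (i j : V) (c : ZMod (m + 1)) :
    colMut m q v i j c = colMut m q v j i (-1 - c) := by
  by_cases hi : i = v
  · subst hi
    by_cases hj : j = i
    · subst hj; rw [cm_left, cm_left, Hl, Hl]
    · rw [cm_left, cm_right hj, G]; congr 1; ring
  by_cases hj : j = v
  · subst hj
    rw [cm_left, cm_right hi, G]; congr 1; ring
  simp only [colMut, if_neg hi, if_neg hj]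
  rw [zm_neg]
  have e1 : q j i (-1 - c) = q i j c := (G i j c).symm
  have e2 : ∑ t ∈ Finset.univ.filter (fun t => t ≠ -1 - c), (q j i t : ℤ) = ∑ t ∈ Finset.univ.filter (fun t => t ≠ c), (q i j t : ℤ) := by
    refine Finset.sum_nbij' (fun t => -1 - t) (fun t => -1 - t) ?_ ?_ ?_ ?_ ?_
    · intro t; simp; intro h h2; apply h; rw [← h2]; ring
    · intro t; simp
    · intro t _; ring
    · intro t _; ring
    · intro t _; rw [G j i]
  rw [e1, e2, G j v (-1 - c), G j v (-1 - c - 1), G v i 0, G j v (-1), G v i (-1 - c), G v i (-1-c+1)]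
  ring_nf

theorem Good.q0 (G : Good q) (i j : V) : q i j (-1) = q j i 0 := by rw [G.skew]; congr 1; ring

theorem cm_C1 (G : Good q) {i j : V} (hi : i ≠ v) (hj : j ≠ v) (h1 : q v i 0 = 0) (h2 : q v j 0 = 0) (c) :
    colMut m q v i j c = q i j c := by
  obtain ⟨a, x, h⟩ := G.mono i j
  rw [cm_mid hi hj h, h2, G.q0, h1]
  simp [h.self]

theorem Szm.at {f : ZMod (m + 1) → ℕ} {a b : ZMod (m + 1)} {x : ℕ} (h : Szm f a x) (hb : f b ≠ 0) : Szm f b (f b) := by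
  have : b = a := by
    by_contra hne; apply hb; rw [h b, if_neg hne]
  subst this
  have h2 : f b = x := by rw [h b, if_pos rfl]
  rw [h2]; exact h

theorem Good.at (G : Good q) {i j : V} {b : ZMod (m + 1)} (h : q i j b ≠ 0) : Szm (q i j) b (q i j b) := by
  obtain ⟨a, x, h1⟩ := G.mono i j
  exact h1.at h

theorem cm_C2 (G : Good q) {i j : V} (hi : i ≠ v) (hj : j ≠ v) (h1 : q v i 0 ≠ 0) (h2 : q v j 0 ≠ 0) (c) :
    colMut m q v i j c = q i j c := by
  obtain ⟨a, x, h⟩ := G.mono i j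
  have h3 := G.at h2
  have h4 := G.at h1
  have h5 : ∀ c, q i v c = if c = -1 then q v i 0 else 0 := fun c => by
    rw [G.skew, h4 (-1 - c)]
    congr 1
    exact propext ⟨fun h => (by rw [sub_eq_zero] at h; exact h.symm), fun h => by rw [h]; ring⟩
  rw [cm_mid hi hj h, h3 c, h3 (c + 1), h5, h5, h5, if_pos rfl]
  have e1 : (c - 1 = -1) = (c = 0) := propext (by constructor <;> intro h <;> linear_combination h)
  have e2 : (c + 1 = 0) = (c = -1) := propext (by constructor <;> intro h <;> linear_combination h)
  simp only [e1, e2]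
  have : (((if c = -1 then q v i 0 else 0 : ℕ) : ℤ) - (if c = 0 then q v i 0 else 0 : ℕ)) * (q v j 0) + (q v i 0) * (((if c = 0 then q v j 0 else 0 : ℕ) : ℤ) - (if c = -1 then q v j 0 else 0 : ℕ)) = 0 := by
    split_ifs <;> push_cast <;> ring
  rw [add_assoc, this, add_zero, h.self]

theorem cm_C3 (G : Good q) {i j : V} (hi : i ≠ v) (hj : j ≠ v) (h1 : q v i 0 = 0) {a x} (h : Szm (q i j) a x) (c) :
    colMut m q v i j c = (2 * (q i j c : ℤ) - x + ((q i v c : ℤ) - q i v (c - 1)) * q v j 0).toNat := by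
  rw [cm_mid hi hj h, G.q0 i v, h1]; simp

end ql

section zmh
variable {m : ℕ}

theorem zval_neg (c : ZMod (m + 1)) : ((-1 - c : ZMod (m + 1)).val : ℤ) = m - c.val := by
  have h1 : c.val < m + 1 := ZMod.val_lt c
  have h2 : (-1 - c : ZMod (m + 1)) = ((m - c.val : ℕ) : ZMod (m + 1)) := by
    rw [Nat.cast_sub (by omega), zm_neg]; simp
  rw [h2, ZMod.val_natCast_of_lt (by omega)]
  omega

theorem zeq_m1 {c : ZMod (m + 1)} (h : c.val = m) : c = -1 := by
  have h5 : ((c.val : ℕ) : ZMod (m + 1)) = ((m : ℕ) : ZMod (m + 1)) := congrArg _ h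
  rw [zm_neg] at h5
  simpa using h5

theorem zval_succ {c : ZMod (m + 1)} (h : c ≠ -1) : ((c + 1 : ZMod (m + 1)).val : ℤ) = c.val + 1 := by
  have h1 : c.val < m + 1 := ZMod.val_lt c
  have h3 : c.val ≠ m := by
    intro h4; exact h (zeq_m1 h4)
  have h2 : (c + 1 : ZMod (m + 1)) = ((c.val + 1 : ℕ) : ZMod (m + 1)) := by simp
  rw [h2, ZMod.val_natCast_of_lt (by omega)]
  omega

theorem zval_pred {c : ZMod (m + 1)} (h : c ≠ 0) : ((c - 1 : ZMod (m + 1)).val : ℤ) = c.val - 1 := by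
  have := zval_succ (c := c - 1) (by intro h2; apply h; linear_combination h2)
  rw [sub_add_cancel] at this; omega

theorem zval_m1 : ((-1 : ZMod (m + 1)).val : ℤ) = m := by
  have := zval_neg (m := m) 0; simpa using this

theorem sz_of {f : ZMod (m + 1) → ℕ} {F : ℤ → ℕ} {a : ℤ} {x : ℕ} (hf : ∀ c, f c = F c.val)
    (hF : Sgl F a x) (hr : x ≠ 0 → 0 ≤ a ∧ a ≤ m) : ∃ a', Szm f a' x := by
  by_cases hx : x = 0
  · refine ⟨0, fun c => ?_⟩
    rw [hf, hF, hx]; simp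
  · obtain ⟨h0, h1⟩ := hr hx
    refine ⟨(a.toNat : ZMod (m + 1)), fun c => ?_⟩
    rw [hf, hF]
    congr 1
    refine propext ⟨fun h => ?_, fun h => ?_⟩
    · have : a.toNat = c.val := by omega
      rw [this]; simp
    · rw [h, ZMod.val_natCast_of_lt (by omega)]; omega

theorem cmatch {f g f' : ZMod (m + 1) → ℕ} {F G F' : ℤ → ℕ}
    (hf : ∀ c, f c = F c.val) (hg : ∀ c, g c = G c.val) (hf' : ∀ c, f' c = F' c.val)
    {a b a' : ℤ} {x y x' k : ℕ}
    (hP : Sgl F a x) (hB : Sgl G b y) (hP' : Sgl F' a' x') (hk : 0 < k)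
    (hG1 : G (-1) = 0) (hGm : G m = 0)
    (p1 : ∀ c, F c = 0 → G c = 0 → F' c = 0)
    (p2 : ∀ c, G (c - 1) = 0 → F' c = 0 → F c = 0)
    (p3 : ∀ c, F (c + 1) = 0 → F' c = 0 → G c = 0)
    (eu : (a'.negOnePow : ℤ) * x' = (a.negOnePow : ℤ) * x + k * ((b.negOnePow : ℤ) * y)) :
    (∀ c, f' c = (2 * (f c : ℤ) - x + ((g c : ℤ) - g (c - 1)) * k).toNat) ∧
    (∀ c d, f c ≠ 0 → g d ≠ 0 → c = d ∨ c = d + 1) := by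
  obtain ⟨h1, h2⟩ := core hP hB hP' hk p1 p2 p3 eu
  constructor
  · intro c
    have : g (c - 1) = G (c.val - 1) := by
      by_cases hc : c = 0
      · subst hc
        rw [zero_sub, hg, zval_m1, hGm]
        simp [hG1]
      · rw [hg, zval_pred hc]
    rw [this, hf', hf, hg, h1]
  · intro c d hc hd
    rw [hf, hP] at hc
    rw [hg, hB] at hd
    have e1 : (c.val : ℤ) = a ∧ x ≠ 0 := by
      by_contra h; apply hc; split_ifs with h3
      · by_contra h4; exact h ⟨h3, h4⟩
      · rfl
    have e2 : (d.val : ℤ) = b ∧ y ≠ 0 := by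
      by_contra h; apply hd; split_ifs with h3
      · by_contra h4; exact h ⟨h3, h4⟩
      · rfl
    rcases h2 e1.2 e2.2 with h | h
    · left; apply ZMod.val_injective; omega
    · right
      have : c.val = d.val + 1 := by omega
      have h5 : ((c.val : ℕ) : ZMod (m+1)) = ((d.val + 1 : ℕ) : ZMod (m+1)) := by rw [this]
      simpa using h5
end zmh

section LM
variable {V : Type*} [Fintype V] [DecidableEq V] {Q : V → V → ℕ}
variable {m : ℕ} {X : V → Stk Q} {r : V → ℕ}

noncomputable def qof (m : ℕ) (X : V → Stk Q) (i j : V) (c : ZMod (m + 1)) : ℕ :=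
  if i = j then 0 else Hs (X i) (X j) ((c.val : ℤ) + 1) + Hs (X j) (X i) ((m : ℤ) + 1 - c.val)

theorem qof_ne {i j : V} (h : i ≠ j) (c : ZMod (m + 1)) :
    qof m X i j c = Hs (X i) (X j) ((c.val : ℤ) + 1) + Hs (X j) (X i) ((m : ℤ) + 1 - c.val) := if_neg h

theorem SState.range (S : SState m X r) {i j : V} (h : i ≠ j) {p : ℤ} (hp : Hs (X i) (X j) p ≠ 0) :
    1 ≤ p ∧ p ≤ m + 1 := by
  constructor
  · by_contra hlt; exact hp (S.pos i j h p (by omega))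
  · have := S.deg0 j
    have := S.degm i
    rcases Hs_ne_deg hp with h | h <;> omega

theorem qof_skew (m : ℕ) (X : V → Stk Q) (i j : V) (c : ZMod (m + 1)) : qof m X i j c = qof m X j i (-1 - c) := by
  by_cases h : i = j
  · simp [qof, h]
  · rw [qof_ne h, qof_ne (Ne.symm h), zval_neg, add_comm]
    congr 2 <;> ring

theorem Sg.shift {h : ℤ → ℕ} {a : ℤ} {x : ℕ} (H : Sg h a x) : Sgl (fun c => h (c + 1)) (a - 1) x := by
  intro p; change h (p + 1) = _; rw [H]; congr 1; exact propext ⟨fun h => by omega, fun h => by omega⟩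
theorem Sg.refl {h : ℤ → ℕ} {a : ℤ} {x : ℕ} (H : Sg h a x) (n : ℤ) : Sgl (fun c => h (n - c)) (n - a) x := by
  intro p; change h (n - p) = _; rw [H]; congr 1; exact propext ⟨fun h => by omega, fun h => by omega⟩

theorem Sg.ne {h : ℤ → ℕ} {a : ℤ} {x : ℕ} (H : Sg h a x) (hx : x ≠ 0) : h a ≠ 0 := by
  rw [H, if_pos rfl]; exact hx

theorem good_qof (S : SState m X r) : Good (qof m X) := by
  refine ⟨fun i c => by simp [qof], qof_skew m X, fun i j => ?_⟩
  by_cases hij : i = j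
  · exact ⟨0, 0, fun c => by simp [qof, hij]⟩
  have hji := Ne.symm hij
  rcases lt_or_gt_of_ne (S.rinj.ne hij) with h | h
  · obtain ⟨a, x, h1, _⟩ := Hs_single _ _ (S.conc hij)
    have hx : x ≠ 0 → 0 ≤ a - 1 ∧ a - 1 ≤ m := fun hx => by
      have := S.range hij (h1.ne hx); omega
    obtain ⟨a', h2⟩ := sz_of (m := m) (f := qof m X i j) (fun c => by
      rw [qof_ne hij, S.ord i j h, add_zero]) h1.shift hx
    exact ⟨a', x, h2⟩
  · obtain ⟨a, x, h1, _⟩ := Hs_single _ _ (S.conc hji)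
    have hx : x ≠ 0 → 0 ≤ (m : ℤ) + 1 - a ∧ (m : ℤ) + 1 - a ≤ m := fun hx => by
      have := S.range hji (h1.ne hx); omega
    obtain ⟨a', h2⟩ := sz_of (m := m) (f := qof m X i j) (fun c => by
      rw [qof_ne hij, S.ord j i h, zero_add]) (h1.refl ((m : ℤ) + 1)) hx
    exact ⟨a', x, h2⟩

theorem Sg.at {h : ℤ → ℕ} {a p : ℤ} {x : ℕ} (H : Sg h a x) (hp : h p ≠ 0) : a = p ∧ x = h p := by
  have := H p
  split_ifs at this with h1
  · exact ⟨h1.symm, this.symm⟩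
  · exact absurd this hp

/-- niceness -/
def Nice (q : V → V → ZMod (m + 1) → ℕ) (v : V) : Prop :=
  ∀ i j a b, i ≠ v → q v j 0 ≠ 0 → q v i 0 = 0 → q i v b ≠ 0 → q i j a ≠ 0 → a = b ∨ a = b + 1

theorem negOnePow_pred (a : ℤ) : ((a - 1).negOnePow : ℤ) = - (a.negOnePow : ℤ) := by
  rw [Int.negOnePow_sub]; simp

theorem lower_mixed (S : SState m X r) {X' : V → Stk Q} {r' : V → ℕ} (S' : SState m X' r') {v : V} (L : Low X X' v)
    (hv : 1 ≤ (X v).2) {i j : V} (hi : i ≠ v) (hj : Hs (X v) (X j) 1 ≠ 0) (hiJ : Hs (X v) (X i) 1 = 0) :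
    (∀ c, qof m X' i j c = (2 * (qof m X i j c : ℤ) - (∑ t, qof m X i j t : ℕ) +
      ((qof m X i v c : ℤ) - qof m X i v (c - 1)) * (Hs (X v) (X j) 1 : ℕ)).toNat) ∧
    (∀ c d, qof m X i j c ≠ 0 → qof m X i v d ≠ 0 → c = d ∨ c = d + 1) := by
  have hjv := S.Jne hj
  have hij : i ≠ j := by rintro rfl; exact hj hiJ
  have T := L.tri j hj
  have hX'i : X' i = X i := L.nJ i hi hiJ
  have hjlt := S.Jlt hj
  have hk := Nat.pos_of_ne_zero hj
  set k := Hs (X v) (X j) 1 with hkd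
  have hrij : r i ≠ r j := S.rinj.ne hij
  have hrvi : r v ≠ r i := S.rinj.ne (Ne.symm hi)
  have hsum : ∀ a x, Szm (qof m X i j) a x → ∑ t, qof m X i j t = x := by
    intro a x h
    rw [Finset.sum_congr rfl (fun t _ => h t)]; simp
  have dich : ((∀ p, Hs (X j) (X i) p = 0) ∧ (∀ p, Hs (X v) (X i) p = 0)) ∨
      ((∀ p, Hs (X i) (X j) p = 0) ∧ (∀ p, Hs (X i) (X v) p = 0)) := by
    rcases Nat.lt_or_ge (r i) (r v) with h1 | h1
    · left; exact ⟨S.ord i j (by omega), S.ord i v h1⟩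
    rcases Nat.lt_or_ge (r j) (r i) with h2 | h2
    · right; exact ⟨S.ord j i h2, S.ord v i (by omega)⟩
    by_cases hD : Dset X r v i
    · left; exact ⟨S.ord i j (by omega), S.claim hD hiJ⟩
    · right; exact ⟨Dset_closed S (by omega) (Dset_of_J S hj) hij hD, S.ord v i (by omega)⟩
  rcases dich with ⟨d1, d2⟩ | ⟨d1, d2⟩
  · obtain ⟨a, x, ha, ea⟩ := Hs_single _ _ (S.conc hij)
    obtain ⟨b, y, hb, eb⟩ := Hs_single _ _ (S.conc hi)
    obtain ⟨a', x', ha', ea'⟩ := Hs_single _ _ (S'.conc hij)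
    rw [hX'i] at ha' ea'
    have hx : x ≠ 0 → 0 ≤ a - 1 ∧ a - 1 ≤ m := fun hx => by
      have := S.range hij (ha.ne hx); omega
    have hf : ∀ c : ZMod (m+1), qof m X i j c = Hs (X i) (X j) ((c.val : ℤ) + 1) := fun c => by
      rw [qof_ne hij, d1, add_zero]
    obtain ⟨a0, h0⟩ := sz_of (m := m) (F := fun c => Hs (X i) (X j) (c + 1)) hf ha.shift hx
    rw [hsum _ _ h0]
    refine cmatch (F := fun c => Hs (X i) (X j) (c + 1)) (G := fun c => Hs (X i) (X v) (c + 1))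
      (F' := fun c => Hs (X i) (X' j) (c + 1)) hf ?_ ?_ ha.shift hb.shift ha'.shift hk ?_ ?_ ?_ ?_ ?_ ?_
    · intro c; rw [qof_ne hi, d2, add_zero]
    · intro c; rw [qof_ne hij, hX'i, T.con2 _ _ (d1 _) (d2 _), add_zero]
    · exact S.pos i v hi _ (by omega)
    · by_contra h
      have := S.degm i
      rcases Hs_ne_deg h with h | h <;> omega
    · intro c h1 h2; exact T.cov2 _ _ h1 h2
    · intro c h1 h2
      simp only [sub_add_cancel] at h1
      exact T.cov1 _ _ h1 h2
    · intro c h1 h2; exact T.cov3 _ _ h2 h1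
    · rw [L.cl j hj, EF_add_right, EF_smul_right, ea, eb] at ea'
      rw [negOnePow_pred, negOnePow_pred, negOnePow_pred]
      linarith
  · obtain ⟨a, x, ha, ea⟩ := Hs_single _ _ (S.conc hij.symm)
    obtain ⟨b, y, hb, eb⟩ := Hs_single _ _ (S.conc hi.symm)
    obtain ⟨a', x', ha', ea'⟩ := Hs_single _ _ (S'.conc hij.symm)
    rw [hX'i] at ha' ea'
    have hx : x ≠ 0 → 0 ≤ (m : ℤ) + 1 - a ∧ (m : ℤ) + 1 - a ≤ m := fun hx => by
      have := S.range hij.symm (ha.ne hx); omega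
    have hf : ∀ c : ZMod (m+1), qof m X i j c = Hs (X j) (X i) ((m : ℤ) + 1 - c.val) := fun c => by
      rw [qof_ne hij, d1, zero_add]
    obtain ⟨a0, h0⟩ := sz_of (m := m) (F := fun c => Hs (X j) (X i) ((m : ℤ) + 1 - c)) hf (ha.refl _) hx
    rw [hsum _ _ h0]
    refine cmatch (F := fun c => Hs (X j) (X i) ((m : ℤ) + 1 - c)) (G := fun c => Hs (X v) (X i) ((m : ℤ) + 1 - c))
      (F' := fun c => Hs (X' j) (X i) ((m : ℤ) + 1 - c)) hf ?_ ?_ (ha.refl _) (hb.refl _) (ha'.refl _) hk ?_ ?_ ?_ ?_ ?_ ?_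
    · intro c; rw [qof_ne hi, d2, zero_add]
    · intro c; rw [qof_ne hij, hX'i, T.cov2 _ _ (d1 _) (d2 _), zero_add]
    · by_contra h
      have := S.range hi.symm h; omega
    · simp only [add_sub_cancel_left]; exact hiJ
    · intro c h1 h2; exact T.con2 _ _ h1 h2
    · intro c h1 h2
      refine T.con3 _ _ h2 ?_
      have e : (m : ℤ) + 1 - (c - 1) = (m : ℤ) + 1 - c + 1 := by ring
      simp only [e] at h1; exact h1
    · intro c h1 h2
      have e : (m : ℤ) + 1 - c = (m : ℤ) + 1 - (c + 1) + 1 := by ring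
      simp only [e] at h2 ⊢
      exact T.con1 _ _ h1 h2
    · rw [L.cl j hj, EF_add_left, EF_smul_left, ea, eb] at ea'
      simp only [Int.negOnePow_sub _ a, Int.negOnePow_sub _ b, Int.negOnePow_sub _ a']
      push_cast
      linear_combination (-((((m:ℤ)+1).negOnePow : ℤˣ) : ℤ)) * ea'

theorem lower_match (S : SState m X r) {X' : V → Stk Q} {r' : V → ℕ} (S' : SState m X' r') {v : V} (L : Low X X' v)
    (hv : 1 ≤ (X v).2) : colMut m (qof m X) v = qof m X' ∧ Nice (qof m X) v := by
  have G := good_qof S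
  have G' := good_qof S'
  have hJ0 : ∀ j, j ≠ v → qof m X v j 0 = Hs (X v) (X j) 1 := by
    intro j hj
    rw [qof_ne hj.symm]
    have : Hs (X j) (X v) ((m : ℤ) + 1 - (0 : ZMod (m+1)).val) = 0 := by
      by_contra h
      have := S.degm j
      have h0 : ((0 : ZMod (m+1)).val : ℤ) = 0 := by simp
      rcases Hs_ne_deg h with h | h <;> omega
    rw [this]; simp
  have hvrow : ∀ j c, j ≠ v → qof m X' v j c = qof m X v j (c + 1) := by
    intro j c hj
    by_cases hJ : Hs (X v) (X j) 1 = 0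
    · rw [qof_ne hj.symm, L.atv, L.nJ j hj hJ, Hs_sh_left, Hs_sh_right]
      by_cases hc : c = -1
      · subst hc
        rw [neg_add_cancel, hJ0 j hj, hJ, zval_m1]
        have h1 : Hs (X v) (X j) ((m:ℤ) + 1 - -1) = 0 := by
          by_contra h; have := S.range hj.symm h; omega
        rw [h1, S.pos j v hj _ (by omega)]
      · rw [qof_ne hj.symm, zval_succ hc]
        congr 2 <;> ring
    · obtain ⟨a, x, h1, e1⟩ := Hs_single _ _ (S.conc hj.symm)
      obtain ⟨rfl, hx⟩ := h1.at hJ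
      obtain ⟨a', x', h1', e1'⟩ := Hs_single _ _ (S'.conc hj)
      have hjv0 := S.ord v j (S.Jlt hJ)
      have f1 : ∀ p, Hs (X' v) (X' j) p = 0 := fun p => by
        rw [L.atv, Hs_sh_left]; exact L.l3 j hJ _
      have f2 : ∀ p, p ≠ 1 → Hs (X' j) (X' v) p = 0 := fun p hp => by
        rw [L.atv, Hs_sh_right]
        refine (L.tri j hJ).con2 _ _ (hjv0 _) ?_
        rw [Hs_exc _ (S.exc v), if_neg (by omega)]
      have f3 : Hs (X' j) (X' v) 1 = x := by
        have hcl : cls (X' v) = (-1 : ℤ) • cls (X v) := by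
          rw [L.atv]; simp only [cls, sh]
          rw [← sub_eq_add_neg, negOnePow_pred]; module
        have e2 := EF_cls (X' j) (X' v)
        rw [hcl, L.cl j hJ, EF_smul_right, EF_add_left, EF_smul_left, EF_all_zero _ _ hjv0,
          EF_exc _ (S.exc v)] at e1'
        have h5 : (Hs (X v) (X j) 1 : ℤ) ≠ 0 := by exact_mod_cast hJ
        have h6 : x' ≠ 0 := by
          rintro rfl; simp at e1'; exact hJ e1'
        have h7 : a' = 1 := by
          by_contra h; exact (h1'.ne h6) (f2 _ h)
        subst h7
        rw [h1', if_pos rfl]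
        simp at e1'
        rw [hx]; exact e1'.symm
      rw [qof_ne hj.symm, qof_ne hj.symm, f1, zero_add, hjv0, add_zero, h1]
      by_cases hc : c = -1
      · subst hc
        rw [zval_m1]; simp [f3]
      · rw [f2, if_neg]
        · rw [zval_succ hc]; have : (0:ℤ) ≤ c.val := by positivity
          omega
        · intro h; apply hc
          exact zeq_m1 (by omega)
  have hmix : ∀ i j c, i ≠ v → j ≠ v → qof m X v i 0 = 0 → qof m X v j 0 ≠ 0 → colMut m (qof m X) v i j c = qof m X' i j c := by
    intro i j c hi hj h1 h2
    obtain ⟨a, x, h⟩ := G.mono i j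
    rw [cm_C3 G hi hj h1 h]
    rw [hJ0 i hi] at h1
    have hj2 := h2
    rw [hJ0 j hj] at hj2
    rw [(lower_mixed S S' L hv hi hj2 h1).1, hJ0 j hj]
    have : ∑ t, qof m X i j t = x := by
      rw [Finset.sum_congr rfl (fun t _ => h t)]; simp
    rw [this]
  constructor
  · funext i j c
    by_cases hi : i = v
    · subst hi
      rw [cm_left]
      by_cases hj : j = i
      · subst hj; rw [G.loop, G'.loop]
      · exact (hvrow j c hj).symm
    by_cases hj : j = v
    · subst hj
      rw [cm_right hi, G'.skew, hvrow _ _ hi, G.skew]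
      congr 1; ring
    by_cases h1 : qof m X v i 0 = 0 <;> by_cases h2 : qof m X v j 0 = 0
    · rw [cm_C1 G hi hj h1 h2]
      rw [hJ0 i hi] at h1
      rw [hJ0 j hj] at h2
      simp only [qof, L.nJ i hi h1, L.nJ j hj h2]
    · exact hmix i j c hi hj h1 h2
    · rw [cm_skew G.skew (G.loop v), hmix j i _ hj hi h2 h1, ← G'.skew]
    · rw [cm_C2 G hi hj h1 h2]
      rw [hJ0 i hi] at h1
      rw [hJ0 j hj] at h2
      by_cases hij : i = j
      · subst hij; rw [G.loop, G'.loop]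
      have main : ∀ i j, i ≠ j → Hs (X v) (X i) 1 ≠ 0 → Hs (X v) (X j) 1 ≠ 0 → ∀ p, Hs (X' i) (X' j) p = Hs (X i) (X j) p := by
        intro i j hij h1 h2
        have vz : ∀ p, Hs (X i) (X j) p = 0 → Hs (X' i) (X' j) p = 0 := fun p h =>
          (L.tri i h1).con2 _ _ ((L.tri j h2).cov2 _ _ h (S.ord v i (S.Jlt h1) p)) (L.l3 j h2 p)
        obtain ⟨a, x, ha, ea⟩ := Hs_single _ _ (S.conc hij)
        obtain ⟨a', x', ha', ea'⟩ := Hs_single _ _ (S'.conc hij)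
        obtain ⟨b, y, hb, eb⟩ := Hs_single _ _ (S.conc (S.Jne h2).symm)
        obtain ⟨rfl, hy⟩ := hb.at h2
        rw [L.cl i h1, L.cl j h2, EF_add_left, EF_add_right, EF_add_right, EF_smul_left, EF_smul_right, EF_smul_left, EF_smul_right, EF_exc _ (S.exc v), EF_all_zero _ _ (S.ord v i (S.Jlt h1)), eb, ea, ← hy] at ea'
        have hxx : (a.negOnePow : ℤ) * x = (a'.negOnePow : ℤ) * x' := by
          rw [← ea']; simp
        by_cases hx' : x' = 0
        · subst hx'
          have : x = 0 := by simpa using hxx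
          intro p; rw [ha, ha', this]; simp
        · have hne := ha'.ne hx'
          have : Hs (X i) (X j) a' ≠ 0 := fun h => hne (vz _ h)
          obtain ⟨rfl, hx⟩ := ha.at this
          have : x = x' := by simpa using hxx
          intro p; rw [ha, ha', this]
      rw [qof_ne hij, qof_ne hij, main i j hij h1 h2, main j i (Ne.symm hij) h2 h1]
  · intro i j a b hi h1 h2 h3 h4
    have hj : j ≠ v := by
      rintro rfl; exact h1 (G.loop j 0)
    rw [hJ0 i hi] at h2
    rw [hJ0 j hj] at h1
    exact (lower_mixed S S' L hv hi h1 h2).2 a b h4 h3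

end LM

section Dual
variable {V : Type*} [Fintype V] {Q : V → V → ℕ}

def qop (Q : V → V → ℕ) : V → V → ℕ := fun i j => Q j i

def qdual (M : QRep Q) : QRep (qop Q) where
  obj i := Module.Dual ℚ (M.obj i)
  map i j a := (M.map j i a).dualMap

noncomputable def transEq (A B : Type) [AddCommGroup A] [Module ℚ A] [AddCommGroup B] [Module ℚ B]
    [FiniteDimensional ℚ A] [FiniteDimensional ℚ B] :
    (A →ₗ[ℚ] B) ≃ₗ[ℚ] (Module.Dual ℚ B →ₗ[ℚ] Module.Dual ℚ A) :=
  LinearEquiv.ofInjectiveOfFinrankEq (Module.Dual.transpose (R := ℚ))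
    (by
      intro f g h
      ext x
      rw [← sub_eq_zero, ← Module.forall_dual_apply_eq_zero_iff ℚ]
      intro φ
      have := LinearMap.congr_fun (LinearMap.congr_fun h φ) x
      rw [map_sub, sub_eq_zero]; exact this)
    (by simp [Module.finrank_linearMap, Subspace.dual_finrank_eq]; ring)

theorem transEq_apply (A B : Type) [AddCommGroup A] [Module ℚ A] [AddCommGroup B] [Module ℚ B]
    [FiniteDimensional ℚ A] [FiniteDimensional ℚ B] (f : A →ₗ[ℚ] B) (φ : Module.Dual ℚ B) (x : A) :
    transEq A B f φ x = φ (f x) := rfl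

theorem qdual_hom (M N : QRep Q) : qhom (qdual N) (qdual M) = qhom M N := by
  let E : QC0 M N ≃ₗ[ℚ] QC0 (qdual N) (qdual M) :=
    LinearEquiv.piCongrRight fun i => transEq (M.obj i) (N.obj i)
  have key : LinearMap.ker (qd (qdual N) (qdual M)) = (LinearMap.ker (qd M N)).map E.toLinearMap := by
    ext g
    rw [Submodule.mem_map_equiv, LinearMap.mem_ker, LinearMap.mem_ker, qd_eq_zero, qd_eq_zero]
    obtain ⟨f, rfl⟩ := E.surjective g
    rw [LinearEquiv.symm_apply_apply]
    constructor
    · intro h i j a x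
      rw [← sub_eq_zero, ← Module.forall_dual_apply_eq_zero_iff ℚ]
      intro φ
      rw [map_sub, sub_eq_zero]
      have := LinearMap.congr_fun (h j i a φ) x
      exact this.symm
    · intro h i j a φ
      refine LinearMap.ext fun x => ?_
      exact (congrArg (show N.obj i →ₗ[ℚ] ℚ from φ) (h j i a x)).symm
  rw [qhom, qhom, key]
  exact LinearEquiv.finrank_map_eq _ _

theorem EF_op (x y : V → ℤ) : EF (qop Q) y x = EF Q x y := by
  simp only [EF, qop]
  congr 1
  · exact Finset.sum_congr rfl fun i _ => by ring
  · rw [Finset.sum_comm]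
    exact Finset.sum_congr rfl fun i _ => Finset.sum_congr rfl fun j _ => by ring

theorem qdual_dim (M : QRep Q) : qdim (qdual M) = qdim M := by
  funext i; simp only [qdim]
  change ((Module.finrank ℚ (Module.Dual ℚ (M.obj i)) : ℕ) : ℤ) = _
  rw [Subspace.dual_finrank_eq]

theorem qdual_ext (M N : QRep Q) : qext (qdual N) (qdual M) = qext M N := by
  have h1 := euler M N
  have h2 := euler (qdual N) (qdual M)
  rw [qdual_dim, qdual_dim, EF_op, qdual_hom] at h2
  omega

noncomputable def sdual (m : ℕ) (X : Stk Q) : Stk (qop Q) := (qdual X.1, m - X.2)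

theorem Hs_dual (m : ℕ) (X Y : Stk Q) (p : ℤ) : Hs (sdual m Y) (sdual m X) p = Hs X Y p := by
  simp only [Hs, sdual, qdual_hom, qdual_ext]
  have : (m : ℤ) - Y.2 - (m - X.2) = X.2 - Y.2 := by ring
  rw [this]

theorem SState.dual {m : ℕ} {X : V → Stk Q} {r : V → ℕ} (S : SState m X r) :
    SState m (fun i => sdual m (X i)) (fun i => (∑ k, r k) - r i) := by
  have hle : ∀ i, r i ≤ ∑ k, r k := fun i => Finset.single_le_sum (f := r) (fun _ _ => Nat.zero_le _) (Finset.mem_univ i)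
  refine ⟨fun i => ?_, fun i => ?_, fun i j h => ?_, fun i => ?_, fun i j h p => ?_, fun i j h p hp => ?_⟩
  · have := S.degm i; simp only [sdual]; omega
  · have := S.deg0 i; simp only [sdual]; omega
  · apply S.rinj; have := hle i; have := hle j; change (∑ k, r k) - r i = (∑ k, r k) - r j at h; omega
  · exact ⟨by simp only [sdual]; rw [qdual_hom]; exact (S.exc i).h, by simp only [sdual]; rw [qdual_ext]; exact (S.exc i).e⟩
  · rw [Hs_dual]; apply S.ord; change (∑ k, r k) - r i < (∑ k, r k) - r j at h; omega
  · rw [Hs_dual]; exact S.pos j i h.symm p hp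

theorem qof_dual [DecidableEq V] (m : ℕ) (X : V → Stk Q) (i j : V) (c : ZMod (m + 1)) :
    qof m (fun i => sdual m (X i)) i j c = qof m X j i c := by
  by_cases h : i = j
  · simp [qof, h]
  · rw [qof_ne h, qof_ne (Ne.symm h), Hs_dual, Hs_dual]
end Dual

section W
variable {V : Type*} [Fintype V] [DecidableEq V] {m : ℕ}

theorem two_pt {f f' f'' : ZMod (m + 1) → ℕ} {a a' b : ZMod (m + 1)} {x x' : ℕ} {K : ℤ} (hb : b + 1 ≠ b)
    (h : Szm f a x) (h' : Szm f' a' x') (hab : x ≠ 0 → a = b ∨ a = b + 1)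
    (e1 : ∀ c, f' c = (2 * (f c : ℤ) - x + ((if c = b then K else 0) - (if c = b + 1 then K else 0))).toNat)
    (e2 : ∀ c, f'' c = (2 * (f' c : ℤ) - x' - ((if c = b then K else 0) - (if c = b + 1 then K else 0))).toNat) :
    f'' = f := by
  have two : ∀ (F : ZMod (m + 1) → ℕ) a x, Szm F a x → (x ≠ 0 → a = b ∨ a = b + 1) →
      x = F b + F (b + 1) ∧ (F b = 0 ∨ F (b + 1) = 0) ∧ ∀ c, c ≠ b → c ≠ b + 1 → F c = 0 := by
    intro F a x h hab
    by_cases hx : x = 0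
    · subst hx
      have : ∀ c, F c = 0 := fun c => by rw [h]; simp
      simp [this]
    · rcases hab hx with rfl | rfl
      · refine ⟨?_, Or.inr ?_, fun c h1 h2 => ?_⟩
        · rw [h, h, if_pos rfl, if_neg hb]; rfl
        · rw [h, if_neg hb]
        · rw [h, if_neg h1]
      · refine ⟨?_, Or.inl ?_, fun c h1 h2 => ?_⟩
        · rw [h, h, if_pos rfl, if_neg hb.symm]; omega
        · rw [h, if_neg hb.symm]
        · rw [h, if_neg h2]
  obtain ⟨t1, t2, t3⟩ := two f a x h hab
  have hz : ∀ c, c ≠ b → c ≠ b + 1 → f' c = 0 := fun c h1 h2 => by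
    rw [e1, t3 c h1 h2, if_neg h1, if_neg h2]; simp
  obtain ⟨s1, s2, s3⟩ := two f' a' x' h' (fun hx => by
    by_contra hcon
    push Not at hcon
    have := hz a' hcon.1 hcon.2
    rw [h', if_pos rfl] at this; exact hx this)
  have u1 := e1 b
  have u2 := e1 (b + 1)
  rw [if_pos rfl, if_neg hb.symm] at u1
  rw [if_neg hb, if_pos rfl] at u2
  funext c
  by_cases h1 : c = b
  · subst h1
    rw [e2, if_pos rfl, if_neg hb.symm]; omega
  by_cases h2 : c = b + 1
  · subst h2
    rw [e2, if_neg hb, if_pos rfl]; omega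
  · rw [e2, t3 c h1 h2, hz c h1 h2, if_neg h1, if_neg h2]; simp

theorem cm_Z {q : V → V → ZMod (m + 1) → ℕ} {v : V} (G : Good q) {i j : V} (hi : i ≠ v) (hj : j ≠ v)
    (h : ∀ c, q v i c = 0) (c) : colMut m q v i j c = q i j c := by
  obtain ⟨a, x, hx⟩ := G.mono i j
  rw [cm_C3 G hi hj (h 0) hx, G.skew i v, G.skew i v, h, h]
  simp [hx.self]

theorem cm_Z2 {q : V → V → ZMod (m + 1) → ℕ} {v : V} (G : Good q) {i j : V} (hi : i ≠ v) (hj : j ≠ v)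
    (h : ∀ c, q v j c = 0) (c) : colMut m q v i j c = q i j c := by
  rw [cm_skew G.skew (G.loop v), cm_Z G hj hi h, ← G.skew]

theorem wrap (hm : 1 ≤ m) (v : V) (g : ℕ → V → V → ZMod (m + 1) → ℕ) (hg : ∀ t < m, g (t + 1) = colMut m (g t) v)
    (G : ∀ t ≤ m, Good (g t)) (N : ∀ t < m, Nice (g t) v) :
    colMut m (fun i j c => g 0 j i c) v = fun i j c => g m j i c := by
  have G0 := G 0 (Nat.zero_le _)
  have Gm := G m le_rfl
  have Go : Good (fun i j c => g 0 j i c) :=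
    ⟨fun i c => G0.loop i c, fun i j c => G0.skew j i c, fun i j => G0.mono j i⟩
  have row : ∀ t ≤ m, ∀ j c, g t v j c = g 0 v j (c + t) := by
    intro t
    induction t with
    | zero => intro _ j c; simp
    | succ t ih =>
      intro ht j c
      rw [hg t ht, cm_left, ih (by omega)]
      congr 1; push_cast; ring
  have row2 : ∀ t ≤ m, ∀ j c, g t j v c = g 0 v j (t - 1 - c) := by
    intro t ht j c
    rw [(G t ht).skew, row t ht]; congr 1; ring
  have row0 : ∀ t ≤ m, ∀ j, g t v j 0 = g 0 v j t := fun t ht j => by rw [row t ht, zero_add]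
  have b1 : ∀ b : ZMod (m + 1), b + 1 ≠ b := by
    intro b h
    have h1 : (1 : ZMod (m + 1)) = 0 := by linear_combination h
    have : Fact (1 < m + 1) := ⟨by omega⟩
    exact one_ne_zero h1
  have const : ∀ i j, ∀ s t, s ≤ t → t ≤ m → (∀ u, s ≤ u → u < t → ∀ c, g (u + 1) i j c = g u i j c) →
      ∀ c, g t i j c = g s i j c := by
    intro i j s t hst
    induction t, hst using Nat.le_induction with
    | base => intro _ _ c; rfl
    | succ t hst ih =>
      intro ht h c
      rw [h t hst (by omega), ih (by omega) (fun u h1 h2 => h u h1 (by omega))]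
  have natv : ∀ (a : ZMod (m + 1)) (t : ℕ), t ≤ m → ((t : ZMod (m + 1)) = a ↔ t = a.val) := by
    intro a t ht
    constructor
    · intro h; rw [← h, ZMod.val_natCast_of_lt (by omega)]
    · intro h; rw [h]; simp
  have stepEq : ∀ i j, i ≠ v → j ≠ v → ∀ t < m, (g 0 v i t = 0 ↔ g 0 v j t = 0) → ∀ c, g (t + 1) i j c = g t i j c := by
    intro i j hi hj t ht h c
    rw [hg t ht]
    by_cases h1 : g 0 v i t = 0
    · exact cm_C1 (G t ht.le) hi hj (by rw [row0 t ht.le, h1]) (by rw [row0 t ht.le, h.mp h1]) c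
    · exact cm_C2 (G t ht.le) hi hj (by rw [row0 t ht.le]; exact h1) (by rw [row0 t ht.le]; exact fun h2 => h1 (h.mpr h2)) c
  have main : ∀ i j, i ≠ v → j ≠ v → ∀ α β x y, Szm (g 0 v i) α x → Szm (g 0 v j) β y → x ≠ 0 → y ≠ 0 → α.val < β.val →
      ∀ c, colMut m (fun i j c => g 0 j i c) v i j c = g m j i c := by
    intro i j hi hj α β x y hα hβ hx hy hab c
    have hβm : β.val < m + 1 := ZMod.val_lt β
    have ai : ∀ t ≤ m, (g 0 v i t = 0 ↔ t ≠ α.val) := fun t ht => by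
      rw [hα, ne_eq, ← natv α t ht]; split_ifs with h <;> simp [h, hx]
    have bj : ∀ t ≤ m, (g 0 v j t = 0 ↔ t ≠ β.val) := fun t ht => by
      rw [hβ, ne_eq, ← natv β t ht]; split_ifs with h <;> simp [h, hy]
    have c1 : ∀ c, g α.val j i c = g 0 j i c := const j i 0 α.val (Nat.zero_le _) (by omega) (fun u h1 h2 =>
      stepEq j i hj hi u (by omega) (by rw [ai u (by omega), bj u (by omega)]; omega))
    have c2 : ∀ c, g β.val j i c = g (α.val + 1) j i c := const j i (α.val + 1) β.val (by omega) (by omega) (fun u h1 h2 =>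
      stepEq j i hj hi u (by omega) (by rw [ai u (by omega), bj u (by omega)]; omega))
    obtain ⟨a0, x0, hx0⟩ := G0.mono j i
    have hxα : Szm (g α.val j i) a0 x0 := fun c => by rw [c1]; exact hx0 c
    have ca : ((α.val : ℕ) : ZMod (m + 1)) = α := by simp
    have cb : ((β.val : ℕ) : ZMod (m + 1)) = β := by simp
    have s1 : ∀ c, g (α.val + 1) j i c = (2 * (g 0 j i c : ℤ) - x0 + ((if c = α - 1 - β then (x * y : ℤ) else 0) - (if c = α - 1 - β + 1 then (x * y : ℤ) else 0))).toNat := by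
      intro c
      rw [hg α.val (by omega), cm_C3 (G α.val (by omega)) hj hi (by rw [row0 _ (by omega)]; exact (bj _ (by omega)).mpr (by omega)) hxα,
        c1, row0 _ (by omega), row2 _ (by omega), row2 _ (by omega), ca, hα α, if_pos rfl, hβ, hβ]
      have e1 : (α - 1 - c = β) = (c = α - 1 - β) := propext ⟨fun h => by linear_combination -h, fun h => by linear_combination -h⟩
      have e2 : (α - 1 - (c - 1) = β) = (c = α - 1 - β + 1) := propext ⟨fun h => by linear_combination -h, fun h => by linear_combination -h⟩
      simp only [e1, e2]
      congr 2
      split_ifs <;> push_cast <;> ring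
    by_cases hbm : β.val = m
    · have hb1 : β = -1 := zeq_m1 hbm
      have hJi : g 0 i v 0 = 0 := by
        rw [G0.skew, hα, if_neg]; intro h
        have : α = β := by rw [hb1, ← h]; ring
        rw [this] at hab; omega
      have hJj : g 0 j v 0 = y := by
        rw [G0.skew, hβ, if_pos]; rw [hb1]; ring
      rw [cm_C3 Go hi hj hJi hx0]
      simp only [hJj]
      have hgm : g m j i c = g β.val j i c := congrArg (fun t => g t j i c) hbm.symm
      rw [hgm, c2, s1, hα, hα]
      have e1 : (c = α) = (c = α - 1 - β) := by rw [hb1]; congr 1; ring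
      have e2 : (c - 1 = α) = (c = α - 1 - β + 1) := by
        rw [hb1]; exact propext ⟨fun h => by linear_combination h, fun h => by linear_combination h⟩
      simp only [e1, e2]
      congr 2
      split_ifs <;> push_cast <;> ring
    · have hb1 : β ≠ -1 := by
        intro h; apply hbm; have := zval_m1 (m := m); rw [← h] at this; omega
      have ha1 : α ≠ -1 := by
        intro h; have := zval_m1 (m := m); rw [← h] at this; omega
      have hJi : g 0 i v 0 = 0 := by
        rw [G0.skew, hα, if_neg]; intro h; apply ha1; rw [← h]; ring
      have hJj : g 0 j v 0 = 0 := by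
        rw [G0.skew, hβ, if_neg]; intro h; apply hb1; rw [← h]; ring
      rw [cm_C1 Go hi hj hJi hJj]
      have c3 : ∀ c, g m j i c = g (β.val + 1) j i c := const j i (β.val + 1) m (by omega) (by omega) (fun u h1 h2 =>
        stepEq j i hj hi u (by omega) (by rw [ai u (by omega), bj u (by omega)]; omega))
      rw [c3]
      obtain ⟨a1, x1, hx1⟩ := (G β.val (by omega)).mono j i
      have hx1' : Szm (g β.val i j) (-1 - a1) x1 := fun c => by
        rw [(G β.val (by omega)).skew, hx1]
        congr 1
        exact propext ⟨fun h => by linear_combination -h, fun h => by linear_combination -h⟩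
      have s2 : ∀ c, g (β.val + 1) j i c = (2 * (g β.val j i c : ℤ) - x1 - ((if c = α - 1 - β then (x * y : ℤ) else 0) - (if c = α - 1 - β + 1 then (x * y : ℤ) else 0))).toNat := by
        intro c
        rw [(G (β.val + 1) (by omega)).skew, hg β.val (by omega), cm_C3 (G β.val (by omega)) hi hj (by rw [row0 _ (by omega)]; exact (ai _ (by omega)).mpr (by omega)) hx1',
          ← (G β.val (by omega)).skew j i, row0 _ (by omega), row2 _ (by omega), row2 _ (by omega), cb, hβ β, if_pos rfl, hα, hα]
        have e1 : (β - 1 - (-1 - c) = α) = (c = α - 1 - β + 1) := propext ⟨fun h => by linear_combination h, fun h => by linear_combination h⟩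
        have e2 : (β - 1 - (-1 - c - 1) = α) = (c = α - 1 - β) := propext ⟨fun h => by linear_combination h, fun h => by linear_combination h⟩
        simp only [e1, e2]
        congr 1
        split_ifs <;> push_cast <;> ring
      have key := two_pt (f := g 0 j i) (f' := g β.val j i) (f'' := g (β.val + 1) j i) (b := α - 1 - β) (K := (x * y : ℤ)) (b1 _) hx0 hx1
        (fun hx0n => by
          have hn := N α.val (by omega) j i a0 (α - 1 - β) hj (by rw [row0 _ (by omega), ca, hα, if_pos rfl]; exact hx)
            (by rw [row0 _ (by omega)]; exact (bj _ (by omega)).mpr (by omega))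
            (by rw [row2 _ (by omega), ca, hβ, if_pos (by ring)]; exact hy)
            (by rw [c1, hx0, if_pos rfl]; exact hx0n)
          exact hn) (fun c => by rw [c2, s1]) s2
      rw [key]
  funext i j c
  by_cases hi : i = v
  · subst hi
    rw [cm_left]
    rw [row2 m le_rfl, G0.skew, zm_neg]; congr 1; ring
  by_cases hj : j = v
  · subst hj
    rw [cm_right hi]
    rw [row m le_rfl, zm_neg]; congr 1; ring
  obtain ⟨α, x, hα⟩ := G0.mono v i
  obtain ⟨β, y, hβ⟩ := G0.mono v j
  by_cases hx : x = 0
  · have z : ∀ c, g 0 v i c = 0 := fun c => by rw [hα, hx]; simp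
    rw [cm_Z Go hi hj (fun c => by change g 0 _ v c = 0; rw [G0.skew, z])]
    symm
    refine const j i 0 m (by omega) le_rfl (fun u _ hu c => ?_) c
    rw [hg u hu]
    exact cm_Z2 (G u hu.le) hj hi (fun c => by rw [row u hu.le, z]) c
  by_cases hy : y = 0
  · have z : ∀ c, g 0 v j c = 0 := fun c => by rw [hβ, hy]; simp
    rw [cm_Z2 Go hi hj (fun c => by change g 0 _ v c = 0; rw [G0.skew, z])]
    symm
    refine const j i 0 m (by omega) le_rfl (fun u _ hu c => ?_) c
    rw [hg u hu]
    exact cm_Z (G u hu.le) hj hi (fun c => by rw [row u hu.le, z]) c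
  rcases lt_trichotomy α.val β.val with h | h | h
  · exact main i j hi hj α β x y hα hβ hx hy h c
  · have h := ZMod.val_injective _ h
    subst h
    have hiff : ∀ c, g 0 v i c = 0 ↔ g 0 v j c = 0 := fun c => by
      rw [hα, hβ]; split_ifs <;> simp [hx, hy]
    have e : g m j i c = g 0 j i c := const j i 0 m (by omega) le_rfl (fun u _ hu c =>
      stepEq j i hj hi u hu (hiff _).symm c) c
    rw [e]
    by_cases h1 : g 0 v i (-1) = 0
    · exact cm_C1 Go hi hj (by change g 0 _ v 0 = 0; rw [G0.skew]; simpa using h1) (by change g 0 _ v 0 = 0; rw [G0.skew]; simpa using (hiff _).mp h1) c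
    · exact cm_C2 Go hi hj (by change g 0 _ v 0 ≠ 0; rw [G0.skew]; simpa using h1) (by change g 0 _ v 0 ≠ 0; rw [G0.skew]; simpa using fun h2 => h1 ((hiff _).mpr h2)) c
  · rw [cm_skew Go.skew (Go.loop v), main j i hj hi β α y x hβ hα hy hx h, ← Gm.skew]

def IsSt (m : ℕ) (Q : V → V → ℕ) (q : V → V → ZMod (m + 1) → ℕ) : Prop :=
  ∃ (X : V → Stk Q) (r : V → ℕ), SState m X r ∧ q = qof m X

theorem IsSt.dual {Q : V → V → ℕ} {q : V → V → ZMod (m + 1) → ℕ} (h : IsSt m Q q) :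
    IsSt m (qop Q) (fun i j c => q j i c) := by
  obtain ⟨X, r, S, rfl⟩ := h
  exact ⟨_, _, S.dual, by funext i j c; rw [qof_dual]⟩

theorem IsSt.undual {Q : V → V → ℕ} {q : V → V → ZMod (m + 1) → ℕ} (h : IsSt m (qop Q) q) :
    IsSt m Q (fun i j c => q j i c) := h.dual

theorem IsSt.step (hm : 1 ≤ m) {Q : V → V → ℕ} {q : V → V → ZMod (m + 1) → ℕ} (h : IsSt m Q q) (v : V) :
    IsSt m Q (colMut m q v) := by
  obtain ⟨X, r, S, rfl⟩ := h
  by_cases hv : 1 ≤ (X v).2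
  · obtain ⟨X', L⟩ := S.exists_low v
    obtain ⟨r', S'⟩ := S.lower L hv
    exact ⟨X', r', S', (lower_match S S' L hv).1⟩
  have hv0 : (X v).2 = 0 := by have := S.deg0 v; omega
  let g : ℕ → V → V → ZMod (m + 1) → ℕ := fun t => (fun q => colMut m q v)^[t] (qof m (fun i => sdual m (X i)))
  have hgs : ∀ t, g (t + 1) = colMut m (g t) v := fun t => Function.iterate_succ_apply' _ _ _
  have key : ∀ t ≤ m, ∃ (Y : V → Stk (qop Q)) (r : V → ℕ), SState m Y r ∧ (Y v).2 = m - t ∧ g t = qof m Y := by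
    intro t
    induction t with
    | zero =>
      intro _
      refine ⟨_, _, S.dual, ?_, rfl⟩
      simp [sdual, hv0]
    | succ t ih =>
      intro ht
      obtain ⟨Y, s, T, hY, hgt⟩ := ih (by omega)
      obtain ⟨Y', L⟩ := T.exists_low v
      have h1 : 1 ≤ (Y v).2 := by omega
      obtain ⟨s', T'⟩ := T.lower L h1
      refine ⟨Y', s', T', ?_, ?_⟩
      · rw [L.atv]; simp only [sh]; push_cast; omega
      · rw [hgs, hgt]; exact (lower_match T T' L h1).1
  have hw := wrap hm v g (fun t _ => hgs t) (fun t ht => by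
      obtain ⟨Y, s, T, _, h⟩ := key t ht
      rw [h]; exact good_qof T) (fun t ht => by
      obtain ⟨Y, s, T, hY, h⟩ := key t ht.le
      have h1 : 1 ≤ (Y v).2 := by omega
      obtain ⟨Y', L⟩ := T.exists_low v
      obtain ⟨s', T'⟩ := T.lower L h1
      rw [h]; exact (lower_match T T' L h1).2)
  have h0 : (fun i j c => g 0 j i c) = qof m X := by
    funext i j c; exact qof_dual m X j i c
  rw [h0] at hw
  rw [hw]
  obtain ⟨Y, s, T, _, h⟩ := key m le_rfl
  exact IsSt.undual ⟨Y, s, T, h⟩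
end W

section Init
variable {V : Type*} [Fintype V] [DecidableEq V]

def simp0 (Q : V → V → ℕ) (i : V) : QRep Q where
  obj j := Fin (if j = i then 1 else 0) → ℚ
  map _ _ _ := 0

theorem simp0_dim (Q : V → V → ℕ) (i : V) : qdim (simp0 Q i) = Pi.single i 1 := by
  funext j
  simp only [qdim]
  change ((Module.finrank ℚ (Fin (if j = i then 1 else 0) → ℚ) : ℕ) : ℤ) = _
  rw [Module.finrank_pi, Fintype.card_fin, Pi.single_apply]; split_ifs <;> rfl

theorem simp0_hom (Q : V → V → ℕ) (i j : V) : qhom (simp0 Q i) (simp0 Q j) = if i = j then 1 else 0 := by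
  have h : LinearMap.ker (qd (simp0 Q i) (simp0 Q j)) = ⊤ := by
    rw [eq_top_iff]; intro f _
    rw [LinearMap.mem_ker, qd_eq_zero]
    intro a b c x
    have : ∀ k a b c x, (simp0 Q k).map a b c x = 0 := fun k a b c x => rfl
    rw [this, this, map_zero]
  rw [qhom, h, finrank_top, Module.finrank_pi_fintype]
  have : ∀ k, Module.finrank ℚ ((simp0 Q i).obj k →ₗ[ℚ] (simp0 Q j).obj k) = if k = i then (if i = j then 1 else 0) else 0 := by
    intro k
    rw [Module.finrank_linearMap]
    change Module.finrank ℚ (Fin (if k = i then 1 else 0) → ℚ) * Module.finrank ℚ (Fin (if k = j then 1 else 0) → ℚ) = _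
    rw [Module.finrank_pi, Fintype.card_fin, Module.finrank_pi, Fintype.card_fin]
    by_cases h : k = i
    · subst h; simp
    · simp [h]
  simp [this]

theorem EF_single (Q : V → V → ℕ) (i j : V) : EF Q (Pi.single i 1) (Pi.single j 1) = (if i = j then 1 else 0) - Q i j := by
  simp only [EF, Pi.single_apply]
  congr 1
  · simp [Finset.sum_ite_eq, eq_comm]
  · simp [Finset.sum_ite_eq]

theorem simp0_ext (Q : V → V → ℕ) (i j : V) : qext (simp0 Q i) (simp0 Q j) = Q i j := by
  have := euler (simp0 Q i) (simp0 Q j)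
  rw [simp0_dim, simp0_dim, EF_single, simp0_hom] at this
  push_cast at this
  have h2 : (qext (simp0 Q i) (simp0 Q j) : ℤ) = Q i j := by linarith
  exact_mod_cast h2

theorem acyc_rank (Q : V → V → ℕ) (h : ∀ i : V, ¬ Relation.TransGen (fun a b => 0 < Q a b) i i) :
    ∃ r : V → ℕ, Function.Injective r ∧ ∀ i j, 0 < Q i j → r i < r j := by
  classical
  let r0 : V → ℕ := fun i => (Finset.univ.filter (fun k => Relation.TransGen (fun a b => 0 < Q a b) k i)).card
  have h0 : ∀ i j, 0 < Q i j → r0 i < r0 j := by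
    intro i j hij
    apply Finset.card_lt_card
    rw [Finset.ssubset_iff_of_subset]
    · exact ⟨i, by simp; exact Relation.TransGen.single hij, by simp; exact h i⟩
    · intro k; simp; intro hk; exact hk.tail hij
  let e := Fintype.equivFin V
  refine ⟨fun i => r0 i * Fintype.card V + e i, fun i j hij => ?_, fun i j hij => ?_⟩
  · have h1 := (e i).2
    have h2 := (e j).2
    have h3 : ((r0 i * Fintype.card V + e i) % Fintype.card V) = ((r0 j * Fintype.card V + e j) % Fintype.card V) := by
      simp only at hij; rw [hij]
    rw [mul_comm, Nat.mul_add_mod, mul_comm (r0 j), Nat.mul_add_mod, Nat.mod_eq_of_lt h1, Nat.mod_eq_of_lt h2] at h3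
    exact e.injective (Fin.ext h3)
  · have h1 := (e i).2
    have h3 : (r0 i + 1) * Fintype.card V ≤ r0 j * Fintype.card V := Nat.mul_le_mul_right _ (h0 i j hij)
    change r0 i * Fintype.card V + (e i : ℕ) < r0 j * Fintype.card V + e j
    rw [add_mul] at h3
    omega

theorem isSt_init {m : ℕ} (hm : 1 ≤ m) (q₀ : V → V → ℕ)
    (hacyclic : ∀ i : V, ¬ Relation.TransGen (fun a b => 0 < q₀ a b) i i)
    (q : V → V → ZMod (m + 1) → ℕ)
    (hq0 : ∀ i j, q i j 0 = q₀ i j)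
    (hqm : ∀ i j, q i j (m : ZMod (m + 1)) = q₀ j i)
    (hqother : ∀ i j (c : ZMod (m + 1)), c ≠ 0 → c ≠ (m : ZMod (m + 1)) → q i j c = 0) :
    IsSt m q₀ q := by
  obtain ⟨r, hr, hlt⟩ := acyc_rank q₀ hacyclic
  have hii : ∀ i, q₀ i i = 0 := fun i => by
    by_contra h; exact hacyclic i (Relation.TransGen.single (Nat.pos_of_ne_zero h))
  let X : V → Stk q₀ := fun i => (simp0 q₀ i, 0)
  have hH : ∀ i j p, Hs (X i) (X j) p = if p = 0 then (if i = j then 1 else 0) else if p = 1 then q₀ i j else 0 := by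
    intro i j p
    simp only [Hs, X, simp0_hom, simp0_ext, sub_self, zero_add]
  refine ⟨X, r, ⟨fun i => le_rfl, fun i => by simp [X], hr, fun i => ⟨?_, ?_⟩, ?_, ?_⟩, ?_⟩
  · simp only [X, simp0_hom, if_true]
  · simp only [X, simp0_ext, hii]
  · intro i j h p
    rw [hH, if_neg (show ¬ j = i by rintro rfl; exact lt_irrefl _ h)]
    have : q₀ j i = 0 := by by_contra h2; have := hlt j i (Nat.pos_of_ne_zero h2); omega
    simp [this]
  · intro i j h p hp
    rw [hH, if_neg h, if_neg (show ¬ p = 1 by omega)]; simp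
  · funext i j c
    have hm1 : (m : ZMod (m + 1)).val = m := ZMod.val_natCast_of_lt (by omega)
    have hcv : c.val < m + 1 := ZMod.val_lt c
    have q0' : c = 0 ↔ c.val = 0 := by rw [ZMod.val_eq_zero]
    have qm' : c = (m : ZMod (m + 1)) ↔ c.val = m := by
      constructor
      · intro h; rw [h, hm1]
      · intro h; apply ZMod.val_injective; rw [h, hm1]
    have hq : q i j c = if c.val = 0 then q₀ i j else if c.val = m then q₀ j i else 0 := by
      split_ifs with h1 h2
      · rw [q0'.mpr h1, hq0]
      · rw [qm'.mpr h2, hqm]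
      · exact hqother i j c (fun h => h1 (q0'.mp h)) (fun h => h2 (qm'.mp h))
    rw [hq]
    by_cases hij : i = j
    · subst hij; simp [qof, hii]
    rw [qof_ne hij, hH, hH, if_neg hij, if_neg (Ne.symm hij)]
    split_ifs <;> first | rfl | omega

theorem st_reach {m : ℕ} (hm : 1 ≤ m) {Q : V → V → ℕ} {q q' : V → V → ZMod (m + 1) → ℕ} (h : IsSt m Q q)
    (hr : Relation.ReflTransGen (fun a b => ∃ v, b = colMut m a v) q q') : IsSt m Q q' := by
  induction hr with
  | refl => exact h
  | tail _ h2 ih => obtain ⟨v, rfl⟩ := h2; exact ih.step hm v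

theorem fin_of_bdd {m : ℕ} (N : ℕ) (s : Set (V → V → ZMod (m + 1) → ℕ)) (h : ∀ q ∈ s, ∀ i j c, q i j c ≤ N) : s.Finite := by
  refine (Set.finite_Icc (0 : V → V → ZMod (m + 1) → ℕ) (fun _ _ _ => N)).subset fun q hq => ?_
  exact ⟨fun i j c => Nat.zero_le _, fun i j c => h q hq i j c⟩

theorem IsSt.bdd {m : ℕ} {Q : V → V → ℕ} {q : V → V → ZMod (m + 1) → ℕ} (h : IsSt m Q q)
    (P : ∀ x, 0 ≤ EF Q x x) (i j c) : q i j c ≤ 4 := by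
  obtain ⟨X, r, S, rfl⟩ := h
  have hb : ∀ i j, i ≠ j → ∀ p, Hs (X i) (X j) p ≤ 2 := by
    intro i j hij p
    rcases lt_or_gt_of_ne (S.rinj.ne hij) with h | h
    · obtain ⟨a, x, h1, e1⟩ := Hs_single _ _ (S.conc hij)
      have e2 := EF_all_zero _ _ (S.ord i j h)
      have e3 := EF_exc _ (S.exc i)
      have e4 := EF_exc _ (S.exc j)
      have p1 := P (cls (X i) + cls (X j))
      have p2 := P (cls (X i) + (-1 : ℤ) • cls (X j))
      simp only [EF_add_left, EF_add_right, EF_smul_left, EF_smul_right, e1, e2, e3, e4] at p1 p2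
      have hx : x ≤ 2 := by
        rcases Int.units_eq_one_or a.negOnePow with h | h <;> rw [h] at p1 p2 <;> simp at p1 p2 <;> omega
      rw [h1]; split_ifs <;> omega
    · rw [S.ord j i h]; omega
  by_cases hij : i = j
  · simp [qof, hij]
  · rw [qof_ne hij]
    have := hb i j hij ((c.val : ℤ) + 1)
    have := hb j i (Ne.symm hij) ((m : ℤ) + 1 - c.val)
    omega

theorem EF_quad (Q : V → V → ℕ) (hii : ∀ i, Q i i = 0) (x : V → ℤ) :
    ∑ i, ∑ j, x i * ((if i = j then (2 : ℤ) else -((Q i j : ℤ) + Q j i)) * x j) = 2 * EF Q x x := by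
  have h1 : ∀ i j, x i * ((if i = j then (2 : ℤ) else -((Q i j : ℤ) + Q j i)) * x j) =
      (if i = j then 2 * (x i * x j) else 0) - ((Q i j : ℤ) * (x i * x j)) - ((Q j i : ℤ) * (x j * x i)) := by
    intro i j
    split_ifs with h
    · subst h; simp [hii]; ring
    · ring
  simp only [h1, Finset.sum_sub_distrib]
  have h2 : ∑ i, ∑ j, ((Q j i : ℤ) * (x j * x i)) = ∑ i, ∑ j, ((Q i j : ℤ) * (x i * x j)) := Finset.sum_comm
  rw [h2]
  simp only [EF, Finset.sum_ite_eq, Finset.mem_univ, if_true, ← Finset.mul_sum]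
  ring

theorem backward (m : ℕ) (hm : 1 ≤ m)
    (q₀ : V → V → ℕ)
    (hacyclic : ∀ i : V, ¬ Relation.TransGen (fun a b => 0 < q₀ a b) i i)
    (q : V → V → ZMod (m + 1) → ℕ)
    (hq0 : ∀ i j, q i j 0 = q₀ i j)
    (hqm : ∀ i j, q i j (m : ZMod (m + 1)) = q₀ j i)
    (hqother : ∀ i j (c : ZMod (m + 1)), c ≠ 0 → c ≠ (m : ZMod (m + 1)) → q i j c = 0)
    (h : Fintype.card V ≤ 2 ∨
        (Matrix.of (fun i j : V =>
          if i = j then (2 : ℤ) else -((q₀ i j : ℤ) + (q₀ j i : ℤ)))).PosSemidef) :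
    {q' : V → V → ZMod (m + 1) → ℕ |
        Relation.ReflTransGen (fun a b => ∃ v, b = colMut m a v) q q'}.Finite := by
  have I := isSt_init hm q₀ hacyclic q hq0 hqm hqother
  have hii : ∀ i, q₀ i i = 0 := fun i => by
    by_contra h; exact hacyclic i (Relation.TransGen.single (Nat.pos_of_ne_zero h))
  rcases h with h | h
  · let N := ∑ i, ∑ j, ∑ c, q i j c
    refine fin_of_bdd N _ fun q' hq' => ?_
    simp only [Set.mem_setOf_eq] at hq'
    induction hq' with
    | refl =>
      intro i j c
      calc q i j c ≤ ∑ c, q i j c := Finset.single_le_sum (f := fun c => q i j c) (fun _ _ => Nat.zero_le _) (Finset.mem_univ c)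
        _ ≤ ∑ j, ∑ c, q i j c := Finset.single_le_sum (f := fun j => ∑ c, q i j c) (fun _ _ => Nat.zero_le _) (Finset.mem_univ j)
        _ ≤ N := Finset.single_le_sum (f := fun i => ∑ j, ∑ c, q i j c) (fun _ _ => Nat.zero_le _) (Finset.mem_univ i)
    | @tail b c' h1 h2 ih =>
      intro i j c
      obtain ⟨v, rfl⟩ := h2
      have I2 := (st_reach hm I h1).step hm v
      by_cases hi : i = v
      · subst hi; rw [cm_left]; exact ih _ _ _
      by_cases hj : j = v
      · subst hj; rw [cm_right hi]; exact ih _ _ _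
      have hij : i = j := by
        by_contra hij
        have : ({i, j, v} : Finset V).card = 3 := Finset.card_eq_three.mpr ⟨i, j, v, hij, hi, hj, rfl⟩
        have := Finset.card_le_univ ({i, j, v} : Finset V)
        omega
      subst hij
      obtain ⟨X, r, S, hX⟩ := I2
      rw [hX]; simp [qof]
  · refine fin_of_bdd 4 _ fun q' hq' => ?_
    apply (st_reach hm I hq').bdd
    intro x
    have h1 := h.dotProduct_mulVec_nonneg x
    have h2 := EF_quad q₀ hii x
    simp only [Matrix.mulVec, dotProduct, Matrix.of_apply, star_trivial, Finset.mul_sum] at h1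
    rw [h2] at h1
    linarith
end Init

section Grow
variable {V : Type*} [Fintype V] [DecidableEq V] {m : ℕ}

def AF (q : V → V → ZMod (m + 1) → ℕ) (A : V → V → ℕ) (T : Finset V) (h : V → ℕ) : Prop :=
  ∀ i ∈ T, ∀ j ∈ T, ∀ c, q i j c = if (c = 0 ∧ h i < h j) ∨ (c = -1 ∧ h j < h i) then A i j else 0

structure HStep (T : Finset V) (v : V) (h h' : V → ℕ) : Prop where
  mn : ∀ x ∈ T, x ≠ v → h v < h x
  mx : ∀ x ∈ T, x ≠ v → h' x < h' v
  eq : ∀ x ∈ T, ∀ y ∈ T, x ≠ v → y ≠ v → (h' x < h' y ↔ h x < h y)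

theorem zm01 (hm : 1 ≤ m) : (0 : ZMod (m + 1)) ≠ -1 := by
  intro h
  have : Fact (1 < m + 1) := ⟨by omega⟩
  exact one_ne_zero (α := ZMod (m + 1)) (by linear_combination h)

theorem zm10 (hm : 1 ≤ m) : (1 : ZMod (m + 1)) ≠ 0 := by
  have : Fact (1 < m + 1) := ⟨by omega⟩
  exact one_ne_zero (α := ZMod (m + 1))

theorem cm_same {q : V → V → ZMod (m + 1) → ℕ} {v : V} (G : Good q) {i j : V} (hi : i ≠ v) (hj : j ≠ v)
    (h1 : ∀ c, c ≠ 0 → q v i c = 0) (h2 : ∀ c, c ≠ 0 → q v j c = 0) (c) : colMut m q v i j c = q i j c := by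
  by_cases h3 : q v i 0 = 0
  · exact cm_Z G hi hj (fun c => by by_cases h : c = 0; · rw [h, h3]
                                    · exact h1 c h) c
  by_cases h4 : q v j 0 = 0
  · exact cm_Z2 G hi hj (fun c => by by_cases h : c = 0; · rw [h, h4]
                                     · exact h2 c h) c
  · exact cm_C2 G hi hj h3 h4 c

theorem AF.step (hm : 1 ≤ m) {q : V → V → ZMod (m + 1) → ℕ} (G : Good q) {A : V → V → ℕ} {T : Finset V} {h h' : V → ℕ}
    (F : AF q A T h) {v : V} (hv : v ∈ T) (H : HStep T v h h') : AF (colMut m q v) A T h' := by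
  have z := zm01 hm
  have hvc : ∀ i ∈ T, i ≠ v → ∀ c, c ≠ 0 → q v i c = 0 := by
    intro i hi hiv c hc
    rw [F v hv i hi, if_neg]
    rintro (h1 | h1)
    · exact hc h1.1
    · have := H.mn i hi hiv; omega
  intro i hi j hj c
  by_cases hiv : i = v
  · subst hiv
    by_cases hjv : j = i
    · subst hjv
      rw [cm_left, G.loop, if_neg (by omega)]
    rw [cm_left, F i hi j hj]
    have h1 := H.mn j hj hjv
    have h2 := H.mx j hj hjv
    have e : (c + 1 = 0) ↔ (c = -1) := ⟨fun h => by linear_combination h, fun h => by linear_combination h⟩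
    congr 1
    rw [e]
    exact propext ⟨fun h => by rcases h with h | h; · exact Or.inr ⟨h.1, h2⟩
                               · omega,
      fun h => by rcases h with h | h; · omega
                  · exact Or.inl ⟨h.1, h1⟩⟩
  by_cases hjv : j = v
  · subst hjv
    rw [cm_right hiv, F i hi j hj]
    have h1 := H.mn i hi hiv
    have h2 := H.mx i hi hiv
    have e : (c - 1 = -1) ↔ (c = 0) := ⟨fun h => by linear_combination h, fun h => by linear_combination h⟩
    congr 1
    rw [e]
    exact propext ⟨fun h => by rcases h with h | h; · omega
                               · exact Or.inl ⟨h.1, h2⟩,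
      fun h => by rcases h with h | h; · exact Or.inr ⟨h.1, h1⟩
                  · omega⟩
  rw [cm_same G hiv hjv (hvc i hi hiv) (hvc j hj hjv), F i hi j hj]
  congr 1
  rw [H.eq i hi j hj hiv hjv, H.eq j hj i hi hjv hiv]

structure GS (q : V → V → ZMod (m + 1) → ℕ) (A : V → V → ℕ) (U : Finset V) (w : V) (h : V → ℕ) (y : V → ℤ) : Prop where
  af : AF q A U h
  ww : ∀ j ∈ U, ∀ c, q w j c = if c = 0 then (y j).toNat else if c = 1 then (-y j).toNat else 0

theorem GS.step (hm : 1 ≤ m) {q : V → V → ZMod (m + 1) → ℕ} (G : Good q) {A : V → V → ℕ} {U : Finset V} {w : V} {h h' : V → ℕ}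
    {y y' : V → ℤ} (S : GS q A U w h y) {v : V} (hw : w ∉ U) (hv : v ∈ U) (H : HStep U v h h') (hy : 0 ≤ y v)
    (hy1 : y' v = - y v) (hy2 : ∀ j ∈ U, j ≠ v → y' j = y j + A v j * y v) :
    GS (colMut m q v) A U w h' y' := by
  have z := zm01 hm
  have z1 := zm10 hm
  have hwv : w ≠ v := by rintro rfl; exact hw hv
  refine ⟨S.af.step hm G hv H, fun j hj c => ?_⟩
  by_cases hjv : j = v
  · subst hjv
    rw [cm_right hwv, S.ww j hj, hy1]
    have e1 : (c - 1 = 0) ↔ (c = 1) := ⟨fun h => by linear_combination h, fun h => by linear_combination h⟩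
    have t1 : (-y j).toNat = 0 := by omega
    simp only [e1, t1, neg_neg, ite_self]
    by_cases h1 : c = 1
    · subst h1; simp [z1]
    · simp [h1]
  · have hvw : q v w 0 = 0 := by
      rw [G.skew, S.ww v hv]
      have t1 : (-y v).toNat = 0 := by omega
      rw [if_neg (by intro h; exact z (by linear_combination -h)), t1]; simp
    have hs : Szm (q w j) (if 0 ≤ y j then 0 else 1) (y j).natAbs := by
      intro c
      rw [S.ww j hj]
      by_cases h0 : 0 ≤ y j
      · have t1 : (-y j).toNat = 0 := by omega
        have t2 : (y j).toNat = (y j).natAbs := by omega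
        simp [h0, t1, t2]
      · have t1 : (-y j).toNat = (y j).natAbs := by omega
        have t2 : (y j).toNat = 0 := by omega
        rw [if_neg h0, t1, t2]
        by_cases hc : c = 0
        · subst hc; rw [if_pos rfl, if_neg (Ne.symm z1)]
        · rw [if_neg hc]
    have hvj : q v j 0 = A v j := by
      rw [S.af v hv j hj, if_pos (Or.inl ⟨rfl, H.mn j hj hjv⟩)]
    rw [cm_C3 G hwv hjv hvw hs, S.ww j hj, S.ww v hv, S.ww v hv, hvj, hy2 j hj hjv]
    have e1 : (c - 1 = 0) ↔ (c = 1) := ⟨fun h => by linear_combination h, fun h => by linear_combination h⟩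
    have t1 : (-y v).toNat = 0 := by omega
    have t2 : ((y v).toNat : ℤ) = y v := by omega
    simp only [e1, t1, ite_self]
    by_cases h0 : c = 0
    · subst h0
      simp only [if_true, if_neg (Ne.symm z1)]
      rw [t2]
      have : (2 * ((y j).toNat : ℤ) - (y j).natAbs) = y j := by omega
      rw [this]; congr 1; push_cast; ring
    by_cases h1 : c = 1
    · subst h1
      simp only [if_true, if_neg z1]
      rw [t2]
      have : (2 * ((-y j).toNat : ℤ) - (y j).natAbs) = -y j := by omega
      rw [this]; congr 1; push_cast; ring
    · simp [h0, h1]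

/-- make w minimal -/
theorem flip_min (hm : 1 ≤ m) (R : (V → V → ZMod (m + 1) → ℕ) → Prop) (RG : ∀ q, R q → Good q)
    (Rs : ∀ q v, R q → R (colMut m q v)) {A : V → V → ℕ} {T : Finset V} {w : V} (hw : w ∈ T) (k : ℕ) :
    ∀ q h, R q → AF q A T h → Set.InjOn h T → (T.filter (fun u => h u < h w)).card = k →
      ∃ q h, R q ∧ AF q A T h ∧ Set.InjOn h T ∧ ∀ u ∈ T, u ≠ w → h w < h u := by
  induction k with
  | zero =>
    intro q h hR F hI hk
    refine ⟨q, h, hR, F, hI, fun u hu huw => ?_⟩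
    rw [Finset.card_eq_zero] at hk
    have h1 : ¬ h u < h w := fun h1 => by
      have : u ∈ T.filter (fun u => h u < h w) := by simp [hu, h1]
      rw [hk] at this; simp at this
    have h2 : h u ≠ h w := fun h2 => huw (hI hu hw h2)
    omega
  | succ k ih =>
    intro q h hR F hI hk
    obtain ⟨v, hv, hmin⟩ := Finset.exists_min_image T h ⟨w, hw⟩
    have hvw : h v < h w := by
      obtain ⟨u, hu⟩ := Finset.card_pos.mp (show 0 < (T.filter (fun u => h u < h w)).card by omega)
      simp only [Finset.mem_filter] at hu
      have := hmin u hu.1; omega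
    have hwv : w ≠ v := by rintro rfl; omega
    have hle : ∀ u, h u ≤ ∑ x, h x := fun u => Finset.single_le_sum (f := h) (fun _ _ => Nat.zero_le _) (Finset.mem_univ u)
    let h' := Function.update h v (∑ x, h x + 1)
    have hne : ∀ x, x ≠ v → h' x = h x := fun x hx => Function.update_of_ne hx _ _
    have hvv : h' v = ∑ x, h x + 1 := Function.update_self _ _ _
    have H : HStep T v h h' := by
      refine ⟨fun x hx hxv => ?_, fun x hx hxv => ?_, fun x hx y hy hxv hyv => ?_⟩
      · have h1 := hmin x hx
        have h2 : h v ≠ h x := fun h2 => hxv (hI hv hx h2).symm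
        omega
      · rw [hne x hxv, hvv]; have := hle x; omega
      · rw [hne x hxv, hne y hyv]
    refine ih (colMut m q v) h' (Rs q v hR) (F.step hm (RG q hR) hv H) ?_ ?_
    · intro x hx y hy hxy
      by_cases hxv : x = v
      · by_cases hyv : y = v
        · rw [hxv, hyv]
        · rw [hxv, hvv, hne y hyv] at hxy; have := hle y; omega
      · by_cases hyv : y = v
        · rw [hyv, hvv, hne x hxv] at hxy; have := hle x; omega
        · rw [hne x hxv, hne y hyv] at hxy; exact hI hx hy hxy
    · have : T.filter (fun u => h' u < h' w) = (T.filter (fun u => h u < h w)).erase v := by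
        ext u
        simp only [Finset.mem_filter, Finset.mem_erase, hne w hwv]
        by_cases huv : u = v
        · subst huv; simp [hvv]; intro _; have := hle w; omega
        · simp [hne u huv, huv]
      rw [this, Finset.card_erase_of_mem (by simp [hv, hvw]), hk]; rfl

end Grow

section Form
variable {V : Type*} [Fintype V] [DecidableEq V]

def QA (Q : V → V → ℕ) (i j : V) : ℕ := Q i j + Q j i
def bf (Q : V → V → ℕ) (x y : V → ℤ) : ℤ := EF Q x y + EF Q y x
abbrev ev (i : V) : V → ℤ := Pi.single i 1

theorem QA_comm (Q : V → V → ℕ) (i j : V) : QA Q i j = QA Q j i := by simp [QA, add_comm]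

variable {Q : V → V → ℕ}

theorem bf_comm (x y : V → ℤ) : bf Q x y = bf Q y x := by simp [bf, add_comm]
theorem bf_add_left (x x' y : V → ℤ) : bf Q (x + x') y = bf Q x y + bf Q x' y := by
  simp only [bf, EF_add_left, EF_add_right]; ring
theorem bf_add_right (x y y' : V → ℤ) : bf Q x (y + y') = bf Q x y + bf Q x y' := by
  simp only [bf, EF_add_left, EF_add_right]; ring
theorem bf_smul_left (c : ℤ) (x y : V → ℤ) : bf Q (c • x) y = c * bf Q x y := by
  simp only [bf, EF_smul_left, EF_smul_right]; ring
theorem bf_smul_right (c : ℤ) (x y : V → ℤ) : bf Q x (c • y) = c * bf Q x y := by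
  simp only [bf, EF_smul_left, EF_smul_right]; ring
theorem bf_self (x : V → ℤ) : bf Q x x = 2 * EF Q x x := by simp only [bf]; ring
theorem N_add (x y : V → ℤ) : EF Q (x + y) (x + y) = EF Q x x + EF Q y y + bf Q x y := by
  simp only [bf, EF_add_left, EF_add_right]; ring
theorem N_smul (c : ℤ) (x : V → ℤ) : EF Q (c • x) (c • x) = c * c * EF Q x x := by
  simp only [EF_smul_left, EF_smul_right]; ring
theorem bf_sub_right (x y y' : V → ℤ) : bf Q x (y - y') = bf Q x y - bf Q x y' := by
  have := bf_add_right (Q := Q) x (y - y') y'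
  rw [sub_add_cancel] at this; linarith
theorem bf_sub_left (x y y' : V → ℤ) : bf Q (y - y') x = bf Q y x - bf Q y' x := by
  rw [bf_comm, bf_sub_right, bf_comm x, bf_comm x]
theorem N_sub (x y : V → ℤ) : EF Q (x - y) (x - y) = EF Q x x + EF Q y y - bf Q x y := by
  have := N_add (Q := Q) (x - y) y
  rw [sub_add_cancel, bf_sub_left, bf_self] at this; linarith

theorem bf_eq (x y : V → ℤ) : bf Q x y = ∑ i, x i * (2 * y i - ∑ j, (QA Q i j : ℤ) * y j) := by
  have h2 : ∑ i, ∑ j, (Q i j : ℤ) * (y i * x j) = ∑ i, ∑ j, (Q j i : ℤ) * (y j * x i) := Finset.sum_comm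
  simp only [bf, EF, h2, mul_sub, Finset.sum_sub_distrib, QA, Finset.mul_sum]
  have h3 : ∀ i j, x i * (((Q i j + Q j i : ℕ) : ℤ) * y j) = (Q i j : ℤ) * (x i * y j) + (Q j i : ℤ) * (y j * x i) := by
    intro i j; push_cast; ring
  simp only [h3, Finset.sum_add_distrib]
  have h4 : ∑ i, x i * (2 * y i) = ∑ i, x i * y i + ∑ i, y i * x i := by
    rw [← Finset.sum_add_distrib]; exact Finset.sum_congr rfl fun i _ => by ring
  rw [h4]; ring

theorem bf_ev (i : V) (y : V → ℤ) : bf Q (ev i) y = 2 * y i - ∑ j, (QA Q i j : ℤ) * y j := by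
  rw [bf_eq, Finset.sum_eq_single i]
  · simp
  · intro b _ hb; simp [hb]
  · simp

theorem bf_exp (x y : V → ℤ) : bf Q x y = ∑ i, x i * bf Q (ev i) y := by
  simp only [bf_ev]; exact bf_eq x y

theorem bf_ev_ev {i j : V} (h : i ≠ j) : bf Q (ev i) (ev j) = -(QA Q i j : ℤ) := by
  rw [bf_ev, Finset.sum_eq_single j]
  · simp [h]
  · intro b _ hb; simp [hb]
  · simp

theorem N_ev (hii : ∀ i, Q i i = 0) (i : V) : EF Q (ev i) (ev i) = 1 := by
  rw [EF_single, hii]; simp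

theorem ev_nonneg (i : V) : (0 : V → ℤ) ≤ ev i := by
  intro j; simp only [ev, Pi.single_apply, Pi.zero_apply]; split_ifs <;> omega

theorem bf_disj (p n : V → ℤ) (hp : 0 ≤ p) (hn : 0 ≤ n) (h : ∀ i, p i * n i = 0) : bf Q p n ≤ 0 := by
  rw [bf_eq]
  apply Finset.sum_nonpos
  intro i _
  have h1 : 0 ≤ ∑ j, (QA Q i j : ℤ) * n j := Finset.sum_nonneg fun j _ => mul_nonneg (by positivity) (hn j)
  have h2 := mul_nonneg (hp i) h1
  have h3 := h i
  simp only [Pi.zero_apply] at h2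
  nlinarith

def sup (U : Finset V) (x : V → ℤ) : Prop := ∀ i, i ∉ U → x i = 0

structure MU (Q : V → V → ℕ) (U : Finset V) : Prop where
  ex : ∃ x, x ≠ 0 ∧ sup U x ∧ EF Q x x ≤ 0
  min : ∀ x, x ≠ 0 → sup U x → (∃ k ∈ U, x k = 0) → 0 < EF Q x x

theorem MU_exists (U : Finset V) : (∃ x, x ≠ 0 ∧ sup U x ∧ EF Q x x ≤ 0) → ∃ U', MU Q U' := by
  induction U using Finset.strongInduction with
  | H U ih =>
    intro h
    by_cases h2 : ∃ x, x ≠ 0 ∧ sup U x ∧ (∃ k ∈ U, x k = 0) ∧ EF Q x x ≤ 0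
    · obtain ⟨x, h3, h4, ⟨k, hk, h5⟩, h6⟩ := h2
      refine ih (U.erase k) (Finset.erase_ssubset hk) ⟨x, h3, fun i hi => ?_, h6⟩
      by_cases e : i = k
      · rw [e, h5]
      · exact h4 i fun h => hi (Finset.mem_erase.mpr ⟨e, h⟩)
    · push Not at h2
      exact ⟨U, h, h2⟩

theorem ex_min {α : Type*} (P : α → Prop) (f : α → ℕ) (h : ∃ x, P x) : ∃ x, P x ∧ ∀ y, P y → f x ≤ f y := by
  classical
  have h1 : ∃ n, ∃ x, P x ∧ f x = n := by obtain ⟨x, hx⟩ := h; exact ⟨_, x, hx, rfl⟩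
  obtain ⟨x, hx, e⟩ := Nat.find_spec h1
  exact ⟨x, hx, fun y hy => by rw [e]; exact Nat.find_min' h1 ⟨y, hy, rfl⟩⟩

theorem N_abs (x : V → ℤ) : EF Q (fun i => |x i|) (fun i => |x i|) ≤ EF Q x x := by
  simp only [EF]
  have h1 : ∑ i, |x i| * |x i| = ∑ i, x i * x i := Finset.sum_congr rfl fun i _ => abs_mul_abs_self _
  have h2 : ∑ i, ∑ j, (Q i j : ℤ) * (x i * x j) ≤ ∑ i, ∑ j, (Q i j : ℤ) * (|x i| * |x j|) := by
    refine Finset.sum_le_sum fun i _ => Finset.sum_le_sum fun j _ => mul_le_mul_of_nonneg_left ?_ (by positivity)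
    rw [← abs_mul]; exact le_abs_self _
  linarith

theorem lemO (hii : ∀ i, Q i i = 0) {U : Finset V} (M : MU Q U) (h3 : 3 ≤ U.card) :
    ∃ z : V → ℤ, sup U z ∧ (∀ i ∈ U, 0 < z i) ∧ ∀ k ∈ U, bf Q (ev k) z = 0 := by
  classical
  have third : ∀ i j : V, ∃ k ∈ U, k ≠ i ∧ k ≠ j := by
    intro i j
    by_contra hc
    push Not at hc
    have : U ⊆ {i, j} := by
      intro k hk; simp only [Finset.mem_insert, Finset.mem_singleton]
      by_cases e : k = i
      · exact Or.inl e
      · exact Or.inr (hc k hk e)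
    have := Finset.card_le_card this
    have := Finset.card_le_two (a := i) (b := j)
    omega
  let s : (V → ℤ) → ℤ := fun x => ∑ i, x i
  have s_add : ∀ x y, s (x + y) = s x + s y := fun x y => Finset.sum_add_distrib
  have s_ev : ∀ i, s (ev i) = 1 := fun i => by simp [s]
  have s0 : s 0 = 0 := by simp [s]
  have s_nn : ∀ x, 0 ≤ x → 0 ≤ s x := fun x hx => Finset.sum_nonneg fun i _ => hx i
  have s_le : ∀ x y, x ≤ y → s x ≤ s y := fun x y h => Finset.sum_le_sum fun i _ => h i
  obtain ⟨z, ⟨z0, zne, zs, zN⟩, zmin⟩ := ex_min (fun z : V → ℤ => 0 ≤ z ∧ z ≠ 0 ∧ sup U z ∧ EF Q z z ≤ 0) (fun z => (s z).toNat) (by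
    obtain ⟨x, h1, h2, h4⟩ := M.ex
    refine ⟨fun i => |x i|, fun i => abs_nonneg _, fun h => h1 ?_, fun i hi => by simp [h2 i hi], (N_abs x).trans h4⟩
    funext i; have := congrFun h i; simpa using this)
  have small : ∀ x, 0 ≤ x → x ≠ 0 → sup U x → s x < s z → 1 ≤ EF Q x x := by
    intro x h1 h2 h4 h5
    by_contra hc
    have : (s z).toNat ≤ (s x).toNat := zmin x ⟨h1, h2, h4, by omega⟩
    have := s_nn x h1
    omega
  have zpos : ∀ i ∈ U, 0 < z i := by
    intro i hi
    by_contra hc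
    have h1 : 0 ≤ z i := z0 i
    have := M.min z zne zs ⟨i, hi, by omega⟩
    omega
  have zU : ∀ i, 0 < z i → i ∈ U := fun i h => by by_contra hc; rw [zs i hc] at h; omega
  have evne : ∀ i, ev i ≠ (0 : V → ℤ) := fun i h => by have := congrFun h i; simp at this
  have key : ∀ k ∈ U, bf Q (ev k) z ≤ EF Q z z := by
    intro k hk
    have h1 : 1 ≤ EF Q (z - ev k) (z - ev k) := by
      apply small
      · intro i; simp only [Pi.zero_apply, Pi.sub_apply, ev, Pi.single_apply]
        have : 0 ≤ z i := z0 i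
        split_ifs with e
        · subst e; have := zpos i hk; omega
        · omega
      · intro h; rw [sub_eq_zero] at h; rw [h, N_ev hii] at zN; omega
      · intro i hi
        have : i ≠ k := fun e => hi (e ▸ hk)
        simp [zs i hi, this]
      · have := s_add (z - ev k) (ev k); rw [sub_add_cancel, s_ev] at this; omega
    rw [N_sub, N_ev hii, bf_comm] at h1
    linarith
  obtain ⟨x, ⟨x0, xz, xN, hx⟩, xmax⟩ := ex_min (fun x : V → ℤ => 0 ≤ x ∧ x ≤ z ∧ EF Q x x = 1 ∧ ∃ j, x = ev j ∨ ∃ y, 0 ≤ y ∧ EF Q y y = 1 ∧ x = y + ev j)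
    (fun x => (s z - s x).toNat) (by
      obtain ⟨k, hk, -⟩ := third (Classical.choice ⟨(Finset.card_pos.mp (by omega : 0 < U.card)).choose⟩) (Finset.card_pos.mp (by omega : 0 < U.card)).choose
      refine ⟨ev k, ev_nonneg k, fun i => ?_, N_ev hii k, k, Or.inl rfl⟩
      simp only [ev, Pi.single_apply]
      have : 0 ≤ z i := z0 i
      split_ifs with e
      · subst e; have := zpos i hk; omega
      · omega)
  have xU : ∀ i, i ∉ U → x i = 0 := fun i hi => le_antisymm ((xz i).trans (zs i hi).le) (x0 i)
  have h1 : bf Q (z - x) x ≤ -2 := by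
    rw [bf_sub_left, bf_self, xN, bf_comm, bf_exp]
    have : ∑ i, x i * bf Q (ev i) z ≤ 0 := by
      apply Finset.sum_nonpos; intro i _
      by_cases hi : i ∈ U
      · have := key i hi
        exact mul_nonpos_of_nonneg_of_nonpos (x0 i) (by linarith)
      · rw [xU i hi, zero_mul]
    linarith
  obtain ⟨i, hi1, hi2⟩ : ∃ i, 0 < (z - x) i ∧ bf Q (ev i) x < 0 := by
    by_contra hc
    push Not at hc
    have : 0 ≤ bf Q (z - x) x := by
      rw [bf_exp]
      apply Finset.sum_nonneg; intro i _
      have h0 : 0 ≤ (z - x) i := by have := xz i; simp only [Pi.sub_apply]; linarith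
      rcases h0.eq_or_lt with e | e
      · rw [← e, zero_mul]
      · exact mul_nonneg h0 (hc i e)
    linarith
  have hN : EF Q (x + ev i) (x + ev i) = 2 + bf Q (ev i) x := by rw [N_add, xN, N_ev hii, bf_comm]; ring
  have hle : x + ev i ≤ z := by
    intro j; simp only [Pi.add_apply, ev, Pi.single_apply, Pi.sub_apply] at hi1 ⊢
    have : x j ≤ z j := xz j
    split_ifs with e
    · subst e; omega
    · omega
  have hnn : 0 ≤ x + ev i := add_nonneg x0 (ev_nonneg i)
  have hss := s_le _ _ hle
  rw [s_add, s_ev] at hss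
  have hsx := s_nn x x0
  have hb : bf Q (ev i) x ≤ -2 := by
    by_contra hc
    have hb1 : bf Q (ev i) x = -1 := by omega
    have := xmax (x + ev i) ⟨hnn, hle, by rw [hN, hb1]; norm_num, i, Or.inr ⟨x, x0, xN, rfl⟩⟩
    simp only [s_add, s_ev] at this
    omega
  have hz : x + ev i = z := by
    have := zmin (x + ev i) ⟨hnn, fun h => by have := s_add x (ev i); rw [h, s_ev, s0] at this; omega,
      fun j hj => by
        have := hle j; have h5 := hnn j; rw [zs j hj] at this; exact le_antisymm this h5, by omega⟩
    have hs : s z = s (x + ev i) := by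
      simp only [s_add, s_ev] at this ⊢; omega
    have := (Finset.sum_eq_sum_iff_of_le (s := Finset.univ) (f := x + ev i) (g := z) (fun j _ => hle j)).mp hs.symm
    funext j; exact this j (Finset.mem_univ j)
  have hiz : i ∈ U := by
    apply zU; rw [← hz]; simp; have : 0 ≤ x i := x0 i; omega
  obtain ⟨j, hj | ⟨y, y0, yN, hj⟩⟩ := hx
  · obtain ⟨k, hk, k1, k2⟩ := third i j
    have := zpos k hk
    rw [← hz, hj] at this; simp [k1, k2] at this
  have hjz : j ∈ U := by
    apply zU; rw [← hz, hj]; have a1 : 0 ≤ y j := y0 j; have a2 := ev_nonneg i j; simp at a2 ⊢; omega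
  have b1 : -1 ≤ bf Q (ev i) y := by
    have : 1 ≤ EF Q (y + ev i) (y + ev i) := by
      apply small
      · exact add_nonneg y0 (ev_nonneg i)
      · intro h; have := s_add y (ev i); rw [h, s_ev, s0] at this; have := s_nn y y0; omega
      · intro k hk
        have h5 := zs k hk
        rw [← hz, hj] at h5
        have a1 := ev_nonneg j k
        have a2 := ev_nonneg i k
        have a3 := y0 k
        simp only [Pi.add_apply, Pi.zero_apply] at *
        omega
      · rw [← hz, hj]; simp only [s_add, s_ev]; omega
    rw [N_add, yN, N_ev hii, bf_comm] at this; linarith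
  have b2 : -1 ≤ bf Q (ev i) (ev j) := by
    have : 0 < EF Q (ev i + ev j) (ev i + ev j) := by
      apply M.min
      · intro h; have := s_add (ev i) (ev j); rw [h, s_ev, s_ev] at this; simp [s] at this
      · intro k hk
        have k1 : k ≠ i := fun e => hk (e ▸ hiz)
        have k2 : k ≠ j := fun e => hk (e ▸ hjz)
        simp [k1, k2]
      · obtain ⟨k, hk, k1, k2⟩ := third i j
        exact ⟨k, hk, by simp [k1, k2]⟩
    rw [N_add, N_ev hii, N_ev hii] at this; linarith
  have hb3 : bf Q (ev i) x = bf Q (ev i) y + bf Q (ev i) (ev j) := by rw [hj, bf_add_right]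
  have zN0 : EF Q z z = 0 := by rw [← hz, hN]; omega
  refine ⟨z, zs, zpos, ?_⟩
  have hsum : ∑ k, z k * bf Q (ev k) z = 0 := by rw [← bf_exp, bf_self, zN0]; rfl
  have h5 := (Finset.sum_eq_zero_iff_of_nonpos (s := Finset.univ) (f := fun k => z k * bf Q (ev k) z) (by
    intro k _
    by_cases hk : k ∈ U
    · have := key k hk
      exact mul_nonpos_of_nonneg_of_nonpos (z0 k) (by linarith)
    · simp [zs k hk])).mp hsum
  intro k hk
  have := h5 k (Finset.mem_univ k)
  rcases mul_eq_zero.mp this with e | e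
  · have := zpos k hk; omega
  · exact e

theorem delta_N {U : Finset V} {z : V → ℤ} (zs : sup U z) (hz : ∀ k ∈ U, bf Q (ev k) z = 0) {x : V → ℤ} (hx : sup U x) : bf Q x z = 0 := by
  rw [bf_exp]; apply Finset.sum_eq_zero; intro i _
  by_cases hi : i ∈ U
  · rw [hz i hi, mul_zero]
  · rw [hx i hi, zero_mul]

/-- nonnegativity and the radical on `U` -/
theorem psd_U {U : Finset V} (M : MU Q U) {z : V → ℤ} (zs : sup U z) (zp : ∀ i ∈ U, 0 < z i) (hz : ∀ k ∈ U, bf Q (ev k) z = 0)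
    {x : V → ℤ} (hx : sup U x) {k : V} (hk : k ∈ U) : 0 ≤ EF Q x x ∧ (EF Q x x = 0 → z k • x = x k • z) := by
  have hzz := delta_N zs hz zs
  have hxz := delta_N zs hz hx
  rw [bf_self] at hzz
  have e : EF Q (z k • x - x k • z) (z k • x - x k • z) = z k * z k * EF Q x x := by
    rw [N_sub, N_smul, N_smul, bf_smul_left, bf_smul_right, hxz]
    have : EF Q z z = 0 := by omega
    rw [this]; ring
  have hs : sup U (z k • x - x k • z) := fun i hi => by simp [hx i hi, zs i hi]
  have zk := zp k hk
  by_cases h0 : z k • x - x k • z = 0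
  · refine ⟨?_, fun _ => sub_eq_zero.mp h0⟩
    rw [h0] at e
    have : EF Q (0 : V → ℤ) 0 = 0 := by simp [EF]
    rw [this] at e
    have hzk : z k * z k ≠ 0 := by positivity
    have := (mul_eq_zero.mp e.symm).resolve_left hzk
    omega
  · have hp := M.min _ h0 hs ⟨k, hk, by simp; ring⟩
    rw [e] at hp
    have h1 : 0 < z k * z k := by positivity
    have h2 : 0 < EF Q x x := by
      by_contra hc; push Not at hc
      nlinarith
    exact ⟨h2.le, fun h => by omega⟩

theorem MU.card (hii : ∀ i, Q i i = 0) {U : Finset V} (M : MU Q U) : 2 ≤ U.card := by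
  by_contra hc
  obtain ⟨x, x0, xs, xN⟩ := M.ex
  have : U.card = 0 ∨ U.card = 1 := by omega
  rcases this with h | h
  · rw [Finset.card_eq_zero] at h
    subst h
    exact x0 (funext fun i => xs i (by simp))
  · obtain ⟨a, rfl⟩ := Finset.card_eq_one.mp h
    have e : x = x a • ev a := by
      funext i
      by_cases hi : i = a
      · subst hi; simp
      · rw [xs i (by simp [hi])]; simp [hi]
    rw [e, N_smul, N_ev hii] at xN
    have : x a = 0 := by nlinarith
    rw [this, zero_smul] at e
    exact x0 e

theorem MU.two (hii : ∀ i, Q i i = 0) {a b : V} (hab : a ≠ b) (M : MU Q {a, b}) : 2 ≤ QA Q a b := by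
  obtain ⟨x, x0, xs, xN⟩ := M.ex
  have e : x = x a • ev a + x b • ev b := by
    funext i
    by_cases hi : i = a
    · subst hi; simp [hab]
    by_cases hj : i = b
    · subst hj; simp [hi]
    · rw [xs i (by simp [hi, hj])]; simp [hi, hj]
  have hne : ¬ (x a = 0 ∧ x b = 0) := by
    rintro ⟨h1, h2⟩; rw [h1, h2] at e; simp at e; exact x0 e
  rw [e, N_add, N_smul, N_smul, N_ev hii, N_ev hii, bf_smul_left, bf_smul_right, bf_ev_ev hab] at xN
  by_contra hc
  have h : QA Q a b = 0 ∨ QA Q a b = 1 := by omega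
  apply hne
  rcases h with h | h <;> rw [h] at xN <;> push_cast at xN
  · constructor <;> nlinarith
  · have := sq_nonneg (x a - x b)
    constructor <;> nlinarith
end Form

section Grow2
variable {V : Type*} [Fintype V] [DecidableEq V] {m : ℕ}

theorem grow_init (hm : 1 ≤ m) (R : (V → V → ZMod (m + 1) → ℕ) → Prop) (RG : ∀ q, R q → Good q)
    (Rs : ∀ q v, R q → R (colMut m q v)) {A : V → V → ℕ} {U : Finset V} {w : V} (hw : w ∉ U)
    (q : V → V → ZMod (m + 1) → ℕ) (h : V → ℕ) (hR : R q) (F : AF q A (insert w U) h) (hI : Set.InjOn h (insert w U : Finset V)) :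
    ∃ q h, R q ∧ GS q A U w h (fun j => (A w j : ℤ)) ∧ Set.InjOn h U := by
  obtain ⟨q, h, hR, F, hI, hmin⟩ := flip_min hm R RG Rs (Finset.mem_insert_self w U) _ q h hR F hI rfl
  refine ⟨q, h, hR, ⟨fun i hi j hj c => F i (Finset.mem_insert_of_mem hi) j (Finset.mem_insert_of_mem hj) c, fun j hj c => ?_⟩,
    hI.mono (by simp)⟩
  rw [F w (Finset.mem_insert_self w U) j (Finset.mem_insert_of_mem hj) c]
  have hjw : j ≠ w := by rintro rfl; exact hw hj
  have := hmin j (Finset.mem_insert_of_mem hj) hjw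
  by_cases hc : c = 0
  · rw [if_pos (Or.inl ⟨hc, this⟩), if_pos hc]; simp
  · rw [if_neg, if_neg hc]
    · simp
    · rintro (h1 | h1)
      · exact hc h1.1
      · omega

theorem rank2 (hm : 1 ≤ m) (S : Set (V → V → ZMod (m + 1) → ℕ)) (hS : S.Finite) (RG : ∀ q ∈ S, Good q)
    (Rs : ∀ q v, q ∈ S → colMut m q v ∈ S) {A : V → V → ℕ} (hA : ∀ i j, A i j = A j i) {U : Finset V} {w : V} (hw : w ∉ U)
    {a b : V} (hab : a ≠ b) (hU : U = {a, b}) (hg : 2 ≤ A a b) (q : V → V → ZMod (m + 1) → ℕ) (h : V → ℕ) (hR : q ∈ S)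
    (G : GS q A U w h (fun j => (A w j : ℤ))) (hI : Set.InjOn h U) (hadj : ∃ u ∈ U, 0 < A w u) : False := by
  have key : ∀ N : ℕ, ∃ q a b h y, a ≠ b ∧ U = {a, b} ∧ 2 ≤ A a b ∧ q ∈ S ∧ GS q A U w h y ∧ h a < h b ∧ (N : ℤ) ≤ y a ∧ 1 ≤ y a + y b := by
    intro N
    induction N with
    | zero =>
      have hs : 1 ≤ (A w a : ℤ) + (A w b : ℤ) := by
        obtain ⟨u, hu, hu2⟩ := hadj
        rw [hU] at hu
        simp only [Finset.mem_insert, Finset.mem_singleton] at hu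
        rcases hu with rfl | rfl <;> omega
      have hne : h a ≠ h b := fun e => hab (hI (by simp [hU]) (by simp [hU]) e)
      rcases lt_or_gt_of_ne hne with h1 | h1
      · exact ⟨q, a, b, h, _, hab, hU, hg, hR, G, h1, by simp, hs⟩
      · exact ⟨q, b, a, h, _, hab.symm, by rw [hU, Finset.pair_comm], by rw [hA]; exact hg, hR, G, h1, by simp, by linarith⟩
    | succ N ih =>
      obtain ⟨q, a, b, h, y, hab, hU, hg, hR, G, hlt, hN, hp⟩ := ih
      let h' : V → ℕ := fun x => if x = a then 1 else 0
      let y' : V → ℤ := fun j => if j = a then - y a else y j + A a j * y a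
      have mem : ∀ x ∈ U, x ≠ a → x = b := fun x hx hxa => by
        rw [hU] at hx; simp only [Finset.mem_insert, Finset.mem_singleton] at hx; tauto
      have H : HStep U a h h' := ⟨fun x hx hxa => by rw [mem x hx hxa]; exact hlt, fun x hx hxa => by simp [h', hxa],
        fun x hx y hy hxa hya => by rw [mem x hx hxa, mem y hy hya]; simp⟩
      have G' := G.step hm (RG q hR) (y' := y') hw (by simp [hU]) H (by omega) (by simp [y']) (fun j _ hj => by simp [y', hj])
      refine ⟨_, b, a, h', y', hab.symm, by rw [hU, Finset.pair_comm], by rw [hA]; exact hg, Rs _ a hR, G', by simp [h', hab.symm], ?_, ?_⟩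
      · simp only [y', if_neg hab.symm]
        have : (2 : ℤ) ≤ A a b := by exact_mod_cast hg
        push_cast
        nlinarith
      · simp only [y', if_neg hab.symm, if_true]
        have : (2 : ℤ) ≤ A a b := by exact_mod_cast hg
        nlinarith
  obtain ⟨B, hB⟩ := (hS.image (fun q' => ∑ v, q' w v 0)).bddAbove
  obtain ⟨q, a, b, h, y, hab, hU, hg, hR, G, hlt, hN, hp⟩ := key (B + 1)
  have h1 : ∑ v, q w v 0 ≤ B := hB ⟨q, hR, rfl⟩
  have h2 : q w a 0 ≤ ∑ v, q w v 0 := Finset.single_le_sum (f := fun v => q w v 0) (fun _ _ => Nat.zero_le _) (Finset.mem_univ a)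
  rw [G.ww a (by simp [hU]) 0, if_pos rfl] at h2
  push_cast at hN
  omega
end Grow2

section Aff
variable {V : Type*} [Fintype V] [DecidableEq V] {Q : V → V → ℕ}

def pr (y x : V → ℤ) : ℤ := ∑ i, y i * x i
def stp (Q : V → V → ℕ) (v : V) (y : V → ℤ) : V → ℤ := fun j => if j = v then - y v else y j + QA Q v j * y v
def Ys (Q : V → V → ℕ) (u : ℕ → V) (a : V → ℤ) : ℕ → V → ℤ
  | 0 => a
  | t + 1 => stp Q (u t) (Ys Q u a t)

theorem pr_add (y x x' : V → ℤ) : pr y (x + x') = pr y x + pr y x' := by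
  simp only [pr, Pi.add_apply, mul_add, Finset.sum_add_distrib]
theorem pr_smul (y x : V → ℤ) (c : ℤ) : pr y (c • x) = c * pr y x := by
  simp only [pr, Pi.smul_apply, smul_eq_mul, Finset.mul_sum]; exact Finset.sum_congr rfl fun i _ => by ring
theorem pr_ev (y : V → ℤ) (i : V) : pr y (ev i) = y i := by
  simp [pr, Pi.single_apply]

theorem pr_step (hii : ∀ i, Q i i = 0) (v : V) (y x : V → ℤ) : pr (stp Q v y) x = pr y x - y v * bf Q (ev v) x := by
  rw [bf_ev]
  have h1 : ∀ j, stp Q v y j * x j = y j * x j + y v * (QA Q v j * x j) - (if j = v then 2 * y v * x v else 0) := by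
    intro j
    simp only [stp]
    split_ifs with e
    · subst e; simp [QA, hii]; ring
    · ring
  simp only [pr, h1, Finset.sum_sub_distrib, Finset.sum_add_distrib, Finset.sum_ite_eq', Finset.mem_univ, if_true, ← Finset.mul_sum]
  ring

theorem pr_step2 (hii : ∀ i, Q i i = 0) (v : V) (y x : V → ℤ) : pr (stp Q v y) x = pr y (x + (- bf Q (ev v) x) • ev v) := by
  rw [pr_step hii, pr_add, pr_smul, pr_ev]; ring

theorem N_refl (hii : ∀ i, Q i i = 0) (v : V) (x : V → ℤ) :
    EF Q (x + (- bf Q (ev v) x) • ev v) (x + (- bf Q (ev v) x) • ev v) = EF Q x x := by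
  rw [N_add, N_smul, N_ev hii, bf_smul_right, bf_comm x]; ring

theorem coh {U : Finset V} (M : MU Q U) {x : V → ℤ} (hx : sup U x) (hN : EF Q x x = 1) : 0 ≤ x ∨ x ≤ 0 := by
  by_contra hc
  push Not at hc
  obtain ⟨c1, c2⟩ := hc
  simp only [Pi.le_def, Pi.zero_apply, not_forall, not_le] at c1 c2
  obtain ⟨i, hi⟩ := c1
  obtain ⟨j, hj⟩ := c2
  let p : V → ℤ := fun k => max (x k) 0
  let n : V → ℤ := fun k => max (- x k) 0
  have hiU : i ∈ U := by by_contra h; rw [hx i h] at hi; omega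
  have hjU : j ∈ U := by by_contra h; rw [hx j h] at hj; omega
  have e : x = p - n := by funext k; simp only [p, n, Pi.sub_apply]; omega
  have p1 : 0 < EF Q p p := M.min p (fun h => by have := congrFun h j; simp only [p, Pi.zero_apply] at this; omega)
    (fun k hk => by simp [p, hx k hk]) ⟨i, hiU, by simp only [p]; omega⟩
  have n1 : 0 < EF Q n n := M.min n (fun h => by have := congrFun h i; simp only [n, Pi.zero_apply] at this; omega)
    (fun k hk => by simp [n, hx k hk]) ⟨j, hjU, by simp only [n]; omega⟩
  have h3 : bf Q p n ≤ 0 := bf_disj p n (fun k => le_max_right _ _) (fun k => le_max_right _ _) (fun k => by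
    simp only [p, n]
    rcases le_total (x k) 0 with h | h
    · rw [max_eq_right h, zero_mul]
    · rw [max_eq_right (a := - x k) (by omega), mul_zero])
  rw [e, N_sub] at hN
  omega

def Fh (Q : V → V → ℕ) (U : Finset V) (d : V → ℤ) (h : V → ℕ) (j : V) : ℤ := d j - ∑ i ∈ U, if h i < h j then (QA Q i j : ℤ) * d i else 0

theorem Fh_min {U : Finset V} {d : V → ℤ} {v : V} {h h' : V → ℕ} (H : HStep U v h h') : Fh Q U d h v = d v := by
  rw [Fh, Finset.sum_eq_zero, sub_zero]
  intro i hi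
  by_cases e : i = v
  · subst e; simp
  · have := H.mn i hi e; rw [if_neg (by omega)]

theorem Fh_step (hii : ∀ i, Q i i = 0) {U : Finset V} {d : V → ℤ} (ds : sup U d) (hd : ∀ k ∈ U, bf Q (ev k) d = 0) {v : V} (hv : v ∈ U) {h h' : V → ℕ} (H : HStep U v h h')
    {j : V} (hj : j ∈ U) : stp Q v (Fh Q U d h) j = Fh Q U d h' j := by
  simp only [stp]
  rw [Fh_min H]
  split_ifs with e
  · subst e
    have h1 := hd j hv
    rw [bf_ev] at h1
    have h2 : ∑ k, (QA Q j k : ℤ) * d k = ∑ i ∈ U, if h' i < h' j then (QA Q i j : ℤ) * d i else 0 := by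
      rw [← Finset.sum_subset (Finset.subset_univ U) (fun i _ hi => by rw [ds i hi, mul_zero])]
      refine Finset.sum_congr rfl fun i hi => ?_
      by_cases e : i = j
      · subst e; simp [QA, hii]
      · rw [if_pos (H.mx i hi e), QA_comm]
    rw [Fh, ← h2]; linarith
  · simp only [Fh]
    rw [← Finset.add_sum_erase U _ hv, ← Finset.add_sum_erase U _ hv, if_pos (H.mn j hj e), if_neg (by have := H.mx j hj e; omega)]
    have : ∑ x ∈ U.erase v, (if h x < h j then (QA Q x j : ℤ) * d x else 0) = ∑ x ∈ U.erase v, (if h' x < h' j then (QA Q x j : ℤ) * d x else 0) := by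
      refine Finset.sum_congr rfl fun i hi => ?_
      rw [Finset.mem_erase] at hi
      simp only [H.eq i hi.2 j hj hi.1 e]
    rw [this]; ring

theorem Ys_Fh (hii : ∀ i, Q i i = 0) {U : Finset V} {d : V → ℤ} (ds : sup U d) (hd : ∀ k ∈ U, bf Q (ev k) d = 0) {u : ℕ → V} (hu : ∀ t, u t ∈ U)
    {H : ℕ → V → ℕ} (hH : ∀ t, HStep U (u t) (H t) (H (t + 1))) (t : ℕ) : ∀ j ∈ U, Ys Q u (Fh Q U d (H 0)) t j = Fh Q U d (H t) j := by
  induction t with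
  | zero => intro j _; rfl
  | succ t ih =>
    intro j hj
    rw [← Fh_step hii ds hd (hu t) (hH t) hj]
    simp only [Ys, stp]
    rw [ih _ (hu t), ih j hj]

theorem pos_chain (hii : ∀ i, Q i i = 0) {U : Finset V} (M : MU Q U) {d : V → ℤ} (ds : sup U d) (dp : ∀ i ∈ U, 0 < d i) (hd : ∀ k ∈ U, bf Q (ev k) d = 0) {u : ℕ → V} (hu : ∀ t, u t ∈ U)
    {H : ℕ → V → ℕ} (hH : ∀ t, HStep U (u t) (H t) (H (t + 1))) (t : ℕ) (k : ℕ) : ∀ r, r + k = t →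
    ∃ x : V → ℤ, 0 ≤ x ∧ sup U x ∧ EF Q x x = 1 ∧ ∀ a, Ys Q u a t (u t) = pr (Ys Q u a r) x := by
  induction k with
  | zero =>
    intro r hr
    obtain rfl : r = t := by omega
    refine ⟨ev (u r), ev_nonneg _, fun i hi => ?_, N_ev hii _, fun a => (pr_ev _ _).symm⟩
    have : i ≠ u r := fun e => hi (e ▸ hu r)
    simp [this]
  | succ k ih =>
    intro r hr
    obtain ⟨x, x0, xs, xN, hx⟩ := ih (r + 1) (by omega)
    let x' := x + (- bf Q (ev (u r)) x) • ev (u r)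
    have hs : sup U x' := fun i hi => by
      have : i ≠ u r := fun e => hi (e ▸ hu r)
      simp [x', this, xs i hi]
    have hN : EF Q x' x' = 1 := by rw [N_refl hii, xN]
    have hp : ∀ a, Ys Q u a t (u t) = pr (Ys Q u a r) x' := fun a => by rw [hx a, Ys, pr_step2 hii]
    rcases coh M hs hN with h0 | h0
    · exact ⟨x', h0, hs, hN, hp⟩
    · exfalso
      have e : x = x (u r) • ev (u r) := by
        funext i
        by_cases hi : i = u r
        · subst hi; simp
        · have h1 : x' i ≤ 0 := h0 i
          have h2 : 0 ≤ x i := x0 i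
          simp [x', hi] at h1 ⊢
          omega
      have e1 : x (u r) = 1 := by
        have h2 : 0 ≤ x (u r) := x0 _
        rw [e, N_smul, N_ev hii] at xN
        nlinarith
      rw [e1, one_smul] at e
      have h1 := hx (Fh Q U d (H 0))
      rw [e, pr_ev, Ys_Fh hii ds hd hu hH t _ (hu t), Fh_min (hH t), Ys, stp, if_pos rfl, Ys_Fh hii ds hd hu hH r _ (hu r), Fh_min (hH r)] at h1
      have := dp _ (hu t)
      have := dp _ (hu r)
      omega

theorem pos_Ys (hii : ∀ i, Q i i = 0) {U : Finset V} (M : MU Q U) {d : V → ℤ} (ds : sup U d) (dp : ∀ i ∈ U, 0 < d i) (hd : ∀ k ∈ U, bf Q (ev k) d = 0) {u : ℕ → V} (hu : ∀ t, u t ∈ U)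
    {H : ℕ → V → ℕ} (hH : ∀ t, HStep U (u t) (H t) (H (t + 1))) (t : ℕ) (a : V → ℤ) (ha : 0 ≤ a) : 0 ≤ Ys Q u a t (u t) := by
  obtain ⟨x, x0, xs, xN, hx⟩ := pos_chain hii M ds dp hd hu hH t t 0 (by omega)
  rw [hx a]
  exact Finset.sum_nonneg fun i _ => mul_nonneg (ha i) (x0 i)

theorem pr_delta (hii : ∀ i, Q i i = 0) {U : Finset V} {d : V → ℤ} (hd : ∀ k ∈ U, bf Q (ev k) d = 0) {u : ℕ → V} (hu : ∀ t, u t ∈ U)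
    (a : V → ℤ) (t : ℕ) : pr (Ys Q u a t) d = pr a d := by
  induction t with
  | zero => rfl
  | succ t ih => rw [Ys, pr_step hii, hd _ (hu t), ih]; ring

def cmb (u : ℕ → V) (Z : ℕ → ℤ) (r : ℕ) : V → ℤ := ∑ k ∈ Finset.range r, Z k • ev (u k)

theorem cmb_succ (u : ℕ → V) (Z : ℕ → ℤ) (r : ℕ) : cmb u Z (r + 1) = cmb u Z r + Z r • ev (u r) := Finset.sum_range_succ _ _

theorem cmb_zero (u : ℕ → V) (Z : ℕ → ℤ) : cmb u Z 0 = 0 := by simp [cmb]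

theorem bf_zero_left (x : V → ℤ) : bf Q 0 x = 0 := by
  have := bf_smul_left (Q := Q) 0 0 x; simpa using this

theorem Ys_cmb (hii : ∀ i, Q i i = 0) (u : ℕ → V) (p : V → ℤ) (r : ℕ) (x : V → ℤ) :
    pr (Ys Q u p r) x = pr p x - bf Q (cmb u (fun k => Ys Q u p k (u k)) r) x := by
  induction r with
  | zero => rw [cmb_zero, bf_zero_left, sub_zero]; rfl
  | succ r ih => rw [Ys, pr_step hii, ih, cmb_succ, bf_add_left, bf_smul_left]; ring

theorem cmb_sup {U : Finset V} {u : ℕ → V} (hu : ∀ t, u t ∈ U) (Z : ℕ → ℤ) (r : ℕ) : sup U (cmb u Z r) := by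
  intro i hi
  simp only [cmb, Finset.sum_apply]
  apply Finset.sum_eq_zero
  intro k _
  have : i ≠ u k := fun e => hi (e ▸ hu k)
  simp [this]

theorem cmb_apply {u : ℕ → V} {n : ℕ} (inj : ∀ i < n, ∀ j < n, u i = u j → i = j) (Z : ℕ → ℤ) {k : ℕ} (hk : k < n) : cmb u Z n (u k) = Z k := by
  simp only [cmb, Finset.sum_apply]
  rw [Finset.sum_eq_single k]
  · simp
  · intro b hb hbk
    rw [Finset.mem_range] at hb
    have : u k ≠ u b := fun e => hbk (inj _ hb _ hk e.symm)
    simp [this]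
  · intro h; exact absurd (Finset.mem_range.mpr hk) h

theorem no_period (hii : ∀ i, Q i i = 0) {U : Finset V} (M : MU Q U) {d : V → ℤ} (ds : sup U d) (dp : ∀ i ∈ U, 0 < d i) (hd : ∀ k ∈ U, bf Q (ev k) d = 0) {u : ℕ → V} (hu : ∀ t, u t ∈ U)
    {n : ℕ} (inj : ∀ i < n, ∀ j < n, u i = u j → i = j) (surj : ∀ x ∈ U, ∃ k < n, u k = x)
    (p : V → ℤ) (hper : ∀ j ∈ U, Ys Q u p n j = p j) : pr p d = 0 := by
  set Z : ℕ → ℤ := fun k => Ys Q u p k (u k) with hZ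
  have zs := cmb_sup hu Z n
  have h1 : ∀ j ∈ U, bf Q (ev j) (cmb u Z n) = 0 := by
    intro j hj
    have := Ys_cmb hii u p n (ev j)
    rw [pr_ev, pr_ev, hper j hj] at this
    rw [bf_comm]; linarith
  have h2 : EF Q (cmb u Z n) (cmb u Z n) = 0 := by
    have := delta_N zs h1 zs
    rw [bf_self] at this; omega
  obtain ⟨k0, hk0⟩ : ∃ k, k ∈ U := ⟨u 0, hu 0⟩
  have h3 := (psd_U M ds dp hd zs hk0).2 h2
  set c := cmb u Z n k0
  have h4 : ∀ k < n, d k0 * Z k = c * d (u k) := by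
    intro k hk
    have := congrFun h3 (u k)
    simp only [Pi.smul_apply, smul_eq_mul] at this
    rwa [cmb_apply inj Z hk] at this
  let D : ℕ → ℤ := fun k => d (u k)
  have hDn : cmb u D n = d := by
    funext i
    by_cases hi : i ∈ U
    · obtain ⟨k, hk, rfl⟩ := surj i hi
      rw [cmb_apply inj D hk]
    · rw [cmb_sup hu D n i hi, ds i hi]
  have h5 : ∀ r ≤ n, d k0 • cmb u Z r = c • cmb u D r := by
    intro r hr
    simp only [cmb, Finset.smul_sum, smul_smul]
    refine Finset.sum_congr rfl fun k hk => ?_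
    rw [Finset.mem_range] at hk
    rw [h4 k (by omega)]
  have h6 : ∀ r ≤ n, d k0 * pr p (cmb u D r) = c * EF Q (cmb u D r) (cmb u D r) := by
    intro r
    induction r with
    | zero => intro _; rw [cmb_zero]; simp [pr, EF]
    | succ r ih =>
      intro hr
      have h7 := Ys_cmb hii u p r (ev (u r))
      rw [pr_ev, pr_ev] at h7
      have h8 : p (u r) = Z r + bf Q (cmb u Z r) (ev (u r)) := by
        have : Z r = Ys Q u p r (u r) := rfl
        rw [this, h7]; ring
      have h9 : d k0 * bf Q (cmb u Z r) (ev (u r)) = c * bf Q (cmb u D r) (ev (u r)) := by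
        rw [← bf_smul_left, h5 r (by omega), bf_smul_left]
      rw [cmb_succ, pr_add, pr_smul, pr_ev, N_add, N_smul, N_ev hii, bf_smul_right, h8]
      have := ih (by omega)
      have h10 : d k0 * Z r = c * D r := h4 r (by omega)
      linear_combination this + D r * h9 + D r * h10
  have := h6 n le_rfl
  rw [hDn] at this
  have h7 := delta_N ds hd ds
  rw [bf_self] at h7
  have h8 : EF Q d d = 0 := by omega
  rw [h8, mul_zero] at this
  exact (mul_eq_zero.mp this).resolve_left (dp k0 hk0).ne'

theorem stp_sum (v : V) {ι : Type*} (s : Finset ι) (f : ι → V → ℤ) : stp Q v (∑ k ∈ s, f k) = ∑ k ∈ s, stp Q v (f k) := by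
  funext j
  simp only [stp, Finset.sum_apply]
  split_ifs with e
  · rw [Finset.sum_neg_distrib]
  · rw [Finset.sum_add_distrib, Finset.mul_sum]

theorem Ys_sum {u : ℕ → V} {n : ℕ} (hp : ∀ k r, u (k * n + r) = u r) (a : V → ℤ) (s : Finset ℕ) (r : ℕ) :
    Ys Q u (∑ k ∈ s, Ys Q u a (k * n)) r = ∑ k ∈ s, Ys Q u a (k * n + r) := by
  induction r with
  | zero => rfl
  | succ r ih =>
    rw [Ys, ih, stp_sum]
    refine Finset.sum_congr rfl fun k _ => ?_
    rw [← add_assoc, Ys, hp]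

theorem pr_sum (s : Finset ℕ) (f : ℕ → V → ℤ) (x : V → ℤ) : pr (∑ k ∈ s, f k) x = ∑ k ∈ s, pr (f k) x := by
  simp only [pr, Finset.sum_apply, Finset.sum_mul]; exact Finset.sum_comm

theorem no_repeat (hii : ∀ i, Q i i = 0) {U : Finset V} (M : MU Q U) {d : V → ℤ} (ds : sup U d) (dp : ∀ i ∈ U, 0 < d i) (hd : ∀ k ∈ U, bf Q (ev k) d = 0) {u : ℕ → V} (hu : ∀ t, u t ∈ U)
    {n : ℕ} (inj : ∀ i < n, ∀ j < n, u i = u j → i = j) (surj : ∀ x ∈ U, ∃ k < n, u k = x) (hp : ∀ k r, u (k * n + r) = u r)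
    (a : V → ℤ) {s t : ℕ} (hst : s < t) (he : ∀ j ∈ U, Ys Q u a (s * n) j = Ys Q u a (t * n) j) : pr a d = 0 := by
  have h := no_period hii M ds dp hd hu inj surj (∑ k ∈ Finset.Ico s t, Ys Q u a (k * n)) (by
    intro j hj
    rw [Ys_sum hp]
    have h1 : ∀ k, k * n + n = (k + 1) * n := fun k => by ring
    simp only [h1, Finset.sum_apply]
    have h2 := Finset.sum_Ico_add' (fun k => Ys Q u a (k * n) j) s t 1
    rw [h2]
    have h3 := Finset.sum_Ico_succ_top (show s ≤ t by omega) (fun k => Ys Q u a (k * n) j)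
    have h4 := Finset.sum_eq_sum_Ico_succ_bot (show s < t + 1 by omega) (fun k => Ys Q u a (k * n) j)
    have := he j hj
    linarith)
  rw [pr_sum, Finset.sum_congr rfl (fun k _ => pr_delta hii hd hu a (k * n)), Finset.sum_const, Nat.card_Ico, nsmul_eq_mul] at h
  rcases mul_eq_zero.mp h with e | e
  · have : t - s = 0 := by exact_mod_cast e
    omega
  · exact e
end Aff

section Fwd
variable {V : Type*} [Fintype V] [DecidableEq V] {m : ℕ}

theorem enum_U (U : Finset V) (h : V → ℕ) (hI : Set.InjOn h U) (hU : 0 < U.card) :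
    ∃ (idx : V → ℕ) (u : ℕ → V), (∀ x ∈ U, ∀ y ∈ U, (idx x < idx y ↔ h x < h y)) ∧ (∀ x ∈ U, idx x < U.card) ∧
      (∀ x ∈ U, u (idx x) = x) ∧ (∀ k < U.card, u k ∈ U ∧ idx (u k) = k) := by
  classical
  let idx : V → ℕ := fun x => (U.filter (fun y => h y < h x)).card
  have mono : ∀ x ∈ U, ∀ y ∈ U, h x < h y → idx x < idx y := by
    intro x hx y hy hxy
    apply Finset.card_lt_card
    rw [Finset.ssubset_iff_of_subset]
    · exact ⟨x, by simp [hx, hxy], by simp⟩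
    · intro z; simp only [Finset.mem_filter]; rintro ⟨h1, h2⟩; exact ⟨h1, by omega⟩
  have mono2 : ∀ x ∈ U, ∀ y ∈ U, (idx x < idx y ↔ h x < h y) := by
    intro x hx y hy
    refine ⟨fun hl => ?_, mono x hx y hy⟩
    rcases lt_trichotomy (h x) (h y) with e | e | e
    · exact e
    · have := hI hx hy e; subst this; omega
    · have := mono y hy x hx e; omega
  have lt : ∀ x ∈ U, idx x < U.card := by
    intro x hx
    apply Finset.card_lt_card
    rw [Finset.ssubset_iff_of_subset (Finset.filter_subset _ _)]
    exact ⟨x, hx, by simp⟩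
  have inj : Set.InjOn idx U := by
    intro x hx y hy e
    by_contra hne
    have : h x ≠ h y := fun e => hne (hI hx hy e)
    rcases lt_or_gt_of_ne this with e1 | e1
    · have := mono x hx y hy e1; omega
    · have := mono y hy x hx e1; omega
  have img : U.image idx = Finset.range U.card := by
    apply Finset.eq_of_subset_of_card_le
    · intro k hk
      obtain ⟨x, hx, rfl⟩ := Finset.mem_image.mp hk
      exact Finset.mem_range.mpr (lt x hx)
    · rw [Finset.card_range, Finset.card_image_of_injOn inj]
  have ex : ∀ k, ∃ x, k < U.card → x ∈ U ∧ idx x = k := by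
    intro k
    by_cases hk : k < U.card
    · have : k ∈ U.image idx := by rw [img]; exact Finset.mem_range.mpr hk
      obtain ⟨x, hx, e⟩ := Finset.mem_image.mp this
      exact ⟨x, fun _ => ⟨hx, e⟩⟩
    · obtain ⟨x, hx⟩ := Finset.card_pos.mp hU
      exact ⟨x, fun h => absurd h hk⟩
  choose u hu using ex
  exact ⟨idx, u, mono2, lt, fun x hx => inj (hu _ (lt x hx)).1 hx (hu _ (lt x hx)).2, hu⟩

theorem affine (hm : 1 ≤ m) {Q : V → V → ℕ} (hii : ∀ i, Q i i = 0)
    (S : Set (V → V → ZMod (m + 1) → ℕ)) (hS : S.Finite) (RG : ∀ q ∈ S, Good q)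
    (Rs : ∀ q v, q ∈ S → colMut m q v ∈ S) {U : Finset V} {w : V} (hw : w ∉ U) (M : MU Q U)
    {d : V → ℤ} (ds : sup U d) (dp : ∀ i ∈ U, 0 < d i) (hd : ∀ k ∈ U, bf Q (ev k) d = 0)
    (q : V → V → ZMod (m + 1) → ℕ) (h : V → ℕ) (hR : q ∈ S)
    (G : GS q (QA Q) U w h (fun j => (QA Q w j : ℤ))) (hI : Set.InjOn h U) (hadj : ∃ u ∈ U, 0 < QA Q w u) : False := by
  have hU : 0 < U.card := by have := M.card hii; omega
  obtain ⟨idx, u0, hmono, hlt, hu1, hu2⟩ := enum_U U h hI hU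
  set n := U.card with hn
  let u : ℕ → V := fun t => u0 (t % n)
  have hu : ∀ t, u t ∈ U := fun t => (hu2 _ (Nat.mod_lt _ hU)).1
  have hui : ∀ t, idx (u t) = t % n := fun t => (hu2 _ (Nat.mod_lt _ hU)).2
  have hinjx : ∀ x ∈ U, ∀ y ∈ U, idx x = idx y → x = y := fun x hx y hy e => by rw [← hu1 x hx, e, hu1 y hy]
  have inj : ∀ i < n, ∀ j < n, u i = u j → i = j := by
    intro i hi j hj e
    have := congrArg idx e
    rw [hui, hui, Nat.mod_eq_of_lt hi, Nat.mod_eq_of_lt hj] at this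
    exact this
  have surj : ∀ x ∈ U, ∃ k < n, u k = x := fun x hx => ⟨idx x, hlt x hx, by
    simp only [u]; rw [Nat.mod_eq_of_lt (hlt x hx), hu1 x hx]⟩
  have hp : ∀ k r, u (k * n + r) = u r := fun k r => by
    simp only [u]; rw [mul_comm, Nat.mul_add_mod]
  let H : ℕ → V → ℕ := fun t x => if idx x < t % n then n + idx x else idx x
  have hH : ∀ t, HStep U (u t) (H t) (H (t + 1)) := by
    intro t
    have hv := hui t
    have hk := Nat.mod_lt t hU
    have hk1 : ((t + 1) % n = t % n + 1 ∧ t % n + 1 < n) ∨ ((t + 1) % n = 0 ∧ t % n + 1 = n) := by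
      rw [Nat.add_mod_eq_ite]
      by_cases h1 : n = 1
      · right; rw [h1]; simp [Nat.mod_one]
      · rw [Nat.mod_eq_of_lt (show 1 < n by omega)]
        split_ifs with h2 <;> omega
    have ne : ∀ x ∈ U, x ≠ u t → idx x ≠ t % n := fun x hx hxv e => hxv (hinjx x hx _ (hu t) (by rw [e, hv]))
    refine ⟨fun x hx hxv => ?_, fun x hx hxv => ?_, fun x hx y hy hxv hyv => ?_⟩
    · have := ne x hx hxv
      have := hlt x hx
      simp only [H, hv]
      split_ifs <;> omega
    · have := ne x hx hxv
      have := hlt x hx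
      simp only [H, hv]
      split_ifs <;> omega
    · have := ne x hx hxv
      have := hlt x hx
      have := ne y hy hyv
      have := hlt y hy
      simp only [H]
      split_ifs <;> omega
  let a : V → ℤ := fun j => (QA Q w j : ℤ)
  have ha : 0 ≤ a := fun j => by simp [a]
  let g : ℕ → (V → V → ZMod (m + 1) → ℕ) := fun t => Nat.rec q (fun k x => colMut m x (u k)) t
  have key : ∀ t, g t ∈ S ∧ GS (g t) (QA Q) U w (H t) (Ys Q u a t) := by
    intro t
    induction t with
    | zero =>
      refine ⟨hR, ⟨fun i hi j hj c => ?_, G.ww⟩⟩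
      have e1 : ∀ x, H 0 x = idx x := fun x => by simp [H]
      simp only [e1, hmono i hi j hj, hmono j hj i hi]
      exact G.af i hi j hj c
    | succ t ih =>
      refine ⟨Rs _ _ ih.1, ?_⟩
      exact ih.2.step hm (RG _ ih.1) hw (hu t) (hH t) (pos_Ys hii M ds dp hd hu hH t a ha) (by simp [Ys, stp])
        (fun j hj hjv => by simp [Ys, stp, hjv])
  have hrep : ∃ s t, s < t ∧ g (s * n) = g (t * n) := by
    have : Finite S := hS
    obtain ⟨x, y, hxy, e⟩ := Finite.exists_ne_map_eq_of_infinite (fun k : ℕ => (⟨g (k * n), (key _).1⟩ : S))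
    have e' := congrArg Subtype.val e
    rcases lt_or_gt_of_ne hxy with h1 | h1
    · exact ⟨x, y, h1, e'⟩
    · exact ⟨y, x, h1, e'.symm⟩
  obtain ⟨s, t, hst, e⟩ := hrep
  have h0 := no_repeat hii M ds dp hd hu inj surj hp a hst (by
    intro j hj
    have e0 := (key (s * n)).2.ww j hj 0
    have e1 := (key (s * n)).2.ww j hj 1
    have f0 := (key (t * n)).2.ww j hj 0
    have f1 := (key (t * n)).2.ww j hj 1
    rw [if_pos rfl] at e0 f0
    rw [if_neg (zm10 hm), if_pos rfl] at e1 f1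
    rw [e] at e0 e1
    omega)
  obtain ⟨x, hx, hx2⟩ := hadj
  have h1 : 0 < pr a d := by
    apply Finset.sum_pos'
    · intro i _
      by_cases hi : i ∈ U
      · exact mul_nonneg (ha i) (dp i hi).le
      · rw [ds i hi, mul_zero]
    · exact ⟨x, Finset.mem_univ x, mul_pos (by simp only [a]; exact_mod_cast hx2) (dp x hx)⟩
  omega

theorem forward (hm : 1 ≤ m)
    (q₀ : V → V → ℕ)
    (hacyclic : ∀ i : V, ¬ Relation.TransGen (fun a b => 0 < q₀ a b) i i)
    (hconn : (SimpleGraph.fromRel (fun i j => 0 < q₀ i j)).Connected)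
    (q : V → V → ZMod (m + 1) → ℕ)
    (hq0 : ∀ i j, q i j 0 = q₀ i j)
    (hqm : ∀ i j, q i j (m : ZMod (m + 1)) = q₀ j i)
    (hqother : ∀ i j (c : ZMod (m + 1)), c ≠ 0 → c ≠ (m : ZMod (m + 1)) → q i j c = 0)
    (hfin : {q' : V → V → ZMod (m + 1) → ℕ |
        Relation.ReflTransGen (fun a b => ∃ v, b = colMut m a v) q q'}.Finite)
    (hcard : ¬ Fintype.card V ≤ 2) (x : V → ℤ) : 0 ≤ EF q₀ x x := by
  have I := isSt_init hm q₀ hacyclic q hq0 hqm hqother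
  have hii : ∀ i, q₀ i i = 0 := fun i => by
    by_contra h; exact hacyclic i (Relation.TransGen.single (Nat.pos_of_ne_zero h))
  by_contra hneg
  push Not at hneg
  set S := {q' : V → V → ZMod (m + 1) → ℕ | Relation.ReflTransGen (fun a b => ∃ v, b = colMut m a v) q q'} with hS
  have RG : ∀ q' ∈ S, Good q' := by
    intro q' hq'
    obtain ⟨X, r, st, rfl⟩ := st_reach hm I hq'
    exact good_qof st
  have Rs : ∀ q' v, q' ∈ S → colMut m q' v ∈ S := fun q' v h => Relation.ReflTransGen.tail h ⟨v, rfl⟩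
  have hq : q ∈ S := Relation.ReflTransGen.refl
  obtain ⟨U, M⟩ := MU_exists (Q := q₀) Finset.univ ⟨x, fun h => by rw [h] at hneg; simp [EF] at hneg, fun i hi => absurd (Finset.mem_univ i) hi, hneg.le⟩
  have hc2 := M.card hii
  have hne : ∃ w, w ∉ U := by
    by_contra hc
    push Not at hc
    have hU : U = Finset.univ := Finset.eq_univ_iff_forall.mpr hc
    have h3 : 3 ≤ U.card := by rw [hU, Finset.card_univ]; omega
    obtain ⟨z, zs, zp, hz⟩ := lemO hii M h3
    obtain ⟨k, hk⟩ := Finset.card_pos.mp (show 0 < U.card by omega)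
    have := (psd_U M zs zp hz (x := x) (fun i hi => absurd (hc i) hi) hk).1
    omega
  obtain ⟨w, hw, hadj⟩ : ∃ w, w ∉ U ∧ ∃ u ∈ U, 0 < QA q₀ w u := by
    obtain ⟨w0, hw0⟩ := hne
    obtain ⟨k, hk⟩ := Finset.card_pos.mp (show 0 < U.card by omega)
    obtain ⟨p⟩ := hconn.preconnected k w0
    obtain ⟨dd, -, h1, h2⟩ := p.exists_boundary_dart (U : Set V) hk hw0
    refine ⟨dd.snd, h2, dd.fst, h1, ?_⟩
    have := dd.adj
    rw [SimpleGraph.fromRel_adj] at this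
    simp only [QA]
    rcases this.2 with h | h <;> omega
  obtain ⟨r, hr, hlt⟩ := acyc_rank q₀ hacyclic
  have hm1 : ((m : ZMod (m + 1))) = -1 := by
    have : ((m + 1 : ℕ) : ZMod (m + 1)) = 0 := ZMod.natCast_self _
    push_cast at this
    linear_combination this
  have F : AF q (QA q₀) (insert w U) r := by
    intro i _ j _ c
    have z := zm01 hm
    have a1 : 0 < q₀ i j → r i < r j := hlt i j
    have a2 : 0 < q₀ j i → r j < r i := hlt j i
    by_cases c0 : c = 0
    · subst c0
      rw [hq0]
      simp only [true_and, z, false_and, or_false, QA]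
      split_ifs <;> omega
    by_cases c1 : c = -1
    · rw [c1, ← hm1, hqm, hm1]
      simp only [z.symm, false_and, true_and, false_or, QA]
      split_ifs <;> omega
    · rw [hqother i j c c0 (by rw [hm1]; exact c1)]
      simp [c0, c1]
  obtain ⟨q1, h, hR, G, hI⟩ := grow_init hm (· ∈ S) RG Rs hw q r hq F hr.injOn
  by_cases h2 : U.card = 2
  · obtain ⟨a, b, hab, hU⟩ := Finset.card_eq_two.mp h2
    subst hU
    exact rank2 hm S hfin RG Rs (QA_comm q₀) hw hab rfl (M.two hii hab) q1 h hR G hI hadj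
  · obtain ⟨z, zs, zp, hz⟩ := lemO hii M (by omega)
    exact affine hm hii S hfin RG Rs hw M zs zp hz q1 h hR G hI hadj
end Fwd

theorem colMut_class_finite_iff (m : ℕ) (hm : 1 ≤ m)
    {V : Type*} [Fintype V] [DecidableEq V] [Nonempty V]
    (q₀ : V → V → ℕ)
    (hacyclic : ∀ i : V, ¬ Relation.TransGen (fun a b => 0 < q₀ a b) i i)
    (hconn : (SimpleGraph.fromRel (fun i j => 0 < q₀ i j)).Connected)
    (q : V → V → ZMod (m + 1) → ℕ)
    (hq0 : ∀ i j, q i j 0 = q₀ i j)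
    (hqm : ∀ i j, q i j (m : ZMod (m + 1)) = q₀ j i)
    (hqother : ∀ i j (c : ZMod (m + 1)), c ≠ 0 → c ≠ (m : ZMod (m + 1)) → q i j c = 0) :
    {q' : V → V → ZMod (m + 1) → ℕ |
        Relation.ReflTransGen (fun a b => ∃ v, b = colMut m a v) q q'}.Finite ↔
      (Fintype.card V ≤ 2 ∨
        (Matrix.of (fun i j : V =>
          if i = j then (2 : ℤ) else -((q₀ i j : ℤ) + (q₀ j i : ℤ)))).PosSemidef) := by
  refine ⟨fun hfin => ?_, backward m hm q₀ hacyclic q hq0 hqm hqother⟩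
  by_cases hcard : Fintype.card V ≤ 2
  · exact Or.inl hcard
  right
  have hii : ∀ i, q₀ i i = 0 := fun i => by
    by_contra h; exact hacyclic i (Relation.TransGen.single (Nat.pos_of_ne_zero h))
  apply Matrix.PosSemidef.of_dotProduct_mulVec_nonneg
  · ext i j
    simp only [Matrix.conjTranspose_apply, Matrix.of_apply, star_trivial]
    by_cases h : i = j
    · subst h; rfl
    · rw [if_neg h, if_neg (Ne.symm h), add_comm]
  · intro x
    have h1 := forward hm q₀ hacyclic hconn q hq0 hqm hqother hfin hcard x
    have h2 := EF_quad q₀ hii x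
    simp only [Matrix.mulVec, dotProduct, Matrix.of_apply, star_trivial, Finset.mul_sum]
    rw [h2]
    linarith
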